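/- arXiv:1104.0838 — 9 statements merged into one kernel-verified Lean document; each statement's English description precedes it below -/
import Mathlib

section
/- Let A₁,…,A_k ∈ M_n(ℂ) be pairwise commuting matrices. Then ℂⁿ is the internal direct sum of the joint generalized eigenspaces N(𝐀,λ) as λ ranges over ℂᵏ (equivalently, over the finite set spec(A₁)×…×spec(A_k), since N(𝐀,λ) is trivial for other λ): the family of subspaces {N(𝐀,λ)}_{λ∈ℂᵏ} is independent and their sum equals ℂⁿ. -/
/-- The kernel of `(M - μ • 1) ^ n`, for `M` of size `n`, is the maximal generalized eigenspace of
the endomorphism `M` defines. -/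
theorem Matrix.ker_mulVecLin_sub_smul_one_pow {K : Type*} [Field K] {n : ℕ}
    (M : Matrix (Fin n) (Fin n) K) (μ : K) :
    LinearMap.ker ((M - μ • (1 : Matrix (Fin n) (Fin n) K)) ^ n).mulVecLin =
      Module.End.maxGenEigenspace (Matrix.toLinAlgEquiv' M) μ := by
  rw [Module.End.maxGenEigenspace_eq_genEigenspace_finrank, Module.finrank_fin_fun,
    Module.End.genEigenspace_nat]
  change LinearMap.ker (Matrix.toLinAlgEquiv' ((M - μ • 1) ^ n)) = _
  rw [map_pow, map_sub, map_smul, map_one]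

/-- For pairwise commuting complex matrices `A 1, …, A k`, the space `ℂⁿ` is the internal
direct sum of the joint generalized eigenspaces
`N(𝐀,λ) = ⋂ j, ker((A j - λ j · 1)ⁿ)`, as `λ` ranges over `ℂᵏ`: the family of these
subspaces is independent and their supremum is all of `ℂⁿ`. -/
theorem directSum_joint_genEigenspaces
    (n k : ℕ) (A : Fin k → Matrix (Fin n) (Fin n) ℂ)
    (hcomm : ∀ i j, Commute (A i) (A j)) :
    iSupIndep (fun lam : Fin k → ℂ => ⨅ j, LinearMap.ker
        (((A j - lam j • (1 : Matrix (Fin n) (Fin n) ℂ)) ^ n).mulVecLin))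
    ∧ (⨆ lam : Fin k → ℂ, ⨅ j, LinearMap.ker
        (((A j - lam j • (1 : Matrix (Fin n) (Fin n) ℂ)) ^ n).mulVecLin)) = ⊤ := by
  simp only [Matrix.ker_mulVecLin_sub_smul_one_pow]
  have hmaps (i j : Fin k) (φ : ℂ) :=
    Module.End.mapsTo_maxGenEigenspace_of_comm
      ((hcomm j i).map (Matrix.toLinAlgEquiv' (R := ℂ) (n := Fin n))) φ
  exact ⟨Module.End.independent_iInf_maxGenEigenspace_of_forall_mapsTo
      (fun i => Matrix.toLinAlgEquiv' (A i)) hmaps,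
    Module.End.iSup_iInf_maxGenEigenspace_eq_top_of_forall_mapsTo
      (fun i => Matrix.toLinAlgEquiv' (A i)) hmaps
      fun i => Module.End.iSup_maxGenEigenspace_eq_top _⟩
end

section
/- Let A₁,…,A_k ∈ M_n(ℝ) be pairwise commuting real matrices. Then there exist B ∈ GL(n,ℝ), a number ℓ ∈ ℕ, and for each r = 1,…,ℓ a choice K_r ∈ {ℝ, ℂ} and d_r ∈ ℕ with Σ_{r=1}^ℓ d_r · dim_ℝ(K_r) = n, such that for every j = 1,…,k the matrix B A_j B⁻¹ is block diagonal with ℓ diagonal blocks A_{j,1},…,A_{j,ℓ}, where: if K_r = ℝ, then A_{j,r} is a d_r×d_r real matrix of the form λ·1 + N with λ ∈ ℝ and N strictly upper triangular; and if K_r = ℂ, then A_{j,r} = i_ℂ(λ·1 + N) for some λ ∈ ℂ and some strictly upper triangular N ∈ M_{d_r}(ℂ). Moreover, K_1 = … = K_ℓ = ℝ holds if and only if every eigenvalue of every A_j is real. -/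
/-- `iC M` is the real `2d × 2d` matrix obtained from a complex `d × d` matrix `M` by
replacing each entry `a + b i` by the `2 × 2` block `[[a, -b], [b, a]]`; row `2p + s`
(with `s < 2`) of `iC M` corresponds to row `p` of `M`. -/
noncomputable def iC {d : ℕ} (M : Matrix (Fin d) (Fin d) ℂ) :
    Matrix (Fin (d * 2)) (Fin (d * 2)) ℝ :=
  Matrix.of fun i j =>
    let a : ℂ := M ⟨i.val / 2, by have := i.isLt; omega⟩ ⟨j.val / 2, by have := j.isLt; omega⟩
    if i.val % 2 = 0 then (if j.val % 2 = 0 then a.re else -a.im)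
    else (if j.val % 2 = 0 then a.im else a.re)

/-- A matrix is strictly upper triangular if all entries on and below the diagonal vanish. -/
def IsStrictlyUpperTriangular {d : ℕ} {R : Type*} [Zero R]
    (N : Matrix (Fin d) (Fin d) R) : Prop :=
  ∀ p q : Fin d, q ≤ p → N p q = 0

/-- A commuting family of nilpotent endomorphisms of a nonzero finite-dimensional space maps the
whole space into a common proper subspace. -/
theorem exists_lt_top_forall_range_le {K V ι : Type*} [Field K] [AddCommGroup V] [Module K V]
    [FiniteDimensional K V] [Nontrivial V] (T : ι → Module.End K V)
    (hT : ∀ i j, Commute (T i) (T j)) (hnil : ∀ i, IsNilpotent (T i)) :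
    ∃ W : Submodule K V, W < ⊤ ∧ ∀ i, LinearMap.range (T i) ≤ W := by
  obtain ⟨W, ⟨hW, hinv⟩, hmax⟩ := WellFounded.has_min (wellFounded_gt (α := Submodule K V))
    {W | W < ⊤ ∧ ∀ i, W.map (T i) ≤ W} ⟨⊥, bot_lt_top, by simp⟩
  refine ⟨W, hW, fun i => ?_⟩
  by_contra hi
  have htop : W ⊔ LinearMap.range (T i) = ⊤ := by
    by_contra h
    refine hmax (W ⊔ LinearMap.range (T i)) ⟨lt_top_iff_ne_top.2 h, fun j => ?_⟩
      (left_lt_sup.2 hi)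
    rw [Submodule.map_sup]
    refine sup_le_sup (hinv j) ?_
    rintro _ ⟨_, ⟨x, rfl⟩, rfl⟩
    exact ⟨T j x, LinearMap.congr_fun (hT i j).eq x⟩
  have key : ∀ m : ℕ, W ⊔ LinearMap.range (T i ^ m) = ⊤ := by
    intro m
    induction m with
    | zero => simp [Module.End.one_eq_id]
    | succ m ih =>
      rw [eq_top_iff, ← htop]
      refine sup_le le_sup_left ?_
      rw [← Submodule.map_top, ← ih, Submodule.map_sup]
      refine sup_le_sup (hinv i) ?_
      rw [pow_succ', Module.End.mul_eq_comp, LinearMap.range_comp]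
  obtain ⟨m, hm⟩ := hnil i
  have := key m
  rw [hm] at this
  simp only [LinearMap.range_zero, bot_le, sup_of_le_left] at this
  exact hW.ne this

/-- A commuting family of nilpotent endomorphisms is simultaneously strictly upper triangular in
a suitable basis. -/
theorem exists_basis_isStrictlyUpperTriangular {K V ι : Type*} [Field K] [AddCommGroup V]
    [Module K V] [FiniteDimensional K V] (T : ι → Module.End K V)
    (hT : ∀ i j, Commute (T i) (T j)) (hnil : ∀ i, IsNilpotent (T i)) :
    ∃ (d : ℕ) (b : Module.Basis (Fin d) K V),
      ∀ i, IsStrictlyUpperTriangular (LinearMap.toMatrix b b (T i)) := by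
  simp only [IsStrictlyUpperTriangular, LinearMap.toMatrix_apply]
  obtain ⟨d, hd⟩ : ∃ d, Module.finrank K V = d := ⟨_, rfl⟩
  induction d generalizing V with
  | zero =>
    exact ⟨0, Module.finBasisOfFinrankEq K V hd, fun _ p => p.elim0⟩
  | succ d ih =>
    have : Nontrivial V := Module.nontrivial_of_finrank_eq_succ hd
    obtain ⟨W, hW, hTW⟩ := exists_lt_top_forall_range_le T hT hnil
    obtain ⟨f, hf, hWf⟩ := Submodule.exists_le_ker_of_lt_top W hW
    have hfin := Module.Dual.finrank_ker_add_one_of_ne_zero hf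
    have hTf : ∀ i x, T i x ∈ LinearMap.ker f := fun i x => hWf (hTW i ⟨x, rfl⟩)
    let S : ι → Module.End K (LinearMap.ker f) := fun i => (T i).restrict fun x _ => hTf i x
    obtain ⟨d', b, hb⟩ := ih S
      (fun i j => LinearMap.ext fun x => Subtype.ext <| LinearMap.congr_fun (hT i j).eq (x : V))
      (fun i => by
        obtain ⟨m, hm⟩ := hnil i
        refine ⟨m, LinearMap.ext fun x => Subtype.ext ?_⟩
        rw [Module.End.pow_restrict m fun x _ => hTf i x]
        exact LinearMap.congr_fun hm (x : V))
      (by omega)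
    obtain ⟨y, hy⟩ : ∃ y, f y ≠ 0 := by
      by_contra! h
      exact hf (LinearMap.ext h)
    let b' := Module.Basis.mkFinSnoc b y
      (by
        intro c x hx h
        have := congrArg f h
        rw [LinearMap.mem_ker] at hx
        simpa [hx, hy] using this)
      (by
        intro z
        refine ⟨-(f z / f y), ?_⟩
        simp [LinearMap.mem_ker, hy])
    have hcast : ∀ p : Fin d', b' p.castSucc = b p := fun p => by simp [b']
    have hlast : b' (Fin.last d') = y := by simp [b']
    have hrepr : ∀ x : LinearMap.ker f, b'.repr x = (b.repr x).mapDomain Fin.castSucc := by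
      intro x
      apply b'.repr.symm.injective
      rw [LinearEquiv.symm_apply_apply, Module.Basis.repr_symm_apply,
        Finsupp.linearCombination_mapDomain]
      have : (b' ∘ Fin.castSucc : Fin d' → V) = (LinearMap.ker f).subtype ∘ b :=
        funext hcast
      rw [this, ← Finsupp.apply_linearCombination, Module.Basis.linearCombination_repr]
      rfl
    refine ⟨d' + 1, b', fun i p q hpq => ?_⟩
    have h1 : T i (b' q) = ((⟨T i (b' q), hTf i _⟩ : LinearMap.ker f) : V) := rfl
    rw [h1, hrepr]
    induction p using Fin.lastCases with
    | last =>
      exact Finsupp.mapDomain_of_notMem_range _ _ (by simp)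
    | cast p =>
      rw [Finsupp.mapDomain_apply (Fin.castSucc_injective d')]
      induction q using Fin.lastCases with
      | last => exact absurd hpq (not_le.2 (Fin.castSucc_lt_last p))
      | cast q =>
        convert hb i p q (Fin.castSucc_le_castSucc_iff.1 hpq) using 3
        exact Subtype.ext (by rw [hcast]; rfl)

/-- Restricting scalars from `ℂ` to `ℝ` turns the matrix of a `ℂ`-linear map into its image
under `iC`. -/
theorem toMatrix_restrictScalars_eq_iC {V : Type*} [AddCommGroup V] [Module ℝ V] [Module ℂ V]
    [IsScalarTower ℝ ℂ V] {d : ℕ} (b : Module.Basis (Fin d) ℂ V) (F : V →ₗ[ℂ] V) :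
    LinearMap.toMatrix ((Complex.basisOneI.smulTower' b).reindex finProdFinEquiv)
      ((Complex.basisOneI.smulTower' b).reindex finProdFinEquiv) (F.restrictScalars ℝ) =
      iC (LinearMap.toMatrix b b F) := by
  ext i j
  obtain ⟨⟨p, s⟩, rfl⟩ := finProdFinEquiv.surjective i
  obtain ⟨⟨q, t⟩, rfl⟩ := finProdFinEquiv.surjective j
  have hdiv : ∀ (p : Fin d) (s : Fin 2) (h : ((finProdFinEquiv (p, s)).val / 2) < d),
      (⟨(finProdFinEquiv (p, s)).val / 2, h⟩ : Fin d) = p := by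
    intro p s h
    ext
    simp only [finProdFinEquiv_apply_val]
    omega
  have hmod : ∀ (p : Fin d) (s : Fin 2), (finProdFinEquiv (p, s)).val % 2 = s := by
    intro p s
    simp only [finProdFinEquiv_apply_val]
    omega
  simp only [iC, Matrix.of_apply, hdiv, hmod, LinearMap.toMatrix_apply,
    Module.Basis.repr_reindex_apply, Module.Basis.reindex_apply, Equiv.symm_apply_apply,
    Module.Basis.smulTower'_repr, Module.Basis.smulTower'_apply,
    LinearMap.coe_restrictScalars, map_smul, Finsupp.smul_apply, smul_eq_mul]
  fin_cases s <;> fin_cases t <;> simp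

/-- If the kernel of a character `R → ℂ` acts nilpotently on `V`, elements of `R` on which the
character is real act simultaneously as a scalar plus a strictly upper triangular matrix. -/
theorem exists_basis_real_block {R V κ : Type*} [CommRing R] [Algebra ℝ R] [AddCommGroup V]
    [Module ℝ V] [Module R V] [IsScalarTower ℝ R V] [FiniteDimensional ℝ V]
    (ψ : R →ₐ[ℝ] ℂ) (N : ℕ) (hN : ∀ x ∈ RingHom.ker ψ ^ N, ∀ v : V, x • v = 0)
    (a : κ → R) (ha : ∀ j, (ψ (a j)).im = 0) :
    ∃ (d : ℕ) (b : Module.Basis (Fin d) ℝ V), ∀ j, ∃ (lam : ℝ) (M : Matrix (Fin d) (Fin d) ℝ),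
      IsStrictlyUpperTriangular M ∧
      LinearMap.toMatrix b b (Algebra.lsmul ℝ ℝ V (a j)) = lam • 1 + M := by
  let t : κ → R := fun j => a j - algebraMap ℝ R (ψ (a j)).re
  have ht : ∀ j, t j ∈ RingHom.ker ψ := by
    intro j
    simp [t, RingHom.mem_ker, Complex.ext_iff, ha j]
  obtain ⟨d, b, hb⟩ := exists_basis_isStrictlyUpperTriangular
    (fun j => Algebra.lsmul ℝ ℝ V (t j)) (fun i j => (Commute.all (t i) (t j)).map _)
    (fun j => ⟨N, by
      rw [← map_pow]
      exact LinearMap.ext fun v => hN _ (Ideal.pow_mem_pow (ht j) N) v⟩)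
  refine ⟨d, b, fun j => ⟨(ψ (a j)).re, _, hb j, ?_⟩⟩
  simp only [t, map_sub, Algebra.algebraMap_eq_smul_one, map_smul, map_one,
    LinearMap.toMatrix_one]
  abel

/-- If the kernel of a character `R → ℂ` acts nilpotently on `V` and the character takes the value
`i`, then some element of `R` on which it takes the value `i` acts as a complex structure. -/
theorem exists_smul_smul_eq_neg {R V : Type*} [CommRing R] [Algebra ℝ R] [AddCommGroup V]
    [Module R V] (ψ : R →ₐ[ℝ] ℂ) (N : ℕ) (hN : ∀ x ∈ RingHom.ker ψ ^ N, ∀ v : V, x • v = 0)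
    (x : R) (hx : ψ x = Complex.I) :
    ∃ y : R, ψ y = Complex.I ∧ ∀ v : V, y • y • v = -v := by
  let I := RingHom.ker ψ ^ (N + 1)
  have hnil : IsNilpotent (Ideal.Quotient.mk I x ^ 2 + 1) := by
    refine ⟨N + 1, ?_⟩
    rw [← map_pow, ← map_one (Ideal.Quotient.mk I), ← map_add, ← map_pow,
      Ideal.Quotient.eq_zero_iff_mem]
    exact Ideal.pow_mem_pow (by simp [RingHom.mem_ker, hx]) (N + 1)
  have hunit : IsUnit (algebraMap ℝ (R ⧸ I) 2 * Ideal.Quotient.mk I x) := by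
    refine ((IsUnit.mk0 (2 : ℝ) two_ne_zero).map _).mul ((isUnit_pow_iff two_ne_zero).1 ?_)
    simpa using hnil.isUnit_add_left_of_commute (u := (-1 : R ⧸ I)) isUnit_one.neg
      (Commute.all _ _)
  obtain ⟨r, ⟨hr1, hr2⟩, -⟩ := Polynomial.existsUnique_nilpotent_sub_and_aeval_eq_zero
    (R := ℝ) (P := Polynomial.X ^ 2 + 1) (x := Ideal.Quotient.mk I x)
    (by simpa using hnil)
    (by
      convert hunit using 1
      simp only [Polynomial.derivative_add, Polynomial.derivative_X_sq, Polynomial.derivative_one,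
        add_zero, map_mul, Polynomial.aeval_C, Polynomial.aeval_X])
  obtain ⟨y, rfl⟩ := Ideal.Quotient.mk_surjective r
  refine ⟨y, ?_, fun v => ?_⟩
  · obtain ⟨m, hm⟩ := hr1
    rw [← map_sub, ← map_pow, Ideal.Quotient.eq_zero_iff_mem] at hm
    have := Ideal.pow_le_self N.succ_ne_zero hm
    rw [RingHom.mem_ker, map_pow] at this
    have := eq_zero_of_pow_eq_zero this
    rw [map_sub, hx, sub_eq_zero] at this
    exact this.symm
  · have h : y ^ 2 + 1 ∈ I := by
      rw [← Ideal.Quotient.eq_zero_iff_mem]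
      simpa using hr2
    have := hN _ (Ideal.pow_le_pow_right N.le_succ h) v
    rw [add_smul, one_smul, pow_two, mul_smul] at this
    exact eq_neg_of_add_eq_zero_left this

/-- If the kernel of a character `R → ℂ` acts nilpotently on `V` and the character takes the value
`i`, elements of `R` act simultaneously as the image under `iC` of a complex scalar plus a strictly
upper triangular complex matrix. -/
theorem exists_basis_complex_block {R V κ : Type*} [CommRing R] [Algebra ℝ R] [AddCommGroup V]
    [Module ℝ V] [Module R V] [IsScalarTower ℝ R V] [FiniteDimensional ℝ V]
    (ψ : R →ₐ[ℝ] ℂ) (N : ℕ) (hN : ∀ x ∈ RingHom.ker ψ ^ N, ∀ v : V, x • v = 0)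
    (a : κ → R) (x : R) (hx : ψ x = Complex.I) :
    ∃ (d : ℕ) (b : Module.Basis (Fin (d * 2)) ℝ V), ∀ j,
      ∃ (lam : ℂ) (M : Matrix (Fin d) (Fin d) ℂ), IsStrictlyUpperTriangular M ∧
      LinearMap.toMatrix b b (Algebra.lsmul ℝ ℝ V (a j)) = iC (lam • 1 + M) := by
  obtain ⟨y, hy, hyy⟩ := exists_smul_smul_eq_neg (V := V) ψ N hN x hx
  let φ : ℂ →ₐ[ℝ] Module.End ℝ V := Complex.lift ⟨Algebra.lsmul ℝ ℝ V y, LinearMap.ext hyy⟩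
  let : Module ℂ V := Module.compHom V φ.toRingHom
  have hsmul : ∀ (z : ℂ) (v : V),
      z • v = (algebraMap ℝ R z.re + algebraMap ℝ R z.im * y) • v := by
    intro z v
    have : z • v = φ z v := rfl
    rw [this]
    simp [φ, Complex.liftAux_apply, add_smul, mul_smul, algebraMap_smul]
  have : IsScalarTower ℝ ℂ V := ⟨fun r z v => by
    change φ (r • z) v = r • φ z v
    rw [map_smul]
    rfl⟩
  have : FiniteDimensional ℂ V := FiniteDimensional.right ℝ ℂ V
  have : SMulCommClass R ℂ V := ⟨fun r z v => by
    rw [hsmul, hsmul, smul_comm]⟩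
  let act : R →+* Module.End ℂ V := Module.toModuleEnd ℂ V
  let t : κ → R := fun j =>
    a j - (algebraMap ℝ R (ψ (a j)).re + algebraMap ℝ R (ψ (a j)).im * y)
  have ht : ∀ j, t j ∈ RingHom.ker ψ := by
    intro j
    simp [t, RingHom.mem_ker, hy]
  obtain ⟨d, b, hb⟩ := exists_basis_isStrictlyUpperTriangular
    (fun j => act (t j)) (fun i j => (Commute.all (t i) (t j)).map _)
    (fun j => ⟨N, by
      rw [← map_pow]
      exact LinearMap.ext fun v => hN _ (Ideal.pow_mem_pow (ht j) N) v⟩)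
  refine ⟨d, (Complex.basisOneI.smulTower' b).reindex finProdFinEquiv,
    fun j => ⟨ψ (a j), _, hb j, ?_⟩⟩
  have h1 : ψ (a j) • (1 : Matrix (Fin d) (Fin d) ℂ) + LinearMap.toMatrix b b (act (t j)) =
      LinearMap.toMatrix b b (act (a j)) := by
    rw [← LinearMap.toMatrix_one b, ← map_smul, ← map_add]
    congr 1
    ext v
    change ψ (a j) • v + t j • v = a j • v
    rw [hsmul, ← add_smul]
    congr 1
    simp only [t]
    abel
  rw [h1, ← toMatrix_restrictScalars_eq_iC]
  rfl

/-- If the kernel of a character `R → ℂ` acts nilpotently on `V`, any family in `R` acts in a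
suitable basis by matrices of real or of complex block form, according to whether the character
is real on the family. -/
theorem exists_basis_block {R V κ : Type*} [CommRing R] [Algebra ℝ R] [AddCommGroup V]
    [Module ℝ V] [Module R V] [IsScalarTower ℝ R V] [FiniteDimensional ℝ V]
    (ψ : R →ₐ[ℝ] ℂ) (N : ℕ) (hN : ∀ x ∈ RingHom.ker ψ ^ N, ∀ v : V, x • v = 0) (a : κ → R) :
    ∃ (d : ℕ) (isR : Bool) (b : Module.Basis (Fin (d * cond isR 1 2)) ℝ V),
      (isR = true ↔ ∀ j, (ψ (a j)).im = 0) ∧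
      (∀ j, isR = true → ∃ (lam : ℝ) (M : Matrix (Fin (d * cond isR 1 2))
          (Fin (d * cond isR 1 2)) ℝ), IsStrictlyUpperTriangular M ∧
          LinearMap.toMatrix b b (Algebra.lsmul ℝ ℝ V (a j)) = lam • 1 + M) ∧
      (∀ j, isR = false → ∃ (lam : ℂ) (M : Matrix (Fin d) (Fin d) ℂ)
          (h : d * cond isR 1 2 = d * 2), IsStrictlyUpperTriangular M ∧
          LinearMap.toMatrix b b (Algebra.lsmul ℝ ℝ V (a j)) =
            Matrix.reindex (finCongr h.symm) (finCongr h.symm) (iC (lam • 1 + M))) := by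
  by_cases ha : ∀ j, (ψ (a j)).im = 0
  · obtain ⟨d, b, hb⟩ := exists_basis_real_block ψ N hN a ha
    obtain ⟨d, rfl⟩ : ∃ d', d = d' * cond true 1 2 := ⟨d, by simp⟩
    exact ⟨d, true, b, by simpa using ha, fun j _ => hb j, by simp⟩
  · obtain ⟨j, hj⟩ := not_forall.1 ha
    obtain ⟨d, b, hb⟩ := exists_basis_complex_block (V := V) ψ N hN a
      ((ψ (a j)).im⁻¹ • (a j - algebraMap ℝ R (ψ (a j)).re))
      (by simp [Complex.ext_iff, hj])
    refine ⟨d, false, b, by simpa using ha, by simp, fun j _ => ?_⟩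
    obtain ⟨lam, M, hM, h⟩ := hb j
    exact ⟨lam, M, rfl, hM, h⟩

/-- A finite-dimensional commutative real algebra has finitely many characters to `ℂ` with pairwise
coprime kernels, suitable powers of which intersect in zero. -/
theorem exists_characters_iInf_ker_pow_eq_bot (R : Type*) [CommRing R] [Algebra ℝ R]
    [Module.Finite ℝ R] :
    ∃ (ℓ N : ℕ) (ψ : Fin ℓ → R →ₐ[ℝ] ℂ),
      (Pairwise fun i j => RingHom.ker (ψ i) ⊔ RingHom.ker (ψ j) = ⊤) ∧
      ⨅ i, RingHom.ker (ψ i) ^ N = ⊥ := by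
  have : IsArtinianRing R := isArtinian_of_tower ℝ inferInstance
  obtain ⟨ℓ, ⟨m⟩⟩ := Finite.exists_equiv_fin (MaximalSpectrum R)
  obtain ⟨N, hN⟩ := IsArtinianRing.isNilpotent_jacobson_bot (R := R)
  have hex : ∀ p : MaximalSpectrum R, ∃ ψ : R →ₐ[ℝ] ℂ, RingHom.ker ψ = p.asIdeal := by
    intro p
    have := p.isMaximal
    let _ : Field (R ⧸ p.asIdeal) := Ideal.Quotient.field _
    let φ : (R ⧸ p.asIdeal) →ₐ[ℝ] ℂ := IsAlgClosed.lift
    refine ⟨φ.comp (Ideal.Quotient.mkₐ ℝ p.asIdeal), ?_⟩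
    ext x
    rw [RingHom.mem_ker, AlgHom.comp_apply, map_eq_zero_iff φ φ.toRingHom.injective]
    exact Ideal.Quotient.eq_zero_iff_mem
  choose χ hχ using hex
  have hcop : Pairwise fun i j : Fin ℓ =>
      RingHom.ker (χ (m.symm i)) ⊔ RingHom.ker (χ (m.symm j)) = ⊤ := by
    intro i j hij
    rw [hχ, hχ]
    exact (m.symm i).isMaximal.coprime_of_ne (m.symm j).isMaximal
      fun h => hij (m.symm.injective (MaximalSpectrum.ext h))
  refine ⟨ℓ, N, fun i => χ (m.symm i), hcop, ?_⟩
  have hprod := Ideal.prod_eq_iInf_of_pairwise_isCoprime (s := Finset.univ)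
    (J := fun i => RingHom.ker (χ (m.symm i)) ^ N)
    (fun i _ j _ hij => Ideal.isCoprime_iff_sup_eq.2 (Ideal.pow_sup_pow_eq_top (hcop hij)))
  simp only [Finset.mem_univ, iInf_pos] at hprod
  rw [← hprod, Finset.prod_pow, eq_bot_iff]
  refine le_trans (Ideal.pow_right_mono ?_ N) hN.le
  refine Ideal.prod_le_inf.trans fun x hx => ?_
  rw [Ideal.jacobson, Submodule.mem_sInf]
  rintro J ⟨-, hJ⟩
  have := Finset.inf_le (f := fun i => RingHom.ker (χ (m.symm i)))
    (Finset.mem_univ (m ⟨J, hJ⟩)) hx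
  simpa [hχ] using this

/-- If powers of pairwise coprime ideals of `R` intersect in zero, an `R`-module is the internal
direct sum of the real subspaces killed by these powers. -/
theorem isInternal_restrictScalars_torsionBySet {R V ι : Type*} [CommRing R] [Algebra ℝ R]
    [AddCommGroup V] [Module ℝ V] [Module R V] [IsScalarTower ℝ R V] [Fintype ι] [DecidableEq ι]
    (I : ι → Ideal R) (hI : Pairwise fun i j => I i ⊔ I j = ⊤) (N : ℕ) (hbot : ⨅ i, I i ^ N = ⊥) :
    DirectSum.IsInternal fun i =>
      (Submodule.torsionBySet R V ((I i ^ N : Ideal R) : Set R)).restrictScalars ℝ := by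
  have hp : ((Finset.univ : Finset ι) : Set ι).Pairwise fun i j => I i ^ N ⊔ I j ^ N = ⊤ :=
    fun i _ j _ hij => Ideal.pow_sup_pow_eq_top (hI hij)
  have hR : DirectSum.IsInternal fun i =>
      Submodule.torsionBySet R V ((I i ^ N : Ideal R) : Set R) := by
    refine DirectSum.isInternal_submodule_of_iSupIndep_of_iSup_eq_top ?_ ?_
    · have := (Submodule.supIndep_torsionBySet_ideal (M := V) hp)
      rwa [← iSupIndep_iff_supIndep_univ] at this
    · have := Submodule.iSup_torsionBySet_ideal_eq_torsionBySet_iInf (M := V) hp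
      simp only [Finset.mem_univ, iSup_pos, iInf_pos, hbot] at this
      rw [this]
      ext v
      simp
  exact hR

/-- The characters of a finite-dimensional commutative real matrix algebra detect whether all
eigenvalues of an element are real. -/
theorem forall_im_eq_zero_iff_forall_mem_spectrum {R : Type*} [CommRing R] [Algebra ℝ R] {n ℓ : ℕ}
    (ρ : R →ₐ[ℝ] Matrix (Fin n) (Fin n) ℝ) (hρ : Function.Injective ρ)
    (ψ : Fin ℓ → R →ₐ[ℝ] ℂ) (N : ℕ) (hbot : ⨅ i, RingHom.ker (ψ i) ^ N = ⊥) (x : R) :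
    (∀ i, (ψ i x).im = 0) ↔
      ∀ μ ∈ spectrum ℂ ((ρ x).map (algebraMap ℝ ℂ)), μ.im = 0 := by
  constructor
  · intro h μ hμ
    let p : Polynomial ℝ := ∏ i, (Polynomial.X - Polynomial.C (ψ i x).re)
    have hp : Polynomial.aeval x (p ^ N) = 0 := by
      rw [← Ideal.mem_bot, ← hbot, Ideal.mem_iInf]
      intro i
      rw [map_pow]
      refine Ideal.pow_mem_pow ?_ N
      rw [RingHom.mem_ker, ← Polynomial.aeval_algHom_apply, map_prod]
      refine Finset.prod_eq_zero (Finset.mem_univ i) ?_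
      simp [Complex.ext_iff, h i]
    have hpA : Polynomial.aeval ((ρ x).map (algebraMap ℝ ℂ))
        ((p ^ N).map (algebraMap ℝ ℂ)) = 0 := by
      rw [Polynomial.aeval_map_algebraMap]
      have h1 := Polynomial.aeval_algHom_apply
        ((Algebra.ofId ℝ ℂ).mapMatrix.comp ρ) x (p ^ N)
      rw [hp, map_zero] at h1
      exact h1
    have hμ' := spectrum.subset_polynomial_aeval _ ((p ^ N).map (algebraMap ℝ ℂ)) ⟨μ, hμ, rfl⟩
    rw [hpA] at hμ'
    have : Nontrivial (Matrix (Fin n) (Fin n) ℂ) := by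
      by_contra hn
      rw [not_nontrivial_iff_subsingleton] at hn
      simp [spectrum.of_subsingleton] at hμ
    rw [spectrum.zero_eq, Set.mem_singleton_iff] at hμ'
    simp only [p, Polynomial.map_pow, Polynomial.map_prod, Polynomial.eval_pow,
      Polynomial.eval_prod] at hμ'
    obtain ⟨i, -, hi⟩ := Finset.prod_eq_zero_iff.1 (eq_zero_of_pow_eq_zero hμ')
    have : μ = ((ψ i x).re : ℂ) := by simpa [sub_eq_zero] using hi
    simp [this]
  · intro h i
    apply h
    rw [Matrix.mem_spectrum_iff_isRoot_charpoly, Matrix.charpoly_map,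
      Polynomial.IsRoot, Polynomial.eval_map, ← Polynomial.aeval_def, Polynomial.aeval_algHom_apply]
    have : Polynomial.aeval x (ρ x).charpoly = 0 := by
      apply hρ
      rw [← Polynomial.aeval_algHom_apply, Matrix.aeval_self_charpoly, map_zero]
    rw [this, map_zero]

/-- Conjugation by a suitable invertible matrix passes from the standard basis to a given one. -/
theorem exists_isUnit_reindex_conj_eq_toMatrix {n : ℕ} {ι : Type*} [Fintype ι] [DecidableEq ι]
    (c : Module.Basis ι ℝ (Fin n → ℝ)) (e : Fin n ≃ ι) :
    ∃ B : Matrix (Fin n) (Fin n) ℝ, IsUnit B ∧ ∀ A : Matrix (Fin n) (Fin n) ℝ,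
      Matrix.reindex e e (B * A * B⁻¹) = LinearMap.toMatrix c c (Matrix.toLin' A) := by
  let std := Pi.basisFun ℝ (Fin n)
  let c' := c.reindex e.symm
  have hinv : c'.toMatrix std * std.toMatrix c' = 1 := Module.Basis.toMatrix_mul_toMatrix_flip _ _
  refine ⟨c'.toMatrix std, IsUnit.of_mul_eq_one _ hinv, fun A => ?_⟩
  have hA : LinearMap.toMatrix std std (Matrix.toLin' A) = A := by
    rw [LinearMap.toMatrix_eq_toMatrix', LinearMap.toMatrix'_toLin']
  have h := basis_toMatrix_mul_linearMap_toMatrix_mul_basis_toMatrix c' std c' std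
    (Matrix.toLin' A)
  rw [hA] at h
  rw [Matrix.inv_eq_right_inv hinv, h]
  ext p q
  simp [c', LinearMap.toMatrix_apply]

/-- Block diagonalization of commuting real matrices: there are a real change of basis `B`,
block sizes `d r` and field choices `isR r` (`true` = ℝ, `false` = ℂ) with
`∑ r, d r · dim_ℝ K_r = n`, such that each `B * A j * B⁻¹` is block diagonal, the `r`-th
block being `λ·1 + N` with `λ ∈ ℝ` and `N` strictly upper triangular if `K_r = ℝ`, and
`i_ℂ(λ·1 + N)` with `λ ∈ ℂ` and `N` strictly upper triangular complex if `K_r = ℂ`.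
Moreover all `K_r` equal `ℝ` iff every eigenvalue of every `A j` is real. -/
theorem structure_commuting_real_matrices
    (n k : ℕ) (A : Fin k → Matrix (Fin n) (Fin n) ℝ)
    (hcomm : ∀ i j, Commute (A i) (A j)) :
    ∃ (B : Matrix (Fin n) (Fin n) ℝ) (_ : IsUnit B) (ℓ : ℕ)
      (d : Fin ℓ → ℕ) (isR : Fin ℓ → Bool)
      (e : Fin n ≃ (Σ r : Fin ℓ, Fin (d r * cond (isR r) 1 2)))
      (blk : (j : Fin k) → (r : Fin ℓ) →
        Matrix (Fin (d r * cond (isR r) 1 2)) (Fin (d r * cond (isR r) 1 2)) ℝ),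
      (∑ r, d r * cond (isR r) 1 2) = n ∧
      (∀ j, Matrix.reindex e e (B * A j * B⁻¹) = Matrix.blockDiagonal' (blk j)) ∧
      (∀ j r, isR r = true →
        ∃ (lam : ℝ) (N : Matrix (Fin (d r * cond (isR r) 1 2))
            (Fin (d r * cond (isR r) 1 2)) ℝ),
          IsStrictlyUpperTriangular N ∧ blk j r = lam • 1 + N) ∧
      (∀ j r, isR r = false →
        ∃ (lam : ℂ) (N : Matrix (Fin (d r)) (Fin (d r)) ℂ)
          (h : d r * cond (isR r) 1 2 = d r * 2),
          IsStrictlyUpperTriangular N ∧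
          blk j r = Matrix.reindex (finCongr h.symm) (finCongr h.symm)
            (iC (lam • 1 + N))) ∧
      ((∀ r, isR r = true) ↔
        (∀ j, ∀ μ ∈ spectrum ℂ ((A j).map (algebraMap ℝ ℂ)), μ.im = 0)) := by
  let f : Fin k → Module.End ℝ (Fin n → ℝ) := fun j => Matrix.toLin' (A j)
  have hf : ∀ x ∈ Set.range f, ∀ y ∈ Set.range f, x * y = y * x := by
    rintro _ ⟨i, rfl⟩ _ ⟨j, rfl⟩
    simp only [f, Module.End.mul_eq_comp, ← Matrix.toLin'_mul, (hcomm i j).eq]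
  let R := Algebra.adjoin ℝ (Set.range f)
  have : IsMulCommutative R := Algebra.isMulCommutative_adjoin ℝ hf
  let _ : CommRing R := open scoped IsMulCommutative in inferInstance
  let a : Fin k → R := fun j => ⟨f j, Algebra.subset_adjoin ⟨j, rfl⟩⟩
  obtain ⟨ℓ, N, ψ, hcop, hbot⟩ := exists_characters_iInf_ker_pow_eq_bot R
  have hint := isInternal_restrictScalars_torsionBySet (V := Fin n → ℝ) _ hcop N hbot
  have hblock := fun r => exists_basis_block
    (V := (Submodule.torsionBySet R (Fin n → ℝ)
      ((RingHom.ker (ψ r) ^ N : Ideal R) : Set R)).restrictScalars ℝ) (ψ r) N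
    (fun x hx v => Subtype.ext ((Submodule.mem_torsionBySet_iff _ _).1 v.2 ⟨x, hx⟩)) a
  choose d isR b hisR hreal hcplx using hblock
  have hmaps : ∀ j r, Set.MapsTo (f j)
      ((Submodule.torsionBySet R (Fin n → ℝ)
        ((RingHom.ker (ψ r) ^ N : Ideal R) : Set R)).restrictScalars ℝ)
      ((Submodule.torsionBySet R (Fin n → ℝ)
        ((RingHom.ker (ψ r) ^ N : Ideal R) : Set R)).restrictScalars ℝ) :=
    fun j r v hv => Submodule.smul_mem (Submodule.torsionBySet R (Fin n → ℝ) _) (a j) hv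
  let c := hint.collectedBasis b
  have hcard : ∑ r, d r * cond (isR r) 1 2 = n := by
    have h := Module.finrank_eq_card_basis c
    rw [Module.finrank_fin_fun] at h
    simpa using h.symm
  let e : Fin n ≃ (Σ r : Fin ℓ, Fin (d r * cond (isR r) 1 2)) :=
    (Pi.basisFun ℝ (Fin n)).indexEquiv c
  obtain ⟨B, hB, hconj⟩ := exists_isUnit_reindex_conj_eq_toMatrix c e
  refine ⟨B, hB, ℓ, d, isR, e,
    fun j r => LinearMap.toMatrix (b r) (b r) (Algebra.lsmul ℝ ℝ _ (a j)), hcard,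
    fun j => (hconj (A j)).trans ?_, fun j r => hreal r j, fun j r => hcplx r j, ?_⟩
  · exact LinearMap.toMatrix_directSum_collectedBasis_eq_blockDiagonal' hint hint b b (hmaps j)
  · let ρ : R →ₐ[ℝ] Matrix (Fin n) (Fin n) ℝ :=
      (LinearMap.toMatrixAlgEquiv' (R := ℝ) (n := Fin n)).toAlgHom.comp R.val
    have hρ : Function.Injective ρ :=
      LinearMap.toMatrixAlgEquiv'.injective.comp Subtype.val_injective
    have hρa : ∀ j, ρ (a j) = A j := fun j => LinearMap.toMatrix'_toLin' (A j)
    simp only [hisR]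
    rw [forall_comm]
    refine forall_congr' fun j => ?_
    rw [forall_im_eq_zero_iff_forall_mem_spectrum ρ hρ ψ N hbot, hρa]
end

section
/- Let φ = (φ₁,…,φ_d) ∈ ℝ^d, suppose φ_j ∈ ℚ for all j < i₀ and φ_{i₀} ∉ ℚ for some index 1 ≤ i₀ ≤ d, and let H ⊆ (ℝ/ℤ)^d be the closure of the one-parameter subgroup {q(tφ) : t ∈ ℝ}. Then the preimage q⁻¹(H) ⊆ ℝ^d contains a vector x with x_j = 0 for all j < i₀ and x_{i₀} ≠ 0. -/
/-- Finitely many rational numbers have a common nonzero denominator. -/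
theorem exists_common_denominator {ι : Type*} (s : Finset ι) (φ : ι → ℝ)
    (h : ∀ j ∈ s, ∃ r : ℚ, φ j = (r : ℝ)) :
    ∃ N : ℕ, N ≠ 0 ∧ ∀ j ∈ s, ∃ m : ℤ, (N : ℝ) * φ j = m := by
  choose! r hr using h
  refine ⟨∏ j ∈ s, (r j).den, Finset.prod_ne_zero_iff.2 fun j _ => (r j).den_ne_zero,
    fun j hj => ?_⟩
  obtain ⟨k, hk⟩ := Finset.dvd_prod_of_mem (fun j => (r j).den) hj
  refine ⟨k * (r j).num, ?_⟩
  have hden : ((r j).den : ℝ) * (r j : ℝ) = (r j).num := by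
    exact_mod_cast Rat.den_mul_eq_num (r j)
  rw [hk, hr j hj]
  push_cast
  rw [← hden]
  ring


/-- Let `φ ∈ ℝ^d` have rational entries before position `i₀` and an irrational entry at
position `i₀`, and let `H` be the closure in the torus `(ℝ/ℤ)^d` of the one-parameter
subgroup `{q(tφ) : t ∈ ℝ}`, where `q` is the componentwise quotient map. Then `q⁻¹(H)`
contains a vector whose entries before position `i₀` vanish and whose `i₀`-th entry is
nonzero. -/
theorem closure_one_param_torus_contains_vector
    (d : ℕ) (φ : Fin d → ℝ) (i₀ : Fin d)
    (hrat : ∀ j < i₀, ∃ r : ℚ, φ j = (r : ℝ))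
    (hirr : Irrational (φ i₀)) :
    ∃ x : Fin d → ℝ,
      (∀ j < i₀, x j = 0) ∧ x i₀ ≠ 0 ∧
      (fun i => ((x i : ℝ) : AddCircle (1 : ℝ))) ∈
        closure {y : Fin d → AddCircle (1 : ℝ) |
          ∃ t : ℝ, y = fun i => ((t * φ i : ℝ) : AddCircle (1 : ℝ))} := by
  obtain ⟨N, hN, hint⟩ := exists_common_denominator (Finset.Iio i₀) φ
    fun j hj => hrat j (Finset.mem_Iio.1 hj)
  refine ⟨fun j => if j < i₀ then 0 else N * φ j, fun j hj => if_pos hj, ?_,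
    subset_closure ⟨N, funext fun j => ?_⟩⟩
  · simpa [hN] using hirr.ne_zero
  · by_cases hj : j < i₀
    · obtain ⟨m, hm⟩ := hint j (Finset.mem_Iio.2 hj)
      simp only [if_pos hj, hm, AddCircle.coe_zero]
      exact ((AddCircle.coe_eq_zero_iff 1).2 ⟨m, by simp⟩).symm
    · simp only [if_neg hj]
end

section
/- Let v₁,…,v_k ∈ ℝ^d be vectors in Gauss–Jordan row echelon form and let 𝔥 = span_ℝ(v₁,…,v_k). Then the image q(𝔥) ⊆ (ℝ/ℤ)^d is compact if and only if v_j ∈ ℚ^d for every j = 1,…,k. -/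
/-- A countable compact Hausdorff additive group is finite. -/
theorem AddGroup.finite_of_countable_compact (G : Type*) [AddGroup G] [TopologicalSpace G]
    [IsTopologicalAddGroup G] [T2Space G] [CompactSpace G] [Countable G] : Finite G := by
  obtain ⟨g, hne⟩ := nonempty_interior_of_iUnion_of_closed
    (f := fun g : G => ({g} : Set G)) (fun _ => isClosed_singleton) (by ext; simp)
  have hg : IsOpen ({g} : Set G) := by
    rw [← hne.subset_singleton_iff.1 interior_subset]
    exact isOpen_interior
  have h0 : IsOpen ({0} : Set G) := by
    have h := hg.preimage (continuous_const_add g)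
    simpa [Set.preimage] using h
  have := discreteTopology_of_isOpen_singleton_zero h0
  exact finite_of_compact_of_discrete

/-- The componentwise quotient homomorphism from `ℝ^d` onto the torus. -/
def torusQuotient (d : ℕ) : (Fin d → ℝ) →+ (Fin d → AddCircle (1 : ℝ)) where
  toFun x m := (x m : AddCircle (1 : ℝ))
  map_zero' := rfl
  map_add' _ _ := rfl

theorem continuous_torusQuotient (d : ℕ) : Continuous (torusQuotient d) :=
  continuous_pi fun m => (AddCircle.continuous_mk' 1).comp (continuous_apply m)

theorem torusQuotient_eq_zero_iff {d : ℕ} {x : Fin d → ℝ} :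
    torusQuotient d x = 0 ↔ ∀ m, ∃ n : ℤ, (n : ℝ) = x m := by
  rw [funext_iff]
  refine forall_congr' fun m => ?_
  change ((x m : ℝ) : AddCircle (1 : ℝ)) = 0 ↔ _
  rw [AddCircle.coe_eq_zero_iff]
  simp

/-- If the matrix `v j (i l)` is the identity and the span of the `v j` has compact image in the
torus, then the `v j` are rational. -/
theorem rational_of_isCompact_image_span {d k : ℕ} {v : Fin k → Fin d → ℝ} {i : Fin k → Fin d}
    (hpivot : ∀ j, v j (i j) = 1) (hother : ∀ j l : Fin k, l ≠ j → v j (i l) = 0)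
    (hc : IsCompact (torusQuotient d '' (Submodule.span ℝ (Set.range v) : Set (Fin d → ℝ))))
    (j : Fin k) (m : Fin d) : ∃ r : ℚ, v j m = r := by
  have happ (c : Fin k → ℝ) (l : Fin k) : (∑ j, c j • v j) (i l) = c l := by
    rw [Finset.sum_apply, Finset.sum_eq_single l]
    · simp [hpivot]
    · intro b _ hb
      simp [hother b l hb.symm]
    · simp
  let f : (Fin k → ℤ) →+ (Fin d → AddCircle (1 : ℝ)) :=
    (torusQuotient d).comp (Fintype.linearCombination ℤ v).toAddMonoidHom
  have hf (c : Fin k → ℤ) : f c = torusQuotient d (∑ j, (c j : ℝ) • v j) := by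
    simp [f, Fintype.linearCombination_apply, Int.cast_smul_eq_zsmul]
  have hrange : (f.range : Set (Fin d → AddCircle (1 : ℝ))) =
      torusQuotient d '' (Submodule.span ℝ (Set.range v) : Set (Fin d → ℝ)) ∩
        {y | ∀ l, y (i l) = 0} := by
    ext y
    constructor
    · rintro ⟨c, rfl⟩
      refine ⟨⟨_, (Submodule.mem_span_range_iff_exists_fun ℝ).2 ⟨fun j => c j, rfl⟩,
        (hf c).symm⟩, fun l => ?_⟩
      rw [hf]
      change (((∑ j, (c j : ℝ) • v j) (i l) : ℝ) : AddCircle (1 : ℝ)) = 0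
      rw [happ (fun j => (c j : ℝ)), AddCircle.coe_eq_zero_iff]
      exact ⟨c l, by simp⟩
    · rintro ⟨⟨x, hx, rfl⟩, hy⟩
      obtain ⟨c, rfl⟩ := (Submodule.mem_span_range_iff_exists_fun ℝ).1 hx
      have hinteger (l : Fin k) : ∃ n : ℤ, (n : ℝ) = c l := by
        have h : (((∑ j, c j • v j) (i l) : ℝ) : AddCircle (1 : ℝ)) = 0 := hy l
        rw [happ, AddCircle.coe_eq_zero_iff] at h
        simpa using h
      choose n hn using hinteger
      exact ⟨n, by simp only [hf, hn]⟩
  have hcompact : IsCompact (f.range : Set (Fin d → AddCircle (1 : ℝ))) := by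
    rw [hrange]
    refine hc.inter_right ?_
    simp only [Set.ofPred_forall]
    exact isClosed_iInter fun l => isClosed_eq (continuous_apply _) continuous_const
  have : CompactSpace f.range := isCompact_iff_compactSpace.1 hcompact
  have : Countable f.range := f.rangeRestrict_surjective.countable
  have := AddGroup.finite_of_countable_compact f.range
  obtain ⟨n, hn, hn0⟩ := (isOfFinAddOrder_of_finite
    (f.rangeRestrict (Pi.single j 1))).exists_nsmul_eq_zero
  have hv : f (Pi.single j 1) = torusQuotient d (v j) := by
    simp [f]
  have hz : torusQuotient d (n • v j) = 0 := by
    rw [map_nsmul, ← hv]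
    exact congrArg Subtype.val hn0
  obtain ⟨z, hz⟩ := torusQuotient_eq_zero_iff.1 hz m
  refine ⟨z / n, ?_⟩
  have : (n : ℝ) ≠ 0 := by positivity
  push_cast
  rw [hz]
  simp [field]

/-- The span of finitely many rational vectors has compact image in the torus. -/
theorem isCompact_image_span_of_rational {d k : ℕ} {v : Fin k → Fin d → ℝ}
    (hv : ∀ j m, ∃ r : ℚ, v j m = r) :
    IsCompact (torusQuotient d '' (Submodule.span ℝ (Set.range v) : Set (Fin d → ℝ))) := by
  choose r hr using hv
  let N : ℕ := ∏ j, ∏ m, (r j m).den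
  have hN : (0 : ℝ) < N := by
    have : 0 < N := Finset.prod_pos fun j _ => Finset.prod_pos fun m _ => (r j m).den_pos
    exact_mod_cast this
  have hinteger (j : Fin k) : torusQuotient d ((N : ℝ) • v j) = 0 := by
    refine torusQuotient_eq_zero_iff.2 fun m => ?_
    obtain ⟨t, ht⟩ : (r j m).den ∣ N :=
      (Finset.dvd_prod_of_mem _ (Finset.mem_univ m)).trans
        (Finset.dvd_prod_of_mem (fun j => ∏ m, (r j m).den) (Finset.mem_univ j))
    refine ⟨t * (r j m).num, ?_⟩
    have h : (N : ℚ) * r j m = t * (r j m).num := by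
      rw [ht, Nat.cast_mul, mul_right_comm, Rat.den_mul_eq_num, mul_comm]
    rw [Pi.smul_apply, hr, smul_eq_mul]
    exact_mod_cast h.symm
  have himage : torusQuotient d '' (Submodule.span ℝ (Set.range v) : Set (Fin d → ℝ)) =
      (fun c : Fin k → ℝ => torusQuotient d (∑ j, c j • v j)) ''
        Set.univ.pi fun _ => Set.Icc 0 (N : ℝ) := by
    ext y
    constructor
    · rintro ⟨x, hx, rfl⟩
      obtain ⟨c, rfl⟩ := (Submodule.mem_span_range_iff_exists_fun ℝ).1 hx
      refine ⟨fun j => toIcoMod hN 0 (c j), fun j _ => ?_, ?_⟩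
      · have := toIcoMod_mem_Ico' hN (c j)
        exact ⟨this.1, this.2.le⟩
      · simp only [map_sum]
        refine Finset.sum_congr rfl fun j _ => ?_
        rw [toIcoMod, sub_smul, smul_assoc, map_sub, map_zsmul, hinteger, smul_zero, sub_zero]
    · rintro ⟨c, -, rfl⟩
      exact ⟨_, (Submodule.mem_span_range_iff_exists_fun ℝ).2 ⟨c, rfl⟩, rfl⟩
  rw [himage]
  exact (isCompact_univ_pi fun _ => isCompact_Icc).image
    ((continuous_torusQuotient d).comp (by fun_prop))

/-- Let `v 1, …, v k ∈ ℝ^d` be in Gauss–Jordan row echelon form (with strictly increasing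
pivot indices `i j`, pivot entries `1`, zeros before each pivot and zeros at the pivot
positions of the other vectors). Then the image under the componentwise quotient map
`q : ℝ^d → (ℝ/ℤ)^d` of the real span of the `v j` is compact if and only if every `v j`
has only rational entries. -/
theorem span_image_torus_compact_iff_rational
    (d k : ℕ) (v : Fin k → (Fin d → ℝ)) (i : Fin k → Fin d)
    (hmono : StrictMono i)
    (hzero : ∀ j, ∀ r : Fin d, r < i j → v j r = 0)
    (hpivot : ∀ j, v j (i j) = 1)
    (hother : ∀ j l : Fin k, l ≠ j → v j (i l) = 0) :
    IsCompact ((fun (x : Fin d → ℝ) (m : Fin d) => ((x m : ℝ) : AddCircle (1 : ℝ))) ''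
        ((Submodule.span ℝ (Set.range v) : Submodule ℝ (Fin d → ℝ)) : Set (Fin d → ℝ)))
      ↔ ∀ j m, ∃ r : ℚ, v j m = (r : ℝ) := by
  exact ⟨fun h => rational_of_isCompact_image_span hpivot hother h,
    isCompact_image_span_of_rational⟩
end

section
/- Let H be a closed abelian subgroup of GL(n,ℝ). Then there exist natural numbers l, m, k and a finite abelian group F such that H is isomorphic as a topological group to ℝˡ × ℤᵐ × (ℝ/ℤ)ᵏ × F. -/
open Filter Topology

section ClosedSubgroups

variable {E : Type*} [NormedAddCommGroup E] [NormedSpace ℝ E] [FiniteDimensional ℝ E]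

/-- A closed additive subgroup of a finite-dimensional real vector space that contains no line is
discrete. -/
theorem AddSubgroup.exists_pos_forall_norm_lt_eq_zero (K : AddSubgroup E)
    (hK : IsClosed (K : Set E)) (hline : ∀ x, (∀ t : ℝ, t • x ∈ K) → x = 0) :
    ∃ ε > 0, ∀ x ∈ K, ‖x‖ < ε → x = 0 := by
  by_contra! hcon
  choose x hxK hxn hx0 using fun n : ℕ => hcon (1 / ((n : ℝ) + 1)) (by positivity)
  have hpos : ∀ n, 0 < ‖x n‖ := fun n => norm_pos_iff.mpr (hx0 n)
  have hlim : Tendsto (fun n => ‖x n‖) atTop (𝓝 0) :=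
    squeeze_zero (fun n => (hpos n).le) (fun n => (hxn n).le)
      tendsto_one_div_add_atTop_nhds_zero_nat
  have := FiniteDimensional.proper ℝ E
  obtain ⟨v, hv, φ, hφ, hlimv⟩ := (isCompact_sphere (0 : E) 1).tendsto_subseq
    (x := fun n => ‖x n‖⁻¹ • x n) (fun n => by
      simp [norm_smul, inv_mul_cancel₀ (hpos n).ne'])
  have hv0 : v = 0 := by
    refine hline v fun t => ?_
    have hfloor : Tendsto (fun r : ℝ => r * (⌊t / r⌋ : ℝ)) (𝓝[>] 0) (𝓝 t) := by
      have h1 : Tendsto (fun r : ℝ => t - r) (𝓝[>] 0) (𝓝 t) := by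
        have : Tendsto (fun r : ℝ => t - r) (𝓝 0) (𝓝 (t - 0)) := by
          exact (continuous_const.sub continuous_id).tendsto _
        rw [sub_zero] at this
        exact this.mono_left nhdsWithin_le_nhds
      refine tendsto_of_tendsto_of_tendsto_of_le_of_le' h1 tendsto_const_nhds ?_ ?_
      · filter_upwards [self_mem_nhdsWithin] with r (hr : 0 < r)
        have := (Int.sub_one_lt_floor (t / r)).le
        calc t - r = r * (t / r - 1) := by field_simp
          _ ≤ _ := by gcongr
      · filter_upwards [self_mem_nhdsWithin] with r (hr : 0 < r)
        calc r * (⌊t / r⌋ : ℝ) ≤ r * (t / r) := by gcongr; exact Int.floor_le _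
          _ = t := by field_simp
    have hlim' : Tendsto (fun n => ‖x (φ n)‖) atTop (𝓝[>] 0) :=
      tendsto_nhdsWithin_iff.mpr
        ⟨hlim.comp hφ.tendsto_atTop, Eventually.of_forall fun n => hpos _⟩
    refine hK.mem_of_tendsto ((hfloor.comp hlim').smul hlimv) (Eventually.of_forall fun n => ?_)
    have : (‖x (φ n)‖ * (⌊t / ‖x (φ n)‖⌋ : ℝ)) • (‖x (φ n)‖⁻¹ • x (φ n))
        = ⌊t / ‖x (φ n)‖⌋ • x (φ n) := by
      rw [smul_smul, mul_right_comm, mul_inv_cancel₀ (hpos _).ne', one_mul, Int.cast_smul_eq_zsmul]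
    simp only [Function.comp_apply, this]
    exact K.zsmul_mem (hxK _) _
  simp [hv0] at hv

/-- The largest linear subspace contained in an additive subgroup of a real vector space. -/
def AddSubgroup.lineal (K : AddSubgroup E) : Submodule ℝ E where
  carrier := {x | ∀ t : ℝ, t • x ∈ K}
  add_mem' hx hy t := by rw [smul_add]; exact K.add_mem (hx t) (hy t)
  zero_mem' t := by simp
  smul_mem' c x hx t := by rw [smul_smul]; exact hx _

omit [FiniteDimensional ℝ E] in
theorem AddSubgroup.mem_of_mem_lineal {K : AddSubgroup E} {x : E} (hx : x ∈ K.lineal) : x ∈ K := by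
  simpa using hx 1

/-- A closed additive subgroup `K` of a finite-dimensional real vector space agrees near zero with
its largest linear subspace, and it is finitely generated modulo that subspace. -/
theorem AddSubgroup.lineal_nhds_and_finite_generation (K : AddSubgroup E)
    (hK : IsClosed (K : Set E)) :
    (∀ᶠ x in 𝓝 (0 : E), x ∈ K → x ∈ K.lineal) ∧
      ∃ s : Set E, s.Finite ∧ s ⊆ K ∧ K ≤ K.lineal.toAddSubgroup ⊔ AddSubgroup.closure s := by
  obtain ⟨W, hW⟩ := K.lineal.exists_isCompl
  let q : E →ₗ[ℝ] E := W.projection K.lineal hW.symm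
  have hqW : ∀ x, q x ∈ W := fun x => Subtype.prop _
  have hqV : ∀ x, x - q x ∈ K.lineal := fun x => by
    rw [← Submodule.projectionOnto_apply_eq_zero_iff hW.symm, map_sub, sub_eq_zero]
    exact (Submodule.projectionOnto_apply_left hW.symm (W.projectionOnto _ hW.symm x)).symm
  let D : AddSubgroup E := K ⊓ W.toAddSubgroup
  have hqD : ∀ x ∈ K, q x ∈ D := fun x hx =>
    ⟨by simpa using K.sub_mem hx (mem_of_mem_lineal (hqV x)), hqW x⟩
  obtain ⟨ε, hε, hD⟩ := D.exists_pos_forall_norm_lt_eq_zero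
    (hK.inter W.closed_of_finiteDimensional) fun x hx =>
      Submodule.disjoint_def.mp hW.disjoint x (fun t => (hx t).1) (by simpa using (hx 1).2)
  have : DiscreteTopology (AddSubgroup.toIntSubmodule D) := by
    change DiscreteTopology D
    rw [discreteTopology_iff_isOpen_singleton_zero, Metric.isOpen_singleton_iff]
    refine ⟨ε, hε, fun y hy => Subtype.ext (hD _ y.2 ?_)⟩
    simpa using hy
  constructor
  · have hq : Tendsto q (𝓝 0) (𝓝 0) := by
      simpa using (LinearMap.continuous_of_finiteDimensional q).tendsto 0
    filter_upwards [hq (Metric.ball_mem_nhds 0 hε)] with x hx hxK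
    have := hD _ (hqD x hxK) (by simpa using hx)
    simpa [this] using hqV x
  · obtain ⟨s, hs⟩ : (AddSubgroup.toIntSubmodule D).FG := Module.Finite.iff_fg.mp inferInstance
    have hsD : AddSubgroup.closure (s : Set E) = D := by
      have := congrArg Submodule.toAddSubgroup hs
      rwa [Submodule.span_int_eq_addSubgroupClosure, AddSubgroup.toIntSubmodule_toAddSubgroup] at this
    refine ⟨s, s.finite_toSet, fun x hx => ?_, fun x hx => ?_⟩
    · exact (hsD ▸ AddSubgroup.subset_closure hx : x ∈ D).1
    · rw [hsD]
      exact AddSubgroup.mem_sup.mpr ⟨x - q x, hqV x, q x, hqD x hx, sub_add_cancel _ _⟩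

end ClosedSubgroups

/-- The quotient of a finite-dimensional real vector space by a discrete subgroup is the product of
a vector group and a torus. -/
theorem AddSubgroup.exists_quotientMap_prod_torus {E : Type*} [NormedAddCommGroup E]
    [NormedSpace ℝ E] [FiniteDimensional ℝ E] (Λ : AddSubgroup E) [DiscreteTopology Λ] :
    ∃ (l k : ℕ) (p : E →+ (Fin l → ℝ) × (Fin k → AddCircle (1 : ℝ))),
      Continuous p ∧ IsOpenMap p ∧ Function.Surjective p ∧ ∀ x, p x = 0 ↔ x ∈ Λ := by
  let L : Submodule ℤ E := AddSubgroup.toIntSubmodule Λ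
  have hL : DiscreteTopology L := ‹DiscreteTopology Λ›
  let F : Submodule ℝ E := Submodule.span ℝ (L : Set E)
  let L' : Submodule ℤ F := ZLattice.comap ℝ L F.subtype
  have : DiscreteTopology L' :=
    ZLattice.comap_discreteTopology ℝ L (by fun_prop) F.injective_subtype
  have : IsZLattice ℝ L' :=
    ⟨Submodule.span_span_coe_preimage⟩
  let b := (Module.finBasis ℤ L')
  let B : Module.Basis _ ℝ F := b.ofZLatticeBasis ℝ
  obtain ⟨W, hW⟩ := F.exists_isCompl
  let e : (W × F) ≃ₗ[ℝ] E := Submodule.prodEquivOfIsCompl W F hW.symm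
  let g : E ≃L[ℝ] (Fin (Module.finrank ℝ W) → ℝ) × (Fin (Module.finrank ℤ L') → ℝ) :=
    (e.symm.trans ((Module.finBasis ℝ W).equivFun.prodCongr B.equivFun)).toContinuousLinearEquiv
  let c : ((Fin (Module.finrank ℝ W) → ℝ) × (Fin (Module.finrank ℤ L') → ℝ)) →+
      (Fin (Module.finrank ℝ W) → ℝ) × (Fin (Module.finrank ℤ L') → AddCircle (1 : ℝ)) :=
    (AddMonoidHom.id _).prodMap
      ((QuotientAddGroup.mk' (AddSubgroup.zmultiples (1 : ℝ))).compLeft _)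
  have hc : ⇑c = Prod.map id (Pi.map fun _ => (QuotientAddGroup.mk : ℝ → AddCircle (1 : ℝ))) := rfl
  have hcs : Function.Surjective c := by
    rw [hc]
    exact Function.surjective_id.prodMap
      (Function.Surjective.piMap fun _ => QuotientAddGroup.mk_surjective)
  have hco : IsOpenMap c := by
    rw [hc]
    exact IsOpenMap.id.prodMap (IsOpenMap.piMap (fun _ => QuotientAddGroup.isOpenMap_coe)
      (Eventually.of_forall fun _ => QuotientAddGroup.mk_surjective))
  have hcc : Continuous c := by
    rw [hc]
    exact continuous_id.prodMap (Continuous.piMap fun _ => continuous_quot_mk)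
  refine ⟨_, _, c.comp (g : E →+ _), hcc.comp g.continuous, hco.comp g.toHomeomorph.isOpenMap,
    hcs.comp g.surjective, fun x => ?_⟩
  obtain ⟨⟨w, y⟩, rfl⟩ := e.surjective x
  have h1 : (c.comp (g : E →+ _)) (e (w, y)) =
      c ((Module.finBasis ℝ W).equivFun w, B.equivFun y) := by
    simp [g]
  have h2 : (∀ i, ((B.repr y i : ℝ) : AddCircle (1 : ℝ)) = 0) ↔ y ∈ L' := by
    have hspan : y ∈ L' ↔ y ∈ Submodule.span ℤ (Set.range B) := by
      rw [b.ofZLatticeBasis_span ℝ]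
    rw [hspan, Module.Basis.mem_span_iff_repr_mem]
    refine forall_congr' fun i => ?_
    rw [AddCircle.coe_eq_zero_iff]
    simp [B]
  have h3 : e (w, y) ∈ Λ ↔ w = 0 ∧ y ∈ L' := by
    constructor
    · intro h
      have hF : e (w, y) ∈ F := Submodule.subset_span h
      have hw : w = 0 := by
        have : (w : E) ∈ F := by
          have := F.sub_mem hF y.2
          simpa [e] using this
        exact Subtype.ext (Submodule.disjoint_def.mp hW.disjoint w this w.2)
      refine ⟨hw, ?_⟩
      have : (e (w, y) : E) = y := by simp [e, hw]
      rw [this] at h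
      exact h
    · rintro ⟨rfl, h⟩
      have : (e (0, y) : E) = y := by simp [e]
      rw [this]
      exact h
  rw [h1, h3, ← h2, hc, Prod.map_apply, Prod.mk_eq_zero]
  exact and_congr (LinearEquiv.map_eq_zero_iff _) funext_iff

theorem AddGroup.FG.exists_addEquiv_pi_int_prod_finite (Q : Type*) [AddCommGroup Q]
    [AddGroup.FG Q] :
    ∃ (m : ℕ) (F : Type) (_ : AddCommGroup F) (_ : Finite F), Nonempty (Q ≃+ (Fin m → ℤ) × F) := by
  classical
  obtain ⟨m, ι, _, p, hp, e, ⟨φ⟩⟩ := AddCommGroup.equiv_free_prod_directSum_zmod Q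
  have : ∀ i, NeZero (p i ^ e i) := fun i => ⟨pow_ne_zero _ (hp i).ne_zero⟩
  exact ⟨m, (i : ι) → ZMod (p i ^ e i), inferInstance, inferInstance,
    ⟨φ.trans ((Finsupp.linearEquivFunOnFinite ℤ ℤ (Fin m)).toAddEquiv.prodCongr
      (DirectSum.addEquivProd _))⟩⟩

/-- A topological abelian group that receives an open homomorphism from a finite-dimensional real
vector space with discrete kernel and finitely generated cokernel is a product of a vector group,
a lattice, a torus and a finite group. -/
theorem exists_continuousAddEquiv_of_isOpenMap {E G : Type*} [NormedAddCommGroup E]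
    [NormedSpace ℝ E] [FiniteDimensional ℝ E] [AddCommGroup G] [TopologicalSpace G]
    [IsTopologicalAddGroup G] (f : E →+ G) (hf : Continuous f) (hfo : IsOpenMap f)
    (hker : ∀ᶠ x in 𝓝 (0 : E), f x = 0 → x = 0) {s : Set G} (hs : s.Finite)
    (hgen : f.range ⊔ AddSubgroup.closure s = ⊤) :
    ∃ (l m k : ℕ) (F : Type) (_ : AddCommGroup F) (_ : Finite F) (_ : TopologicalSpace F)
      (_ : DiscreteTopology F),
      Nonempty (G ≃ₜ+ (Fin l → ℝ) × (Fin m → ℤ) × (Fin k → AddCircle (1 : ℝ)) × F) := by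
  have : DiscreteTopology f.ker := by
    obtain ⟨ε, hε, hball⟩ := Metric.eventually_nhds_iff_ball.mp hker
    rw [discreteTopology_iff_isOpen_singleton_zero, Metric.isOpen_singleton_iff]
    exact ⟨ε, hε, fun y hy => Subtype.ext (hball y (by simpa using hy) y.2)⟩
  obtain ⟨l, k, p, hp, hpo, hps, hpk⟩ := f.ker.exists_quotientMap_prod_torus
  let Q := G ⧸ f.range
  have hopen : IsOpen (f.range : Set G) := by
    rw [AddMonoidHom.coe_range]
    exact hfo.isOpen_range
  have : DiscreteTopology Q := QuotientAddGroup.discreteTopology hopen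
  have : AddGroup.FG Q := by
    refine AddGroup.fg_iff.mpr ⟨QuotientAddGroup.mk' f.range '' s, ?_, hs.image _⟩
    rw [← AddMonoidHom.map_closure, ← top_le_iff, ← AddSubgroup.map_top_of_surjective
      (QuotientAddGroup.mk' f.range) (QuotientAddGroup.mk'_surjective _), ← hgen,
      AddSubgroup.map_sup]
    refine sup_le ?_ le_rfl
    simp
  obtain ⟨m, F, _, _, ⟨ψ⟩⟩ := AddGroup.FG.exists_addEquiv_pi_int_prod_finite Q
  let : TopologicalSpace F := ⊥
  have : DiscreteTopology F := ⟨rfl⟩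
  -- the divisibility of the target extends `φ₀` from the image of `f` to all of `G`
  let φ₀ : f.range →+ (Fin l → ℝ) × (Fin k → AddCircle (1 : ℝ)) :=
    (QuotientAddGroup.lift f.ker p fun x hx => (hpk x).mpr hx).comp
      (QuotientAddGroup.quotientKerEquivRange f).symm.toAddMonoidHom
  obtain ⟨φ, hφ⟩ := (Module.Baer.of_divisible ((Fin l → ℝ) × (Fin k → AddCircle (1 : ℝ)))
    ).extension_property_addMonoidHom f.range.subtype f.range.subtype_injective φ₀
  have hφf : ∀ x, φ (f x) = p x := fun x => by
    have h1 := DFunLike.congr_fun hφ (f.rangeRestrict x)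
    have h2 : (QuotientAddGroup.quotientKerEquivRange f).symm (f.rangeRestrict x) =
        (x : E ⧸ f.ker) := by
      rw [AddEquiv.symm_apply_eq]
      rfl
    have h3 : φ (f x) = QuotientAddGroup.lift f.ker p (fun x hx => (hpk x).mpr hx)
      ((QuotientAddGroup.quotientKerEquivRange f).symm (f.rangeRestrict x)) := h1
    rw [h2] at h3
    exact h3
  let Φ : G →+ ((Fin l → ℝ) × (Fin k → AddCircle (1 : ℝ))) × Q :=
    φ.prod (QuotientAddGroup.mk' f.range)
  have hΦf : ∀ x, Φ (f x) = (p x, 0) := fun x =>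
    Prod.ext (hφf x) ((QuotientAddGroup.eq_zero_iff _).mpr ⟨x, rfl⟩)
  have hf0 : map f (𝓝 0) = 𝓝 0 := by
    simpa using hfo.map_nhds_eq hf.continuousAt (x := 0)
  have hΦ0 : map Φ (𝓝 0) = 𝓝 0 := by
    have hp0 : map p (𝓝 0) = 𝓝 0 := by
      simpa using hpo.map_nhds_eq hp.continuousAt (x := 0)
    have hcomp : Φ ∘ f = (fun t => (t, (0 : Q))) ∘ p := funext hΦf
    have hprod : 𝓝 ((0 : (Fin l → ℝ) × (Fin k → AddCircle (1 : ℝ))), (0 : Q)) =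
        map (fun t => (t, 0)) (𝓝 0) := by
      rw [nhds_prod_eq, nhds_discrete Q, prod_pure]
    rw [← hf0, map_map, hcomp, ← map_map, hp0]
    exact hprod.symm
  have hΦinj : Function.Injective Φ := by
    rw [injective_iff_map_eq_zero]
    intro g hg
    obtain ⟨x, rfl⟩ : g ∈ f.range := (QuotientAddGroup.eq_zero_iff _).mp (congrArg Prod.snd hg)
    rw [hΦf] at hg
    exact (hpk x).mp (congrArg Prod.fst hg)
  have hΦsurj : Function.Surjective Φ := by
    rintro ⟨t, q⟩
    obtain ⟨g, rfl⟩ := QuotientAddGroup.mk_surjective q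
    obtain ⟨x, hx⟩ := hps (t - φ g)
    refine ⟨g + f x, ?_⟩
    rw [map_add, hΦf, hx]
    exact Prod.ext (by simp [Φ]) (by simp [Φ]; rfl)
  have hΦc : Continuous Φ := continuous_of_continuousAt_zero Φ (by
    rw [ContinuousAt, map_zero, Tendsto, hΦ0])
  have hΦo : IsOpenMap Φ := by
    rw [IsTopologicalAddGroup.isOpenMap_iff_nhds_zero, hΦ0]
  let e₁ : G ≃ₜ+ ((Fin l → ℝ) × (Fin k → AddCircle (1 : ℝ))) × Q :=
    { AddEquiv.ofBijective Φ ⟨hΦinj, hΦsurj⟩ with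
      continuous_toFun := hΦc
      continuous_invFun := ((Equiv.ofBijective Φ
        ⟨hΦinj, hΦsurj⟩).toHomeomorphOfContinuousOpen hΦc hΦo).symm.continuous }
  let e₂ : (((Fin l → ℝ) × (Fin k → AddCircle (1 : ℝ))) × Q) ≃ₜ+
      ((Fin l → ℝ) × (Fin k → AddCircle (1 : ℝ))) × ((Fin m → ℤ) × F) :=
    { (AddEquiv.refl _).prodCongr ψ with
      continuous_toFun := continuous_id.prodMap continuous_of_discreteTopology
      continuous_invFun := continuous_id.prodMap continuous_of_discreteTopology }
  let e₃ : (((Fin l → ℝ) × (Fin k → AddCircle (1 : ℝ))) × ((Fin m → ℤ) × F)) ≃ₜ+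
      (Fin l → ℝ) × (Fin m → ℤ) × (Fin k → AddCircle (1 : ℝ)) × F :=
    { toFun := fun x => (x.1.1, x.2.1, x.1.2, x.2.2)
      invFun := fun x => ((x.1, x.2.2.1), (x.2.1, x.2.2.2))
      map_add' := fun _ _ => rfl
      continuous_toFun := by fun_prop
      continuous_invFun := by fun_prop }
  exact ⟨l, m, k, F, _, inferInstance, inferInstance, inferInstance,
    ⟨(e₁.trans e₂).trans e₃⟩⟩

section Exponential

variable {A : Type*} [NormedCommRing A] [NormedAlgebra ℝ A] [FiniteDimensional ℝ A]

variable (A) in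
/-- The exponential of a finite-dimensional commutative real normed algebra, as a homomorphism to
the group of units. -/
noncomputable def expUnits : A →+ Additive Aˣ :=
  haveI := FiniteDimensional.complete ℝ A
  letI := NormedAlgebra.restrictScalars ℚ ℝ A
  { toFun := fun a => Additive.ofMul
      ⟨NormedSpace.exp a, NormedSpace.exp (-a),
        by rw [← NormedSpace.exp_add, add_neg_cancel, NormedSpace.exp_zero],
        by rw [← NormedSpace.exp_add, neg_add_cancel, NormedSpace.exp_zero]⟩
    map_zero' := congrArg Additive.ofMul (Units.ext NormedSpace.exp_zero)
    map_add' := fun _ _ => congrArg Additive.ofMul (Units.ext NormedSpace.exp_add) }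

theorem coe_expUnits (a : A) : ((expUnits A a).toMul : A) = NormedSpace.exp a := rfl

theorem hasStrictFDerivAt_exp_zero_equiv :
    HasStrictFDerivAt (NormedSpace.exp : A → A)
      ((ContinuousLinearEquiv.refl ℝ A : A ≃L[ℝ] A) : A →L[ℝ] A) 0 := by
  have := FiniteDimensional.complete ℝ A
  exact hasStrictFDerivAt_exp_zero

theorem continuous_expUnits : Continuous (expUnits A) := by
  have := FiniteDimensional.complete ℝ A
  let := NormedAlgebra.restrictScalars ℚ ℝ A
  exact (Units.isOpenEmbedding_val (R := A)).isInducing.continuous_iff.mpr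
    NormedSpace.exp_continuous

theorem map_expUnits_nhds_zero : map (expUnits A) (𝓝 0) = 𝓝 0 := by
  have := FiniteDimensional.complete ℝ A
  have h : map ((fun u : Additive Aˣ => (u.toMul : A)) ∘ expUnits A) (𝓝 0) = 𝓝 1 := by
    have := hasStrictFDerivAt_exp_zero_equiv (A := A).map_nhds_eq_of_equiv
    rwa [NormedSpace.exp_zero] at this
  have hval : IsOpenEmbedding (fun u : Additive Aˣ => (u.toMul : A)) :=
    Units.isOpenEmbedding_val (R := A)
  rw [← map_map] at h
  have h0 := hval.map_nhds_eq 0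
  exact map_injective hval.injective (h.trans h0.symm)

theorem isOpen_range_expUnits : IsOpen ((expUnits A).range : Set (Additive Aˣ)) := by
  have := FiniteDimensional.complete ℝ A
  refine AddSubgroup.isOpen_of_mem_nhds (g := 0) _ ?_
  rw [← map_expUnits_nhds_zero]
  exact mem_of_superset (image_mem_map univ_mem) (by simp)

theorem eventually_expUnits_eq_zero : ∀ᶠ x in 𝓝 (0 : A), expUnits A x = 0 → x = 0 := by
  have := FiniteDimensional.complete ℝ A
  have h := hasStrictFDerivAt_exp_zero_equiv (A := A)
  filter_upwards [(h.toOpenPartialHomeomorph _).open_source.mem_nhds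
    h.mem_toOpenPartialHomeomorph_source] with x hx hx0
  refine (h.toOpenPartialHomeomorph _).injOn hx h.mem_toOpenPartialHomeomorph_source ?_
  change NormedSpace.exp x = NormedSpace.exp 0
  rw [← coe_expUnits, hx0, NormedSpace.exp_zero]
  rfl

/-- The square of a unit is an exponential: it is joined to `1` inside the group of units by the
algebra norms of the points of a complex line. -/
theorem two_nsmul_mem_range_expUnits (u : Additive Aˣ) : 2 • u ∈ (expUnits A).range := by
  have := FiniteDimensional.complete ℝ A
  let v : A := u.toMul
  let p : ℂ → A := fun z => algebraMap ℝ A (Complex.normSq (1 - z)) +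
    algebraMap ℝ A (2 * ((1 - z) * (starRingEnd ℂ) z).re) * v +
    algebraMap ℝ A (Complex.normSq z) * v ^ 2
  have hp : Continuous p := by
    have := continuous_algebraMap ℝ A
    fun_prop
  have hφ : ∀ (φ : A →ₐ[ℝ] ℂ) (z : ℂ), φ (p z) =
      ((1 - z) + z * φ v) * ((1 - (starRingEnd ℂ) z) + (starRingEnd ℂ) z * φ v) := by
    intro φ z
    have hre : ∀ w : ℂ, algebraMap ℝ ℂ (2 * w.re) = w + (starRingEnd ℂ) w := fun w => by
      rw [Complex.add_conj]; rfl
    have hns : ∀ w : ℂ, algebraMap ℝ ℂ (Complex.normSq w) = w * (starRingEnd ℂ) w := fun w => by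
      rw [Complex.mul_conj]; rfl
    simp only [p, map_add, map_mul φ, map_pow, AlgHom.commutes, hre, hns]
    simp only [map_sub, map_mul, map_one, Complex.conj_conj]
    ring
  let bad : Set ℂ := {z | ∃ φ : A →ₐ[ℝ] ℂ, φ (p z) = 0}
  have hbad : bad.Finite := by
    refine (Set.finite_iUnion fun φ : A →ₐ[ℝ] ℂ =>
      Set.toFinite {(1 - φ v)⁻¹, (starRingEnd ℂ) (1 - φ v)⁻¹}).subset ?_
    rintro z ⟨φ, h0⟩
    have key : ∀ w : ℂ, (1 - w) + w * φ v = 0 → w = (1 - φ v)⁻¹ := fun w hw =>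
      eq_inv_of_mul_eq_one_left (by linear_combination -hw)
    rw [hφ, mul_eq_zero] at h0
    refine Set.mem_iUnion.mpr ⟨φ, ?_⟩
    rcases h0 with h0 | h0
    · exact Or.inl (key _ h0)
    · right
      rw [Set.mem_singleton_iff, ← key _ h0, Complex.conj_conj]
  have hunit : ∀ z ∈ badᶜ, IsUnit (p z) := by
    intro z hz
    by_contra hnu
    obtain ⟨I, hI, hzI⟩ := exists_max_ideal_of_mem_nonunits hnu
    let := Ideal.Quotient.field I
    let φ : A →ₐ[ℝ] ℂ := (IsAlgClosed.lift (R := ℝ) (S := A ⧸ I) (M := ℂ)).comp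
      (Ideal.Quotient.mkₐ ℝ I)
    exact hz ⟨φ, by simp [φ, Ideal.Quotient.eq_zero_iff_mem.mpr hzI]⟩
  have hp0 : p 0 = 1 := by simp [p]
  have hp1 : p 1 = v ^ 2 := by simp [p]
  have h0 : (0 : ℂ) ∈ badᶜ := by
    rintro ⟨φ, hz⟩
    simp [hp0] at hz
  have h1 : (1 : ℂ) ∈ badᶜ := by
    rintro ⟨φ, hz⟩
    rw [hp1] at hz
    exact ((u.toMul.isUnit.pow 2).map φ).ne_zero hz
  have hconn : IsPreconnected badᶜ :=
    (hbad.countable.isPathConnected_compl_of_one_lt_rank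
      (by simp)).isConnected.isPreconnected
  let P : (badᶜ : Set ℂ) → Additive Aˣ := fun z => Additive.ofMul (hunit z z.2).unit
  have hP : Continuous P :=
    (Units.isOpenEmbedding_val (R := A)).isInducing.continuous_iff.mpr
      (hp.comp continuous_subtype_val)
  have : PreconnectedSpace (badᶜ : Set ℂ) := Subtype.preconnectedSpace hconn
  have hclopen : IsClopen (P ⁻¹' ((expUnits A).range : Set (Additive Aˣ))) :=
    ⟨(AddSubgroup.isClosed_of_isOpen _ isOpen_range_expUnits).preimage hP,
      isOpen_range_expUnits.preimage hP⟩
  have hP0 : P ⟨0, h0⟩ = 0 := congrArg Additive.ofMul (Units.ext hp0)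
  have hP1 : P ⟨1, h1⟩ = 2 • u := congrArg Additive.ofMul (Units.ext hp1)
  have huniv := hclopen.eq_univ ⟨⟨0, h0⟩, ⟨0, by rw [hP0, map_zero]⟩⟩
  rw [← hP1]
  exact huniv.ge (Set.mem_univ (⟨1, h1⟩ : (badᶜ : Set ℂ)))

/-- The exponentials form a subgroup of finite index in the group of units: every coset is
represented by one of the finitely many involutions. -/
theorem finite_quotient_range_expUnits : Finite (Additive Aˣ ⧸ (expUnits A).range) := by
  have : IsArtinianRing A := IsArtinianRing.of_finite ℝ A
  have : Finite (TopologicalSpace.Clopens (PrimeSpectrum A)) :=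
    Finite.of_injective (fun s => (s : Set (PrimeSpectrum A))) SetLike.coe_injective
  have : Finite {e : A // IsIdempotentElem e} :=
    Finite.of_equiv _ (PrimeSpectrum.isIdempotentElemEquivClopens (R := A)).toEquiv.symm
  obtain ⟨c, hc⟩ : ∃ c : A, 2 * c = 1 :=
    ⟨algebraMap ℝ A 2⁻¹, by rw [← map_ofNat (algebraMap ℝ A) 2, ← map_mul]; simp⟩
  let T := {s : Additive Aˣ // 2 • s = 0}
  have hT : ∀ s : T, (s.1.toMul : A) * s.1.toMul = 1 := fun s => by
    have := congrArg (fun t : Additive Aˣ => (t.toMul : A)) s.2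
    simpa [two_nsmul] using this
  have : Finite T := by
    refine Finite.of_injective (β := {e : A // IsIdempotentElem e})
      (fun s => ⟨c * (1 - s.1.toMul), ?_⟩) fun s t hst => ?_
    · unfold IsIdempotentElem
      linear_combination c ^ 2 * hT s + c * (1 - (s.1.toMul : A)) * hc
    · refine Subtype.ext (congrArg Additive.ofMul (Units.ext ?_))
      have h : c * (1 - (s.1.toMul : A)) = c * (1 - (t.1.toMul : A)) := Subtype.ext_iff.mp hst
      change (s.1.toMul : A) = t.1.toMul
      linear_combination -2 * h + ((t.1.toMul : A) - s.1.toMul) * hc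
  refine Finite.of_surjective (fun s : T => (s.1 : Additive Aˣ ⧸ (expUnits A).range)) fun q => ?_
  obtain ⟨u, rfl⟩ := QuotientAddGroup.mk_surjective q
  obtain ⟨a, ha⟩ := two_nsmul_mem_range_expUnits u
  have ha' : 2 • expUnits A ((2⁻¹ : ℝ) • a) = 2 • u := by
    rw [← map_nsmul, ← ha, ← Nat.cast_smul_eq_nsmul ℝ, smul_smul]
    simp
  refine ⟨⟨u - expUnits A ((2⁻¹ : ℝ) • a), by rw [nsmul_sub, ha', sub_self]⟩, ?_⟩
  rw [QuotientAddGroup.eq]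
  exact ⟨(2⁻¹ : ℝ) • a, by rw [neg_sub, sub_add_cancel]⟩

/-- A closed subgroup of the unit group of a finite-dimensional commutative real algebra is a
product of a vector group, a lattice, a torus and a finite group. -/
theorem AddSubgroup.exists_continuousAddEquiv_of_isClosed_units (H : AddSubgroup (Additive Aˣ))
    (hH : IsClosed (H : Set (Additive Aˣ))) :
    ∃ (l m k : ℕ) (F : Type) (_ : AddCommGroup F) (_ : Finite F) (_ : TopologicalSpace F)
      (_ : DiscreteTopology F),
      Nonempty (H ≃ₜ+ (Fin l → ℝ) × (Fin m → ℤ) × (Fin k → AddCircle (1 : ℝ)) × F) := by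
  let K : AddSubgroup A := H.comap (expUnits A)
  obtain ⟨hloc, s, hs, hsK, hKs⟩ :=
    K.lineal_nhds_and_finite_generation (hH.preimage continuous_expUnits)
  let f : K.lineal →+ H :=
    ((expUnits A).comp K.lineal.subtype.toAddMonoidHom).codRestrict H
      fun x => mem_of_mem_lineal x.2
  have hf : Continuous f :=
    (continuous_expUnits.comp continuous_subtype_val).subtype_mk _
  have hfo : IsOpenMap f := by
    rw [IsTopologicalAddGroup.isOpenMap_iff_nhds_zero]
    intro S hS
    rw [Filter.mem_map, nhds_subtype, Filter.mem_comap] at hS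
    obtain ⟨U, hU, hUS⟩ := hS
    have himg : expUnits A '' (U ∩ {x | x ∈ K → x ∈ K.lineal}) ∈ 𝓝 (0 : Additive Aˣ) := by
      rw [← map_expUnits_nhds_zero]
      exact image_mem_map (inter_mem hU hloc)
    rw [nhds_subtype]
    refine ⟨_, himg, ?_⟩
    rintro ⟨h, hh⟩ ⟨x, ⟨hxU, hx⟩, rfl⟩
    exact hUS (a := ⟨x, hx hh⟩) hxU
  have hker : ∀ᶠ x in 𝓝 (0 : K.lineal), f x = 0 → x = 0 := by
    rw [nhds_subtype]
    filter_upwards [eventually_expUnits_eq_zero.comap _] with x hx hfx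
    exact Subtype.ext (hx (congrArg Subtype.val hfx))
  let q : H → Additive Aˣ ⧸ (expUnits A).range := fun h => (h : Additive Aˣ)
  have := finite_quotient_range_expUnits (A := A)
  let r : Set.range q → H := Set.rangeSplitting q
  let g : K →+ H := ((expUnits A).comp K.subtype).codRestrict H fun x => x.2
  let s' : Set H := Set.range r ∪ g '' (Subtype.val ⁻¹' s)
  have hs' : s'.Finite := (Set.finite_range r).union
    ((hs.preimage Subtype.val_injective.injOn).image _)
  have hgK : ∀ x : K, g x ∈ f.range ⊔ closure s' := by
    have hle : K.lineal.toAddSubgroup ⊔ closure s ≤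
        ((f.range ⊔ closure s').comap g).map K.subtype := by
      refine sup_le (fun v hv => ?_) ((closure_le _).mpr fun x hx => ?_)
      · exact ⟨⟨v, mem_of_mem_lineal hv⟩, mem_sup_left ⟨⟨v, hv⟩, rfl⟩, rfl⟩
      · exact ⟨⟨x, hsK hx⟩,
          mem_sup_right (subset_closure (Or.inr ⟨⟨x, hsK hx⟩, hx, rfl⟩)), rfl⟩
    intro x
    obtain ⟨y, hy, hyx⟩ := hle (hKs x.2)
    rwa [← Subtype.ext hyx]
  refine exists_continuousAddEquiv_of_isOpenMap f hf hfo hker hs' (top_le_iff.mp fun h _ => ?_)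
  have hr : q (r ⟨q h, h, rfl⟩) = q h := Set.apply_rangeSplitting q ⟨q h, h, rfl⟩
  obtain ⟨x, hx⟩ := QuotientAddGroup.eq.mp hr
  have hxK : x ∈ K := by
    change expUnits A x ∈ H
    rw [hx]
    exact H.add_mem (H.neg_mem (Subtype.prop _)) h.2
  have hgx : g ⟨x, hxK⟩ = -r ⟨q h, h, rfl⟩ + h := Subtype.ext hx
  have hh : h = r ⟨q h, h, rfl⟩ + g ⟨x, hxK⟩ := by rw [hgx, add_neg_cancel_left]
  rw [hh]
  exact add_mem (mem_sup_right (subset_closure (Or.inl ⟨_, rfl⟩))) (hgK _)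

end Exponential

/-- Structure theorem: every closed abelian subgroup `H` of `GL(n,ℝ)` is isomorphic as a
topological group to `ℝˡ × ℤᵐ × (ℝ/ℤ)ᵏ × F` for some `l, m, k ∈ ℕ` and some finite
abelian group `F` (the additive factors are viewed as multiplicative groups, and the
isomorphism is a multiplication-preserving homeomorphism). -/
theorem closed_abelian_subgroup_structure
    (n : ℕ) (H : Subgroup (GL (Fin n) ℝ))
    (hclosed : IsClosed (H : Set (GL (Fin n) ℝ)))
    (habelian : ∀ a ∈ H, ∀ b ∈ H, a * b = b * a) :
    ∃ (l m k : ℕ) (F : Type) (_ : CommGroup F) (_ : Fintype F)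
      (_ : TopologicalSpace F) (_ : DiscreteTopology F)
      (e : ↥H ≃ₜ (Multiplicative (Fin l → ℝ) × Multiplicative (Fin m → ℤ) ×
        Multiplicative (Fin k → AddCircle (1 : ℝ)) × F)),
      ∀ x y : ↥H, e (x * y) = e x * e y := by
  let A : Subalgebra ℝ (Matrix (Fin n) (Fin n) ℝ) := Algebra.adjoin ℝ (Units.val '' (H : Set _))
  have hA : IsMulCommutative A := Algebra.isMulCommutative_adjoin ℝ (by
    rintro _ ⟨a, ha, rfl⟩ _ ⟨b, hb, rfl⟩
    exact congrArg Units.val (habelian a ha b hb))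
  let := Matrix.linftyOpNormedRing (n := Fin n) (α := ℝ)
  let := Matrix.linftyOpNormedAlgebra (R := ℝ) (n := Fin n) (α := ℝ)
  let : NormedCommRing A :=
    { (inferInstance : NormedRing A) with mul_comm := fun a b => hA.is_comm.comm a b }
  let : NormedAlgebra ℝ A := { (inferInstance : Algebra ℝ A) with
    norm_smul_le := fun r a => norm_smul_le r (a : Matrix (Fin n) (Fin n) ℝ) }
  have hmem : ∀ h ∈ H, (h : Matrix (Fin n) (Fin n) ℝ) ∈ A := fun h hh =>
    Algebra.subset_adjoin ⟨h, hh, rfl⟩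
  let φ : Aˣ →* GL (Fin n) ℝ := Units.map A.val
  have hφ : Continuous φ := Units.continuous_iff.mpr
    ⟨continuous_subtype_val.comp Units.continuous_val,
      continuous_subtype_val.comp Units.continuous_coe_inv⟩
  let H' : AddSubgroup (Additive Aˣ) := (H.comap φ).toAddSubgroup
  let ψ : H → Aˣ := fun h =>
    ⟨⟨h.1, hmem _ h.2⟩, ⟨(h.1⁻¹ : GL (Fin n) ℝ), hmem _ (H.inv_mem h.2)⟩,
      Subtype.ext h.1.mul_inv, Subtype.ext h.1.inv_mul⟩
  have hφψ : ∀ h, φ (ψ h) = h := fun h => Units.ext rfl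
  have hψH : ∀ h, φ (ψ h) ∈ H := fun h => (hφψ h).symm ▸ h.2
  have hψ : Continuous ψ := Units.continuous_iff.mpr
    ⟨(Units.continuous_val.comp continuous_subtype_val).subtype_mk _,
      (Units.continuous_coe_inv.comp continuous_subtype_val).subtype_mk _⟩
  let e₁ : H ≃ₜ H' :=
    { toFun := fun h => ⟨Additive.ofMul (ψ h), hψH h⟩
      invFun := fun u => ⟨φ u.1.toMul, u.2⟩
      left_inv := fun h => Subtype.ext (hφψ h)
      right_inv := fun u => Subtype.ext (congrArg Additive.ofMul (Units.ext rfl))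
      continuous_toFun := hψ.subtype_mk _
      continuous_invFun := (hφ.comp continuous_subtype_val).subtype_mk _ }
  have hmul : ∀ x y : H, e₁ (x * y) = e₁ x + e₁ y := fun x y =>
    Subtype.ext (congrArg Additive.ofMul (Units.ext rfl))
  obtain ⟨l, m, k, F, _, _, _, _, ⟨e₂⟩⟩ :=
    H'.exists_continuousAddEquiv_of_isClosed_units (hclosed.preimage hφ)
  let e₃ : ((Fin l → ℝ) × (Fin m → ℤ) × (Fin k → AddCircle (1 : ℝ)) × F) ≃ₜ
      Multiplicative (Fin l → ℝ) × Multiplicative (Fin m → ℤ) ×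
        Multiplicative (Fin k → AddCircle (1 : ℝ)) × Multiplicative F :=
    Homeomorph.refl _
  refine ⟨l, m, k, Multiplicative F, inferInstance, Fintype.ofFinite _, inferInstance,
    inferInstance, (e₁.trans e₂.toHomeomorph).trans e₃, fun x y => ?_⟩
  change e₃ (e₂ (e₁ (x * y))) = e₃ (e₂ (e₁ x)) * e₃ (e₂ (e₁ y))
  rw [hmul, map_add]
  rfl
end

section
/- Let H be a closed abelian subgroup of GL(n,ℝ) that is isomorphic as a topological group to ℝˡ × ℤᵐ × (ℝ/ℤ)ᵏ × F with F a finite abelian group, and set j = l + m. Then there exist a closed subgroup H_c of GL(n,ℝ) that is isomorphic as a topological group to ℝʲ, and a discrete subgroup H_d contained in H ∩ H_c that is isomorphic as a group to ℤʲ, such that both quotient groups H/H_d and H_c/H_d are compact. -/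
open Topology NormedSpace

theorem spectrum_finite_of_finiteDimensional {K A : Type*} [Field K] [Ring A] [Algebra K A]
    [FiniteDimensional K A] (a : A) : (spectrum K a).Finite := by
  classical
  nontriviality A
  refine (minpoly K a).roots.toFinset.finite_toSet.subset fun z hz => ?_
  have h := spectrum.subset_polynomial_aeval a (minpoly K a) ⟨z, hz, rfl⟩
  rw [minpoly.aeval, spectrum.zero_eq, Set.mem_singleton_iff] at h
  simpa [minpoly.ne_zero (Algebra.IsIntegral.isIntegral (R := K) a)] using h

/-- In a Banach algebra, the exponential map covers a neighbourhood of `1`. -/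
theorem range_exp_mem_nhds_one {A : Type*} [NormedRing A] [NormedAlgebra ℂ A] [CompleteSpace A] :
    Set.range (exp : A → A) ∈ 𝓝 1 := by
  have h : HasStrictFDerivAt (exp : A → A)
      ((ContinuousLinearEquiv.refl ℂ A : A ≃L[ℂ] A) : A →L[ℂ] A) 0 :=
    hasStrictFDerivAt_exp_zero (𝕂 := ℂ) (𝔸 := A)
  have h2 := h.map_nhds_eq_of_equiv
  rw [exp_zero] at h2
  rw [← h2]
  exact Filter.range_mem_map

theorem exists_exp_eq_of_isUnit {A : Type*} [NormedRing A] [NormedAlgebra ℂ A]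
    [FiniteDimensional ℂ A] (hcomm : ∀ x y : A, Commute x y) {a : A} (ha : IsUnit a) :
    ∃ y, exp y = a := by
  let : NormedAlgebra ℚ A := .restrictScalars ℚ ℂ A
  have : CompleteSpace A := FiniteDimensional.complete ℂ A
  let g : ℂ → A := fun z => 1 + z • (a - 1)
  have hg : Continuous g := by fun_prop
  let U : Set ℂ := {z | IsUnit (g z)}
  have hUo : IsOpen U := Units.isOpen.preimage hg
  have hUc : Uᶜ.Countable := by
    have hfin := (spectrum_finite_of_finiteDimensional (K := ℂ) (1 - a)).image (fun w => w⁻¹)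
    refine (hfin.subset fun z hz => ?_).countable
    have hz0 : z ≠ 0 := by
      rintro rfl
      exact hz (by simp [U, g])
    refine ⟨z⁻¹, ?_, inv_inv z⟩
    rw [spectrum.mem_iff]
    intro hu
    apply hz
    have : g z = z • (algebraMap ℂ A z⁻¹ - (1 - a)) := by
      simp only [g, Algebra.algebraMap_eq_smul_one, smul_sub, smul_smul, mul_inv_cancel₀ hz0,
        one_smul]
      abel
    change IsUnit (g z)
    rw [this]
    exact hu.smul (Units.mk0 z hz0)
  have hUconn : IsPreconnected U := by
    simpa using (hUc.isConnected_compl_of_one_lt_rank (by simp)).isPreconnected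
  have key : ∀ z ∈ U, ∀ᶠ w in 𝓝 z, ∃ y, g w = g z * exp y := by
    intro z hz
    obtain ⟨u, hu⟩ := hz
    have ht : Filter.Tendsto (fun w => (↑u⁻¹ : A) * g w) (𝓝 z) (𝓝 1) := by
      have : Continuous fun w => (↑u⁻¹ : A) * g w := continuous_const.mul hg
      simpa [← hu] using this.tendsto z
    filter_upwards [ht range_exp_mem_nhds_one] with w hw
    obtain ⟨y, hy⟩ := hw
    exact ⟨y, by rw [hy, ← hu, Units.mul_inv_cancel_left]⟩
  have hsub : U ⊆ {z | g z ∈ Set.range (exp : A → A)} := by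
    refine (hUconn.subset_of_closure_inter_subset (u := {z | z ∈ U ∧ g z ∈ Set.range exp})
      ?_ ?_ ?_).trans fun z hz => hz.2
    · rw [isOpen_iff_mem_nhds]
      rintro z ⟨hz, x, hx⟩
      filter_upwards [key z hz, hUo.mem_nhds hz] with w hw hwU
      obtain ⟨y, hy⟩ := hw
      exact ⟨hwU, x + y, by rw [exp_add_of_commute (hcomm _ _), hx, hy]⟩
    · exact ⟨0, by simp [U, g], by simp [U, g], 0, by simp [g]⟩
    · rintro z ⟨hzc, hz⟩
      obtain ⟨w, ⟨y, hy⟩, hw, x, hx⟩ := mem_closure_iff_nhds.1 hzc _ (key z hz)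
      refine ⟨hz, x + -y, ?_⟩
      rw [exp_add_of_commute (hcomm _ _), hx, hy, mul_assoc,
        ← exp_add_of_commute (hcomm _ _)]
      simp
  simpa [g] using hsub (show (1 : ℂ) ∈ U by simpa [U, g] using ha)


theorem exists_exp_eq_and_forall_commute_of_isUnit {A : Type*} [NormedRing A] [NormedAlgebra ℂ A]
    [FiniteDimensional ℂ A] {a : A} (ha : IsUnit a) :
    ∃ y, exp y = a ∧ ∀ c, Commute c a → Commute c y := by
  let B := Subalgebra.centralizer ℂ (Set.centralizer {a})
  have haB : a ∈ B := fun x hx => (hx a rfl).symm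
  have hBa : ∀ b ∈ B, b ∈ Set.centralizer {a} := fun b hb => by
    rintro _ rfl
    exact hb _ (by rintro _ rfl; rfl)
  have hcomm : ∀ x y : B, Commute x y := fun x y => Subtype.ext (y.2 x (hBa _ x.2))
  obtain ⟨u, rfl⟩ := ha
  have hu : (↑u⁻¹ : A) ∈ B := fun x hx => (show Commute x u from haB x hx).units_inv_right
  have hunit : IsUnit (⟨u, haB⟩ : B) :=
    ⟨⟨⟨u, haB⟩, ⟨_, hu⟩, Subtype.ext u.mul_inv, Subtype.ext u.inv_mul⟩, rfl⟩
  obtain ⟨y, hy⟩ := exists_exp_eq_of_isUnit hcomm hunit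
  refine ⟨y, ?_, fun c hc => y.2 c ?_⟩
  · let : NormedAlgebra ℚ A := .restrictScalars ℚ ℂ A
    let : NormedAlgebra ℚ B := .restrictScalars ℚ ℂ B
    have : CompleteSpace B := FiniteDimensional.complete ℂ B
    exact (map_exp B.val continuous_subtype_val y).symm.trans (congrArg B.val hy)
  · rintro _ rfl
    exact hc.symm

/-- If a real Banach algebra is the fixed-point set of an involution of a finite-dimensional
complex one, then squares of units have logarithms in the double centralizer. -/
theorem exists_exp_eq_sq_and_forall_commute {E A : Type*} [NormedRing E] [NormedAlgebra ℝ E]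
    [CompleteSpace E] [NormedRing A] [NormedAlgebra ℂ A] [FiniteDimensional ℂ A]
    (i : E →+* A) (hi : Continuous i) (hinj : Function.Injective i)
    (c : A →+* A) (hc : Continuous c) (hcc : ∀ y, c (c y) = y) (hci : ∀ x, c (i x) = i x)
    (hfix : ∀ y, c y = y → ∃ x, i x = y) {a : E} (ha : IsUnit a) :
    ∃ x, exp x = a ^ 2 ∧ ∀ b, Commute b a → Commute b x := by
  let : NormedAlgebra ℚ E := .restrictScalars ℚ ℝ E
  let : NormedAlgebra ℚ A := .restrictScalars ℚ ℂ A
  have : CompleteSpace A := FiniteDimensional.complete ℂ A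
  obtain ⟨y, hy, hya⟩ := exists_exp_eq_and_forall_commute_of_isUnit (ha.map i)
  have hcy : ∀ b, Commute b (i a) → Commute b (c y) := fun b hb => by
    have := (hya (c b) (by simpa [hci] using hb.map c)).map c
    rwa [hcc] at this
  obtain ⟨x, hx⟩ := hfix (y + c y) (by rw [map_add, hcc, add_comm])
  refine ⟨x, hinj ?_, fun b hb => hinj ?_⟩
  · rw [map_exp i hi, hx, exp_add_of_commute (hcy _ (hya _ (Commute.refl _)).symm),
      ← map_exp c hc, hy, hci, map_pow, sq]
  · rw [map_mul, map_mul, hx]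
    exact (hya _ (hb.map i)).add_right (hcy _ (hb.map i))

theorem exists_continuous_monoidHom_of_commute {ι E : Type*} [Fintype ι] [DecidableEq ι]
    [NormedRing E] [NormedAlgebra ℝ E] [CompleteSpace E] (x : ι → E)
    (hx : ∀ i j, Commute (x i) (x j)) :
    ∃ φ : Multiplicative (ι → ℝ) →* Eˣ, Continuous φ ∧
      ∀ t, (φ (.ofAdd t) : E) = exp (∑ i, t i • x i) := by
  let : NormedAlgebra ℚ E := .restrictScalars ℚ ℝ E
  let L : (ι → ℝ) → E := fun t => ∑ i, t i • x i
  have hL : Continuous L := by fun_prop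
  have hcomm : ∀ s t, Commute (L s) (L t) := fun s t =>
    Commute.sum_left _ _ _ fun i _ => Commute.sum_right _ _ _ fun j _ =>
      ((hx i j).smul_left _).smul_right _
  let f : Multiplicative (ι → ℝ) →* E :=
    { toFun := fun t => exp (L t.toAdd)
      map_one' := by simp [L]
      map_mul' := fun s t => by
        rw [← exp_add_of_commute (hcomm _ _)]
        simp [L, add_smul, Finset.sum_add_distrib] }
  have hf : Continuous f := exp_continuous.comp (hL.comp continuous_toAdd)
  refine ⟨f.toHomUnits, Units.continuous_iff.2 ⟨hf, ?_⟩, fun t => rfl⟩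
  have : (fun t => ((f.toHomUnits t)⁻¹ : Eˣ).val) = fun t => f t⁻¹ := by
    ext t
    rw [← map_inv]
    rfl
  exact this ▸ hf.comp continuous_inv

/-- The square of a representation of `ℤʲ` by units extends continuously to `ℝʲ`, provided squares
of units have logarithms in their double centralizers. -/
theorem exists_continuous_monoidHom_extending_sq {ι E : Type*} [Fintype ι] [DecidableEq ι]
    [NormedRing E] [NormedAlgebra ℝ E] [CompleteSpace E]
    (hE : ∀ a : E, IsUnit a → ∃ x, exp x = a ^ 2 ∧ ∀ b, Commute b a → Commute b x)
    (θ : Multiplicative (ι → ℤ) →* Eˣ) :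
    ∃ φ : Multiplicative (ι → ℝ) →* Eˣ, Continuous φ ∧
      ∀ z : ι → ℤ, φ (.ofAdd fun i => (z i : ℝ)) = θ (.ofAdd z) ^ 2 := by
  have hθ : ∀ u v, Commute (θ u) (θ v) := fun u v => (Commute.all u v).map θ
  choose x hx hxc using fun i => hE (θ (.ofAdd (Pi.single i 1))) (Units.isUnit _)
  obtain ⟨φ, hφ, hφx⟩ := exists_continuous_monoidHom_of_commute x fun i j =>
    hxc j _ (hxc i _ (hθ _ _).units_val).symm
  refine ⟨φ, hφ, fun z => ?_⟩
  let p : (ι → ℤ) →+ Additive Eˣ :=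
    { toFun := fun z => .ofMul (φ (.ofAdd fun i => (z i : ℝ)))
      map_zero' := by
        simp only [Pi.zero_apply, Int.cast_zero]
        exact map_one φ
      map_add' := fun u v => by
        simp only [Pi.add_apply, Int.cast_add]
        exact map_mul φ (.ofAdd fun i => (u i : ℝ)) (.ofAdd fun i => (v i : ℝ)) }
  let q : (ι → ℤ) →+ Additive Eˣ :=
    { toFun := fun z => .ofMul (θ (.ofAdd z) ^ 2)
      map_zero' := by simp
      map_add' := fun u v => by
        rw [ofAdd_add, map_mul, (hθ _ _).mul_pow, ofMul_mul] }
  suffices p = q from DFunLike.congr_fun this z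
  refine AddMonoidHom.pi_ext fun i k => ?_
  have : p.comp (AddMonoidHom.single _ i) = q.comp (AddMonoidHom.single _ i) := by
    refine AddMonoidHom.ext_int (Units.ext ?_)
    change (φ (.ofAdd fun j => ((Pi.single i 1 : ι → ℤ) j : ℝ)) : E) =
      ((θ (.ofAdd (Pi.single i 1)) ^ 2 : Eˣ) : E)
    rw [hφx, Units.val_pow_eq_pow_val, ← hx]
    simp [Pi.single_apply]
  exact DFunLike.congr_fun this k

theorem Matrix.exists_continuous_monoidHom_extending_sq {n ι : Type*} [Fintype n] [DecidableEq n]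
    [Fintype ι] [DecidableEq ι] (θ : Multiplicative (ι → ℤ) →* GL n ℝ) :
    ∃ φ : Multiplicative (ι → ℝ) →* GL n ℝ, Continuous φ ∧
      ∀ z : ι → ℤ, φ (.ofAdd fun i => (z i : ℝ)) = θ (.ofAdd z) ^ 2 := by
  let := Matrix.linftyOpNormedRing (n := n) (α := ℝ)
  let := Matrix.linftyOpNormedAlgebra (n := n) (R := ℝ) (α := ℝ)
  let := Matrix.linftyOpNormedRing (n := n) (α := ℂ)
  let := Matrix.linftyOpNormedAlgebra (n := n) (R := ℂ) (α := ℂ)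
  have : CompleteSpace (Matrix n n ℝ) := FiniteDimensional.complete ℝ _
  refine _root_.exists_continuous_monoidHom_extending_sq (fun a ha =>
    exists_exp_eq_sq_and_forall_commute (Complex.ofRealHom.mapMatrix (m := n))
      (continuous_id.matrix_map Complex.continuous_ofReal)
      (Matrix.map_injective Complex.ofReal_injective) ((starRingEnd ℂ).mapMatrix (m := n))
      (continuous_id.matrix_map Complex.continuous_conj) (fun y => ?_) (fun x => ?_)
      (fun y hy => ?_) ha) θ
  · ext a b
    simp
  · ext a b
    simp
  · refine ⟨y.map Complex.re, ?_⟩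
    ext a b
    exact Complex.conj_eq_iff_re.1 (congrFun (congrFun hy a) b)

/-- A continuous homomorphism from `ℝʲ` that is proper on `ℤʲ` is a closed embedding. -/
theorem isClosedEmbedding_of_finite_preimage {ι G : Type*} [Fintype ι] [Group G]
    [TopologicalSpace G] [IsTopologicalGroup G] [T2Space G] [WeaklyLocallyCompactSpace G]
    {φ : Multiplicative (ι → ℝ) →* G} (hφ : Continuous φ)
    (hfin : ∀ K : Set G, IsCompact K → {z : ι → ℤ | φ (.ofAdd fun i => (z i : ℝ)) ∈ K}.Finite) :
    Topology.IsClosedEmbedding φ := by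
  have hcpt : ∀ K : Set G, IsCompact K → IsCompact (φ ⁻¹' K) := fun K hK => by
    let Q : Set (Multiplicative (ι → ℝ)) := Multiplicative.toAdd ⁻¹' Set.Icc 0 1
    have hQ : IsCompact Q := isCompact_Icc (a := (0 : ι → ℝ)) (b := 1)
    have hS := hfin _ (hK.mul (hQ.image hφ).inv)
    have hSQ := (hS.image fun z : ι → ℤ =>
      (Multiplicative.ofAdd fun i => (z i : ℝ))).isCompact.mul hQ
    refine hSQ.of_isClosed_subset (hK.isClosed.preimage hφ) fun t ht => ?_
    have hfr : (Multiplicative.ofAdd fun i => Int.fract (t.toAdd i)) ∈ Q :=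
      ⟨fun i => Int.fract_nonneg _, fun i => (Int.fract_lt_one _).le⟩
    have hdec : (Multiplicative.ofAdd fun i => ((⌊t.toAdd i⌋ : ℤ) : ℝ)) *
        (Multiplicative.ofAdd fun i => Int.fract (t.toAdd i)) = t := by
      rw [← ofAdd_add]
      exact congrArg Multiplicative.ofAdd (funext fun i => Int.floor_add_fract (t.toAdd i))
    refine ⟨_, ⟨fun i => ⌊t.toAdd i⌋, ?_, rfl⟩, _, hfr, hdec⟩
    refine ⟨φ t, ht, _, Set.inv_mem_inv.2 ⟨_, hfr, rfl⟩, ?_⟩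
    change φ t * (φ _)⁻¹ = φ _
    rw [mul_inv_eq_iff_eq_mul, ← map_mul, hdec]
  have hinj : Function.Injective φ := by
    rw [injective_iff_map_eq_one]
    intro t ht
    have hb : Bornology.IsBounded (Multiplicative.toAdd '' (φ ⁻¹' {1})) :=
      ((hcpt {1} isCompact_singleton).image continuous_toAdd).isBounded
    obtain ⟨R, hR⟩ := hb.exists_norm_le
    by_contra h
    have hpos : 0 < ‖t.toAdd‖ := norm_pos_iff.2 h
    obtain ⟨N, hN⟩ := exists_nat_gt (R / ‖t.toAdd‖)
    rw [div_lt_iff₀ hpos] at hN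
    have := hR (N • t.toAdd) ⟨t ^ N, by simp [ht], rfl⟩
    rw [← Nat.cast_smul_eq_nsmul ℝ, norm_smul] at this
    exact absurd hN (by simpa using this)
  exact .of_continuous_injective_isClosedMap hφ hinj
    (isProperMap_iff_isCompact_preimage.2 ⟨hφ, fun K hK => hcpt K hK⟩).isClosedMap

theorem compactSpace_quotient_of_forall_exists_mul_mem {G : Type*} [Group G] [TopologicalSpace G]
    (N : Subgroup G) {C : Set G} (hC : IsCompact C) (h : ∀ g, ∃ x ∈ N, g * x ∈ C) :
    CompactSpace (G ⧸ N) := by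
  refine ⟨(hC.image (continuous_quotient_mk' (s := QuotientGroup.leftRel N))).of_isClosed_subset
    isClosed_univ fun q _ => ?_⟩
  obtain ⟨g, rfl⟩ := QuotientGroup.mk_surjective q
  obtain ⟨x, hx, hgx⟩ := h g
  exact ⟨g * x, hgx, QuotientGroup.mk_mul_of_mem g hx⟩

/-- Let `H` be a closed abelian subgroup of `GL(n,ℝ)` isomorphic as a topological group to
`ℝˡ × ℤᵐ × (ℝ/ℤ)ᵏ × F` with `F` finite abelian, and set `j = l + m`. Then there are a
closed subgroup `H_c` of `GL(n,ℝ)` isomorphic as a topological group to `ℝʲ` and a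
discrete subgroup `H_d ≤ H ∩ H_c` isomorphic as a group to `ℤʲ` such that both `H/H_d`
and `H_c/H_d` are compact. -/
theorem exists_connected_and_discrete_cocompact_companions
    (n l m k : ℕ) (H : Subgroup (GL (Fin n) ℝ))
    (hclosed : IsClosed (H : Set (GL (Fin n) ℝ)))
    (habelian : ∀ a ∈ H, ∀ b ∈ H, a * b = b * a)
    (F : Type) [CommGroup F] [Fintype F] [TopologicalSpace F] [DiscreteTopology F]
    (e : ↥H ≃ₜ (Multiplicative (Fin l → ℝ) × Multiplicative (Fin m → ℤ) ×
      Multiplicative (Fin k → AddCircle (1 : ℝ)) × F))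
    (he : ∀ x y : ↥H, e (x * y) = e x * e y) :
    ∃ (Hc Hd : Subgroup (GL (Fin n) ℝ)),
      IsClosed (Hc : Set (GL (Fin n) ℝ)) ∧
      (∃ ec : ↥Hc ≃ₜ Multiplicative (Fin (l + m) → ℝ),
        ∀ x y : ↥Hc, ec (x * y) = ec x * ec y) ∧
      Hd ≤ H ⊓ Hc ∧
      DiscreteTopology ↥Hd ∧
      Nonempty (↥Hd ≃* Multiplicative (Fin (l + m) → ℤ)) ∧
      CompactSpace (↥H ⧸ Hd.subgroupOf H) ∧
      CompactSpace (↥Hc ⧸ Hd.subgroupOf Hc) := by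
  let eM := MulEquiv.mk e.toEquiv he
  let ψ : Multiplicative (Fin (l + m) → ℤ) →* (Multiplicative (Fin l → ℝ) ×
      Multiplicative (Fin m → ℤ) × Multiplicative (Fin k → AddCircle (1 : ℝ)) × F) :=
    { toFun := fun z => (.ofAdd fun i => (z.toAdd (Fin.castAdd m i) : ℝ),
        .ofAdd fun i => z.toAdd (Fin.natAdd l i), 1, 1)
      map_one' := by
        simp
        exact ⟨rfl, rfl⟩
      map_mul' := fun u v => by
        simp
        exact ⟨rfl, rfl⟩ }
  let δ : Multiplicative (Fin (l + m) → ℤ) →* H := eM.symm.toMonoidHom.comp ψ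
  have heδ : ∀ z, e (δ z) = ψ z := fun z => e.apply_symm_apply _
  obtain ⟨φ, hφ, hφδ⟩ := Matrix.exists_continuous_monoidHom_extending_sq (H.subtype.comp δ)
  have hφδ' : ∀ z : Fin (l + m) → ℤ, φ (.ofAdd fun i => (z i : ℝ)) = δ (.ofAdd (2 • z)) :=
    fun z => by
      rw [hφδ, ofAdd_nsmul, map_pow]
      rfl
  have hfin : ∀ K : Set (GL (Fin n) ℝ), IsCompact K →
      {z : Fin (l + m) → ℤ | φ (.ofAdd fun i => (z i : ℝ)) ∈ K}.Finite := fun K hK => by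
    have hKe := (hclosed.isClosedEmbedding_subtypeVal.isCompact_preimage hK).image e.continuous
    obtain ⟨R, hR⟩ := (hKe.image (continuous_toAdd.comp continuous_fst)).isBounded.exists_norm_le
    obtain ⟨S, hS⟩ := (hKe.image
      (continuous_toAdd.comp (continuous_fst.comp continuous_snd))).isBounded.exists_norm_le
    let N := max R S
    refine (Set.finite_Icc (fun _ : Fin (l + m) => -⌈N⌉) fun _ => ⌈N⌉).subset fun z hz => ?_
    have hz' : ψ (.ofAdd (2 • z)) ∈ e '' (Subtype.val ⁻¹' K) := by
      refine ⟨δ (.ofAdd (2 • z)), ?_, heδ _⟩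
      rw [Set.mem_preimage, ← hφδ']
      exact hz
    have h1 := hR _ ⟨_, hz', rfl⟩
    have h2 := hS _ ⟨_, hz', rfl⟩
    have hb : ∀ i, |2 * (z i : ℝ)| ≤ N := by
      intro i
      induction i using Fin.addCases with
      | left i =>
        have := (norm_le_pi_norm _ i).trans h1
        simp [ψ] at this
        refine le_trans ?_ (le_max_left _ _)
        simpa [abs_mul] using this
      | right i =>
        have := (norm_le_pi_norm _ i).trans h2
        simp [ψ, Int.norm_eq_abs] at this
        refine le_trans ?_ (le_max_right _ _)
        simpa [abs_mul] using this
    have hb' : ∀ i, |z i| ≤ ⌈N⌉ := fun i => by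
      have h3 := hb i
      rw [abs_mul, abs_two] at h3
      have h4 : ((|z i| : ℤ) : ℝ) ≤ ⌈N⌉ := by
        push_cast
        linarith [Int.le_ceil N, abs_nonneg (z i : ℝ)]
      exact_mod_cast h4
    exact ⟨fun i => (abs_le.1 (hb' i)).1, fun i => (abs_le.1 (hb' i)).2⟩
  have : LocallyCompactSpace (Matrix (Fin n) (Fin n) ℝ) :=
    inferInstanceAs (LocallyCompactSpace (Fin n → Fin n → ℝ))
  have hemb := isClosedEmbedding_of_finite_preimage hφ hfin
  let κ : Multiplicative (Fin (l + m) → ℤ) →* Multiplicative (Fin (l + m) → ℝ) :=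
    AddMonoidHom.toMultiplicative ((Int.castAddHom ℝ).compLeft (Fin (l + m)))
  have hκ : Topology.IsEmbedding κ :=
    Topology.IsEmbedding.piMap fun _ : Fin (l + m) => Int.isClosedEmbedding_coe_real.isEmbedding
  have hκφ : Topology.IsEmbedding (φ.comp κ) := hemb.isEmbedding.comp hκ
  refine ⟨φ.range, (φ.comp κ).range, ?_, ?_, ?_, ?_, ?_, ?_, ?_⟩
  · rw [MonoidHom.coe_range]
    exact hemb.isClosed_range
  · let ec : Multiplicative (Fin (l + m) → ℝ) ≃ₜ φ.range := hemb.isEmbedding.toHomeomorph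
    have hec : ∀ s t, ec (s * t) = ec s * ec t := fun s t => Subtype.ext (map_mul φ s t)
    exact ⟨ec.symm, (MulEquiv.mk ec.toEquiv hec).symm.map_mul⟩
  · rintro _ ⟨z, rfl⟩
    refine ⟨?_, κ z, rfl⟩
    have := hφδ' z.toAdd
    change φ (κ z) ∈ H
    exact this ▸ (δ _).2
  · exact hκφ.toHomeomorph.symm.isEmbedding.discreteTopology
  · exact ⟨(MonoidHom.ofInjective hκφ.injective).symm⟩
  · let C : Set (Multiplicative (Fin l → ℝ) × Multiplicative (Fin m → ℤ) ×
        Multiplicative (Fin k → AddCircle (1 : ℝ)) × F) :=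
      (Multiplicative.toAdd ⁻¹' Set.Icc 0 2) ×ˢ (Multiplicative.toAdd ⁻¹' Set.Icc 0 1) ×ˢ Set.univ
    have hC : IsCompact C :=
      (isCompact_Icc (a := (0 : Fin l → ℝ)) (b := 2)).prod
        ((Set.finite_Icc (0 : Fin m → ℤ) 1).isCompact.prod
          (isCompact_univ (X := (Fin k → AddCircle (1 : ℝ)) × F)))
    refine compactSpace_quotient_of_forall_exists_mul_mem _ (e.isCompact_preimage.2 hC)
      fun g => ?_
    let z : Fin (l + m) → ℤ :=
      Fin.append (fun i => -⌊(e g).1.toAdd i / 2⌋) fun i => -((e g).2.1.toAdd i / 2)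
    refine ⟨δ (.ofAdd (2 • z)), ⟨.ofAdd z, hφδ' z⟩, ?_⟩
    rw [Set.mem_preimage, he, heδ]
    refine ⟨⟨fun i => ?_, fun i => ?_⟩, ⟨fun i => ?_, fun i => ?_⟩, trivial⟩
    · have := Int.floor_le ((e g).1.toAdd i / 2)
      simp [ψ, z]
      linarith
    · have := Int.lt_floor_add_one ((e g).1.toAdd i / 2)
      simp [ψ, z]
      linarith
    · simp [ψ, z]
      omega
    · simp [ψ, z]
      omega
  · let Q : Set (Multiplicative (Fin (l + m) → ℝ)) := Multiplicative.toAdd ⁻¹' Set.Icc 0 1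
    have hQ : IsCompact Q := isCompact_Icc (a := (0 : Fin (l + m) → ℝ)) (b := 1)
    refine compactSpace_quotient_of_forall_exists_mul_mem _
      (hQ.image (f := φ.rangeRestrict) (hφ.subtype_mk _)) ?_
    rintro ⟨_, t, rfl⟩
    let z : Multiplicative (Fin (l + m) → ℤ) := .ofAdd fun i => -⌊t.toAdd i⌋
    refine ⟨φ.rangeRestrict (κ z), ⟨z, rfl⟩, t * κ z, ?_, map_mul _ _ _⟩
    have : (t * κ z).toAdd = fun i => Int.fract (t.toAdd i) := by
      ext i
      have := Int.self_sub_floor (t.toAdd i)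
      simp [κ, z, ← this, sub_eq_add_neg]
    rw [Set.mem_preimage, this]
    exact ⟨fun i => Int.fract_nonneg _, fun i => (Int.fract_lt_one _).le⟩
end

section
/- Let 𝔥 ⊆ M_n(ℝ) be a linear subspace, and let U = {x ∈ ℝⁿ : the linear map 𝔥 → ℝⁿ, A ↦ Ax, is injective}. Then U is an open subset of ℝⁿ, and if U is nonempty, then the complement ℝⁿ \ U has Lebesgue measure zero. -/
open MeasureTheory

/-- Openness of the set of parameters for which a bilinear family of linear maps is injective. -/
theorem LinearMap.isOpen_setOf_injective_apply {E V W : Type*}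
    [NormedAddCommGroup E] [NormedSpace ℝ E] [FiniteDimensional ℝ E]
    [AddCommGroup V] [Module ℝ V] [FiniteDimensional ℝ V]
    [NormedAddCommGroup W] [NormedSpace ℝ W] (T : E →ₗ[ℝ] V →ₗ[ℝ] W) :
    IsOpen {x : E | Function.Injective (T x)} := by
  let b := Module.finBasis ℝ V
  have hb (x : E) : Function.Injective (T x) ↔ LinearIndependent ℝ (fun j => T x (b j)) := by
    rw [← LinearMap.ker_eq_bot]
    exact ⟨fun h => b.linearIndependent.map' (T x) h,
      fun h => LinearMap.ker_eq_bot.2 (LinearMap.injective_of_linearIndependent b.span_eq h)⟩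
  simp only [hb]
  exact isOpen_setOfPred_linearIndependent.preimage
    (continuous_pi fun j => (T.flip (b j)).continuous_of_finiteDimensional)

/-- A line through a parameter of injectivity meets the non-injectivity locus in finitely many
points. -/
theorem LinearMap.finite_setOf_not_injective_add_smul {K V W : Type*} [Field K]
    [AddCommGroup V] [Module K V] [FiniteDimensional K V] [AddCommGroup W] [Module K W]
    {f : V →ₗ[K] W} (hf : Function.Injective f) (g : V →ₗ[K] W) :
    {t : K | ¬ Function.Injective (f + t • g)}.Finite := by
  obtain ⟨L, hL⟩ := f.exists_leftInverse_of_injective (LinearMap.ker_eq_bot.2 hf)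
  refine ((Module.End.finite_spectrum (L ∘ₗ g)).image fun s => -s⁻¹).subset fun t ht => ?_
  have ht : ¬ Function.Injective (f + t • g) := ht
  rw [injective_iff_map_eq_zero] at ht
  push Not at ht
  obtain ⟨v, hv, hv0⟩ := ht
  have hLf : L (f v) = v := LinearMap.congr_fun hL v
  have hLv : v + t • L (g v) = 0 := by
    simpa [hLf] using congrArg L hv
  have ht0 : t ≠ 0 := by
    rintro rfl
    simp [hv0] at hLv
  refine ⟨-t⁻¹, Module.End.HasEigenvalue.mem_spectrum
    (Module.End.hasEigenvalue_of_hasEigenvector (x := v)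
      (Module.End.hasEigenvector_iff.2 ⟨Module.End.mem_eigenspace_iff.2 ?_, hv0⟩)), by simp⟩
  rw [LinearMap.comp_apply, eq_comm, neg_smul, neg_eq_iff_add_eq_zero,
    ← smul_right_injective V ht0 |>.eq_iff]
  simpa [smul_smul, ht0] using hLv

/-- A closed set meeting every line through `x₀` in a null set is null. -/
theorem IsClosed.addHaar_eq_zero_of_forall_line {E : Type*} [NormedAddCommGroup E]
    [NormedSpace ℝ E] [FiniteDimensional ℝ E] [MeasurableSpace E] [BorelSpace E]
    (μ : Measure E) [μ.IsAddHaarMeasure] {C : Set E} (hC : IsClosed C) (x₀ : E)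
    (h : ∀ y : E, volume {t : ℝ | x₀ + t • y ∈ C} = 0) : μ C = 0 := by
  have hmeas : MeasurableSet {p : E × ℝ | x₀ + p.2 • p.1 ∉ C} :=
    (hC.isOpen_compl.preimage (f := fun p : E × ℝ => x₀ + p.2 • p.1)
      (by fun_prop)).measurableSet
  have hae : ∀ᵐ t : ℝ, ∀ᵐ y ∂μ, x₀ + t • y ∉ C := by
    rw [← Measure.ae_ae_comm hmeas]
    exact Filter.Eventually.of_forall fun y => by simpa [ae_iff] using h y
  obtain ⟨t, ht, ht0⟩ := (hae.and (Measure.ae_ne volume (0 : ℝ))).exists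
  have hnull : μ ((t • ·) ⁻¹' ((x₀ + ·) ⁻¹' C)) = 0 := measure_eq_zero_iff_ae_notMem.2 ht
  rw [Measure.addHaar_preimage_smul μ ht0, measure_preimage_add] at hnull
  exact (mul_eq_zero.1 hnull).resolve_left (by simp [ht0])

/-- For a linear subspace `𝔥` of `n × n` real matrices, the set
`U = {x ∈ ℝⁿ : A ↦ Ax is injective on 𝔥}` is open, and if `U` is nonempty then its
complement is Lebesgue-null. -/
theorem injectivity_locus_open_and_conull
    (n : ℕ) (𝔥 : Submodule ℝ (Matrix (Fin n) (Fin n) ℝ)) :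
    IsOpen {x : Fin n → ℝ |
        Function.Injective fun A : ↥𝔥 => (A : Matrix (Fin n) (Fin n) ℝ).mulVec x} ∧
    (({x : Fin n → ℝ |
        Function.Injective fun A : ↥𝔥 => (A : Matrix (Fin n) (Fin n) ℝ).mulVec x}).Nonempty →
      volume ({x : Fin n → ℝ |
        Function.Injective fun A : ↥𝔥 => (A : Matrix (Fin n) (Fin n) ℝ).mulVec x}ᶜ) = 0) := by
  let T : (Fin n → ℝ) →ₗ[ℝ] 𝔥 →ₗ[ℝ] (Fin n → ℝ) :=
    ((Matrix.mulVecBilin ℝ ℝ).comp 𝔥.subtype).flip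
  have hopen : IsOpen {x | Function.Injective (T x)} := T.isOpen_setOf_injective_apply
  refine ⟨hopen, fun ⟨x₀, hx₀⟩ => ?_⟩
  refine hopen.isClosed_compl.addHaar_eq_zero_of_forall_line volume x₀ fun y => ?_
  have hx₀ : Function.Injective (T x₀) := hx₀
  have hfin := LinearMap.finite_setOf_not_injective_add_smul hx₀ (T y)
  simp_rw [← map_smul, ← map_add] at hfin
  exact hfin.measure_zero volume
end

section
/- Let T(n,ℝ) denote the group of upper triangular n×n real matrices with all diagonal entries equal to 1, and let H be a closed connected subgroup of T(n,ℝ). Then: (1) there exists a Borel measurable subset S ⊆ ℝⁿ meeting each H-orbit in ℝⁿ in exactly one point; (2) for every x ∈ ℝⁿ, if the stabilizer {h ∈ H : hx = x} is discrete, then it is trivial. -/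
open MeasureTheory

open Filter Topology NormedSpace

section ExpAlgebra

variable {𝔸 : Type*} [NormedRing 𝔸] [NormedAlgebra ℝ 𝔸]

/-- The logarithm series truncated at order `n`. -/
noncomputable def truncLog (n : ℕ) (g : 𝔸) : 𝔸 :=
  -∑ k ∈ Finset.range n, ((k : ℝ) + 1)⁻¹ • (1 - g) ^ (k + 1)

theorem analyticAt_truncLog (n : ℕ) (g : 𝔸) : AnalyticAt ℝ (truncLog n : 𝔸 → 𝔸) g := by
  unfold truncLog
  refine AnalyticAt.neg (Finset.analyticAt_fun_sum _ fun k _ => ?_)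
  have h1 : AnalyticAt ℝ (fun g : 𝔸 => 1 - g) g := analyticAt_const.sub analyticAt_id
  have h2 : AnalyticAt ℝ (fun _ : 𝔸 => ((k : ℝ) + 1)⁻¹) g := analyticAt_const
  exact h2.fun_smul (h1.fun_pow (k + 1))

variable [CompleteSpace 𝔸]

theorem exp_add_smul (s t : ℝ) (X : 𝔸) : exp ((s + t) • X) = exp (s • X) * exp (t • X) := by
  let := NormedAlgebra.restrictScalars ℚ ℝ 𝔸
  rw [add_smul, exp_add_of_commute]
  exact ((Commute.refl X).smul_left s).smul_right t

theorem exp_mul_exp_neg (X : 𝔸) : exp X * exp (-X) = 1 := by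
  have h := exp_add_smul 1 (-1) X
  simpa [exp_zero] using h.symm

theorem exp_neg_mul_exp (X : 𝔸) : exp (-X) * exp X = 1 := by
  simpa using exp_mul_exp_neg (-X)

/-- The exponential, as a map to the group of units. -/
noncomputable def expUnit (X : 𝔸) : 𝔸ˣ := ⟨exp X, exp (-X), exp_mul_exp_neg X, exp_neg_mul_exp X⟩

@[simp]
theorem val_expUnit (X : 𝔸) : (expUnit X : 𝔸) = exp X := rfl

theorem expUnit_zero : expUnit (0 : 𝔸) = 1 := Units.ext (by simp [exp_zero])

theorem expUnit_add_smul (s t : ℝ) (X : 𝔸) :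
    expUnit ((s + t) • X) = expUnit (s • X) * expUnit (t • X) :=
  Units.ext (exp_add_smul s t X)

theorem expUnit_neg (X : 𝔸) : expUnit (-X) = (expUnit X)⁻¹ := Units.ext rfl

theorem expUnit_intCast_smul (m : ℤ) (X : 𝔸) : expUnit ((m : ℝ) • X) = expUnit X ^ m := by
  induction m with
  | zero => simp [expUnit_zero]
  | succ i ih => rw [Int.cast_add, expUnit_add_smul, ih, zpow_add]; simp
  | pred i ih => rw [Int.cast_sub, sub_eq_add_neg, expUnit_add_smul, ih, zpow_sub]
                 simp [expUnit_neg]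

theorem continuous_exp : Continuous (exp : 𝔸 → 𝔸) := by
  let := NormedAlgebra.restrictScalars ℚ ℝ 𝔸
  exact exp_continuous

theorem continuous_expUnit : Continuous (expUnit : 𝔸 → 𝔸ˣ) :=
  Units.isOpenEmbedding_val.continuous_iff.2 continuous_exp

/-- If elements `exp (Z k)` of a closed subgroup have `Z k → 0` and `c k • Z k → X`, then
`exp X` lies in the subgroup. -/
theorem expUnit_mem_of_tendsto {H : Subgroup 𝔸ˣ} (hH : IsClosed (H : Set 𝔸ˣ))
    {Z : ℕ → 𝔸} {c : ℕ → ℝ} {X : 𝔸} (hmem : ∀ k, expUnit (Z k) ∈ H)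
    (hZ : Tendsto Z atTop (𝓝 0)) (hc : Tendsto (fun k => c k • Z k) atTop (𝓝 X)) :
    expUnit X ∈ H := by
  have h1 : Tendsto (fun k => (round (c k) : ℝ) • Z k) atTop (𝓝 X) := by
    have h2 : Tendsto (fun k => (c k - round (c k)) • Z k) atTop (𝓝 0) := by
      refine squeeze_zero_norm (a := fun k => ‖Z k‖) (fun k => ?_) (by simpa using hZ.norm)
      rw [norm_smul]
      have := abs_sub_round (c k)
      exact mul_le_of_le_one_left (norm_nonneg _) (by rw [Real.norm_eq_abs]; linarith)
    simpa [sub_smul] using hc.sub h2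
  refine hH.mem_of_tendsto ((continuous_expUnit.tendsto X).comp h1) (Eventually.of_forall fun k => ?_)
  simp only [Function.comp, expUnit_intCast_smul]
  exact H.zpow_mem (hmem k) _

/-- The velocity at `1` of a curve in a closed subgroup exponentiates into the subgroup. -/
theorem expUnit_mem_of_hasDerivAt {H : Subgroup 𝔸ˣ} (hH : IsClosed (H : Set 𝔸ˣ))
    {g : ℝ → 𝔸ˣ} {X : 𝔸} (hg : ∀ t, g t ∈ H) (h0 : g 0 = 1)
    (hX : HasDerivAt (fun t => (g t : 𝔸)) X 0) : expUnit X ∈ H := by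
  have he : HasStrictFDerivAt (exp : 𝔸 → 𝔸)
      ((ContinuousLinearEquiv.refl ℝ 𝔸 : 𝔸 ≃L[ℝ] 𝔸) : 𝔸 →L[ℝ] 𝔸) 0 := hasStrictFDerivAt_exp_zero
  set L := he.localInverse
  have hL' := he.to_localInverse
  have hr := he.eventually_right_inverse
  rw [exp_zero] at hL' hr
  have hL1 : L 1 = 0 := by simpa [exp_zero] using he.localInverse_apply_image
  have hg0 : (g 0 : 𝔸) = 1 := by simp [h0]
  have hd : HasDerivAt (fun t => L (g t)) X 0 := by
    have := HasFDerivAt.comp_hasDerivAt (f := fun t => (g t : 𝔸)) (l := L) (0:ℝ)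
      (by rw [hg0]; exact hL'.hasFDerivAt) hX
    simpa [Function.comp_def] using this
  have hu : Tendsto (fun k : ℕ => (1 / ((k : ℝ) + 1))) atTop (𝓝 0) :=
    tendsto_one_div_add_atTop_nhds_zero_nat
  have hev : ∀ᶠ t in 𝓝 (0:ℝ), exp (L (g t)) = g t := by
    have := hX.continuousAt.tendsto
    rw [hg0] at this
    exact this.eventually hr
  obtain ⟨N, hN⟩ := (hu.eventually hev).exists_forall_of_atTop
  have hu' := (tendsto_add_atTop_iff_nat N).2 hu
  refine expUnit_mem_of_tendsto hH (Z := fun k => L (g (1 / (((k + N : ℕ) : ℝ) + 1))))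
    (c := fun k => (((k + N : ℕ) : ℝ) + 1)) (fun k => ?_) ?_ ?_
  · convert hg (1 / (((k + N : ℕ) : ℝ) + 1)) using 1
    exact Units.ext (hN _ (Nat.le_add_left _ _))
  · have := hd.continuousAt.tendsto.comp hu'
    simpa [h0, hL1, Function.comp_def] using this
  · have h3 := hd.tendsto_slope_zero
    have h4 : Tendsto (fun k : ℕ => 1 / (((k + N : ℕ) : ℝ) + 1)) atTop (𝓝[≠] 0) :=
      tendsto_nhdsWithin_iff.2 ⟨hu', Eventually.of_forall fun k => by
        simp only [Set.mem_compl_iff, Set.mem_singleton_iff]; positivity⟩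
    have := h3.comp h4
    simpa [h0, hL1, Function.comp_def] using this

/-- The Lie algebra of a closed subgroup of the unit group of a Banach algebra. -/
def lieSubmodule (H : Subgroup 𝔸ˣ) (hH : IsClosed (H : Set 𝔸ˣ)) : Submodule ℝ 𝔸 where
  carrier := {X | ∀ t : ℝ, expUnit (t • X) ∈ H}
  zero_mem' t := by simp [expUnit_zero, H.one_mem]
  smul_mem' c X hX t := by rw [smul_smul]; exact hX _
  add_mem' {X Y} hX hY t := by
    refine expUnit_mem_of_hasDerivAt hH (g := fun s => expUnit (s • t • X) * expUnit (s • t • Y))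
      (fun s => H.mul_mem ?_ ?_) (by simp [expUnit_zero]) ?_
    · rw [smul_smul]; exact hX _
    · rw [smul_smul]; exact hY _
    · have h1 := hasDerivAt_exp_smul_const (𝕂 := ℝ) (t • X) (0 : ℝ)
      have h2 := hasDerivAt_exp_smul_const (𝕂 := ℝ) (t • Y) (0 : ℝ)
      simpa [exp_zero, Pi.mul_def] using h1.mul h2

theorem expUnit_mem {H : Subgroup 𝔸ˣ} {hH : IsClosed (H : Set 𝔸ˣ)} {X : 𝔸}
    (hX : X ∈ lieSubmodule H hH) : expUnit X ∈ H := by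
  simpa using hX 1

theorem eventually_eq_zero_of_disjoint [FiniteDimensional ℝ 𝔸] {H : Subgroup 𝔸ˣ}
    (hH : IsClosed (H : Set 𝔸ˣ)) {W : Submodule ℝ 𝔸} (hW : Disjoint (lieSubmodule H hH) W) :
    ∀ᶠ Y : W in 𝓝 0, expUnit (Y : 𝔸) ∈ H → Y = 0 := by
  by_contra hcon
  rw [not_eventually] at hcon
  obtain ⟨Y, hY0, hY⟩ := exists_seq_forall_of_frequently hcon
  push Not at hY
  have hn : ∀ k, ‖Y k‖ ≠ 0 := fun k => norm_ne_zero_iff.2 (hY k).2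
  obtain ⟨u, hu, φ, hφ, hlim⟩ := (isCompact_sphere (0 : W) 1).tendsto_subseq
    (x := fun k => ‖Y k‖⁻¹ • Y k) (fun k => by
      rw [mem_sphere_zero_iff_norm, norm_smul, norm_inv, norm_norm, inv_mul_cancel₀ (hn k)])
  have hu_mem : (u : 𝔸) ∈ lieSubmodule H hH := fun t => by
    refine expUnit_mem_of_tendsto hH (Z := fun k => (Y (φ k) : 𝔸)) (c := fun k => t * ‖Y (φ k)‖⁻¹)
      (fun k => (hY _).1) ?_ ?_
    · simpa [Function.comp_def] using
        (continuous_subtype_val.tendsto (0 : W)).comp (hY0.comp hφ.tendsto_atTop)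
    · have := ((continuous_subtype_val.tendsto u).comp hlim).const_smul t
      simpa [Function.comp_def, smul_smul] using this
  have : (u : 𝔸) = 0 := Submodule.disjoint_def.1 hW _ hu_mem u.2
  have hu0 : u = 0 := Subtype.ext this
  simp [hu0] at hu

/-- **Cartan**: near `1`, a closed subgroup consists of exponentials of its Lie algebra. -/
theorem eventually_mem_exp_lieSubmodule [FiniteDimensional ℝ 𝔸] {H : Subgroup 𝔸ˣ}
    (hH : IsClosed (H : Set 𝔸ˣ)) :
    ∀ᶠ g in 𝓝 (1 : 𝔸ˣ), g ∈ H → ∃ X ∈ lieSubmodule H hH, expUnit X = g := by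
  obtain ⟨W, hW⟩ := (lieSubmodule H hH).exists_isCompl
  let V := lieSubmodule H hH
  have hfst : HasStrictFDerivAt (fun p : V × W => exp (p.1 : 𝔸))
      (V.subtypeL ∘L ContinuousLinearMap.fst ℝ V W) 0 := by
    have h0 : HasStrictFDerivAt (exp : 𝔸 → 𝔸) (1 : 𝔸 →L[ℝ] 𝔸)
      ((V.subtypeL ∘L ContinuousLinearMap.fst ℝ V W) 0) := by
        simpa using hasStrictFDerivAt_exp_zero
    exact h0.comp 0 (V.subtypeL ∘L ContinuousLinearMap.fst ℝ V W).hasStrictFDerivAt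
  have hsnd : HasStrictFDerivAt (fun p : V × W => exp (p.2 : 𝔸))
      (W.subtypeL ∘L ContinuousLinearMap.snd ℝ V W) 0 := by
    have h0 : HasStrictFDerivAt (exp : 𝔸 → 𝔸) (1 : 𝔸 →L[ℝ] 𝔸)
      ((W.subtypeL ∘L ContinuousLinearMap.snd ℝ V W) 0) := by
        simpa using hasStrictFDerivAt_exp_zero
    exact h0.comp 0 (W.subtypeL ∘L ContinuousLinearMap.snd ℝ V W).hasStrictFDerivAt
  have hmul := (hfst.mul' hsnd).map_nhds_eq_of_surj (by
    refine LinearMap.range_eq_top.2 fun Z => ?_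
    obtain ⟨X, hX, Y, hY, rfl⟩ := Submodule.mem_sup.1 (hW.sup_eq_top ▸ Submodule.mem_top (x := Z))
    exact ⟨(⟨X, hX⟩, ⟨Y, hY⟩), by simp [exp_zero, add_comm]⟩)
  have key : ∀ᶠ g in 𝓝 (1 : 𝔸), ∀ u ∈ H, (u : 𝔸) = g → ∃ X ∈ lieSubmodule H hH, expUnit X = u := by
    have h1 : (1 : 𝔸) = exp (((0 : V × W).1 : V) : 𝔸) * exp (((0 : V × W).2 : W) : 𝔸) := by
      simp [exp_zero]
    rw [h1]
    change ∀ᶠ g in 𝓝 (((fun p : V × W => exp (p.1 : 𝔸)) * fun p : V × W => exp (p.2 : 𝔸)) 0), _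
    rw [← hmul, eventually_map]
    have h2 := (continuous_snd.tendsto (0 : V × W)).eventually
      (eventually_eq_zero_of_disjoint hH hW.disjoint)
    filter_upwards [h2] with p hp u hu hup
    have hup' : u = expUnit (p.1 : 𝔸) * expUnit (p.2 : 𝔸) := Units.ext hup
    have hp1 : expUnit (p.1 : 𝔸) ∈ H := expUnit_mem p.1.2
    have hp2 : p.2 = 0 := hp (by rwa [hup', H.mul_mem_cancel_left hp1] at hu)
    exact ⟨p.1, p.1.2, by rw [hup', hp2]; simp [expUnit_zero]⟩
  have hc := (Units.continuous_val.tendsto (1 : 𝔸ˣ)).eventually (by simpa using key)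
  filter_upwards [hc] with g hg hgH using hg g hgH rfl

theorem hasDerivAt_one_sub_exp_pow (Z : 𝔸) (k : ℕ) (t : ℝ) :
    HasDerivAt (fun t : ℝ => (1 - exp (t • Z)) ^ (k + 1))
      (-(((k : ℝ) + 1) • ((1 - exp (t • Z)) ^ k * (exp (t • Z) * Z)))) t := by
  have h1 := (hasDerivAt_exp_smul_const (𝕂 := ℝ) Z t).const_sub 1
  have hcomm : Commute (1 - exp (t • Z)) (exp (t • Z) * Z) := by
    have hc : Commute (exp (t • Z)) Z := by
      let := NormedAlgebra.restrictScalars ℚ ℝ 𝔸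
      exact ((Commute.refl Z).smul_left t).exp_left
    exact (Commute.one_left _).sub_left ((Commute.refl _).mul_right hc)
  induction k with
  | zero => simpa using h1
  | succ k ih =>
    convert ih.mul h1 using 1
    · exact funext fun s => pow_succ _ _
    rw [neg_mul, smul_mul_assoc, mul_assoc, ← hcomm.eq, ← mul_assoc ((1 - exp (t • Z)) ^ k),
      ← pow_succ]
    push_cast
    rw [mul_neg]
    module

theorem truncLog_exp {n : ℕ} {Z : 𝔸} (hZ : ∀ t : ℝ, (1 - exp (t • Z)) ^ n = 0) :
    truncLog n (exp Z) = Z := by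
  have hd : ∀ t : ℝ, HasDerivAt (fun t : ℝ => truncLog n (exp (t • Z))) Z t := by
    intro t
    have := (HasDerivAt.fun_sum (u := Finset.range n) fun k _ =>
      (hasDerivAt_one_sub_exp_pow Z k t).const_smul (((k : ℝ) + 1)⁻¹)).neg
    have hk : ∀ k : ℕ, ((k : ℝ) + 1)⁻¹ • (-(((k : ℝ) + 1) •
        ((1 - exp (t • Z)) ^ k * (exp (t • Z) * Z)))) =
          -((1 - exp (t • Z)) ^ k * (exp (t • Z) * Z)) := fun k => by
      rw [smul_neg, smul_smul, inv_mul_cancel₀ (by positivity), one_smul]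
    have hg := geom_sum_mul_neg (1 - exp (t • Z)) n
    rw [sub_sub_cancel, hZ t, sub_zero] at hg
    rw [Finset.sum_congr rfl fun k _ => hk k, Finset.sum_neg_distrib, neg_neg, ← Finset.sum_mul,
      ← mul_assoc, hg, one_mul] at this
    exact this
  have hconst : ∀ t : ℝ, HasDerivAt (fun t : ℝ => truncLog n (exp (t • Z)) - t • Z) 0 t := by
    intro t
    simpa [Pi.sub_def] using (hd t).sub ((hasDerivAt_id t).smul_const Z)
  have := is_const_of_deriv_eq_zero (fun t => (hconst t).differentiableAt)
    (fun t => (hconst t).deriv) 1 0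
  simpa [exp_zero, truncLog, sub_eq_zero] using this

theorem analyticAt_exp (X : 𝔸) : AnalyticAt ℝ (exp : 𝔸 → 𝔸) X := exp_analytic X

variable [FiniteDimensional ℝ 𝔸] {H : Subgroup 𝔸ˣ} {hH : IsClosed (H : Set 𝔸ˣ)} {n : ℕ}

theorem exists_lieSubmodule_expUnit_mul (hn : ∀ g ∈ H, (1 - (g : 𝔸)) ^ n = 0) {X Y : 𝔸}
    (hX : X ∈ lieSubmodule H hH) (hY : Y ∈ lieSubmodule H hH) :
    ∃ Z ∈ lieSubmodule H hH, expUnit Z = expUnit X * expUnit Y := by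
  let p : ℝ → 𝔸ˣ := fun t => expUnit (t • X) * expUnit (t • Y)
  have hpc : Tendsto p (𝓝 0) (𝓝 1) := by
    have : Continuous p := (continuous_expUnit.comp (continuous_id.smul continuous_const)).mul
      (continuous_expUnit.comp (continuous_id.smul continuous_const))
    simpa [p, expUnit_zero] using this.tendsto 0
  have hloc : ∀ᶠ t in 𝓝 (0 : ℝ), truncLog n (p t : 𝔸) ∈ lieSubmodule H hH ∧
      exp (truncLog n (p t : 𝔸)) = p t := by
    filter_upwards [hpc.eventually (eventually_mem_exp_lieSubmodule hH)] with t ht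
    obtain ⟨Z, hZ, hZt⟩ := ht (H.mul_mem (hX t) (hY t))
    have hlog : truncLog n (p t : 𝔸) = Z := by
      rw [← hZt, val_expUnit]
      exact truncLog_exp fun s => hn _ (hZ s)
    exact ⟨hlog ▸ hZ, by rw [hlog, ← hZt, val_expUnit]⟩
  have hpa : ∀ t, AnalyticAt ℝ (fun t => (p t : 𝔸)) t := fun t =>
    ((analyticAt_exp _).comp (analyticAt_id.smul analyticAt_const)).mul
      ((analyticAt_exp _).comp (analyticAt_id.smul analyticAt_const))
  have hla : ∀ t, AnalyticAt ℝ (fun t => truncLog n (p t : 𝔸)) t := fun t =>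
    (analyticAt_truncLog n _).comp (hpa t)
  have hexp := AnalyticOnNhd.eq_of_eventuallyEq (f := fun t => exp (truncLog n (p t : 𝔸)))
    (fun t _ => (analyticAt_exp _).comp (hla t)) (fun t _ => hpa t) (hloc.mono fun t ht => ht.2)
  obtain ⟨W, hW⟩ := (lieSubmodule H hH).exists_isCompl
  let π := LinearMap.toContinuousLinearMap (W.projectionOnto _ hW.symm)
  have hπ : ∀ Z, π Z = 0 ↔ Z ∈ lieSubmodule H hH := fun Z =>
    Submodule.projectionOnto_apply_eq_zero_iff hW.symm
  have hmem := AnalyticOnNhd.eq_of_eventuallyEq (f := fun t => π (truncLog n (p t : 𝔸)))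
    (g := fun _ => 0) (fun t _ => (π.analyticAt _).comp (hla t)) (fun t _ => analyticAt_const)
    (hloc.mono fun t ht => (hπ _).2 ht.1)
  refine ⟨truncLog n (p 1 : 𝔸), (hπ _).1 (congrFun hmem 1), Units.ext ?_⟩
  simpa [p] using congrFun hexp 1

/-- A closed connected subgroup of unipotent elements is the image of its Lie algebra under the
exponential map. -/
theorem exists_lieSubmodule_expUnit_eq (hconn : IsPreconnected (H : Set 𝔸ˣ))
    (hn : ∀ g ∈ H, (1 - (g : 𝔸)) ^ n = 0) {g : 𝔸ˣ} (hg : g ∈ H) :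
    ∃ Z ∈ lieSubmodule H hH, expUnit Z = g := by
  let K : Subgroup H :=
    { carrier := {g | ∃ Z ∈ lieSubmodule H hH, expUnit Z = g}
      one_mem' := ⟨0, zero_mem _, expUnit_zero⟩
      mul_mem' := by
        rintro a b ⟨X, hX, hXa⟩ ⟨Y, hY, hYb⟩
        simpa [hXa, hYb] using exists_lieSubmodule_expUnit_mul hn hX hY
      inv_mem' := by
        rintro a ⟨X, hX, hXa⟩
        exact ⟨-X, neg_mem hX, by rw [expUnit_neg, hXa]; rfl⟩ }
  have hK1 : (K : Set H) ∈ 𝓝 (1 : H) := by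
    have := (continuous_subtype_val.tendsto (1 : H)).eventually
      (eventually_mem_exp_lieSubmodule hH)
    filter_upwards [this] with g hg using hg g.2
  have hopen : IsOpen (K : Set H) := K.isOpen_of_mem_nhds hK1
  have : PreconnectedSpace H := isPreconnected_iff_preconnectedSpace.1 hconn
  have huniv := IsClopen.eq_univ ⟨K.isClosed_of_isOpen hopen, hopen⟩ ⟨1, K.one_mem⟩
  exact huniv.symm.subset (Set.mem_univ (⟨g, hg⟩ : H))

end ExpAlgebra

section Unipotent

open scoped Matrix.Norms.Operator

variable {n : ℕ}

/-- Upper triangular matrices with unit diagonal. -/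
def IsUnitriangular (g : Matrix (Fin n) (Fin n) ℝ) : Prop :=
  g.BlockTriangular (id : Fin n → Fin n) ∧ ∀ i, g i i = 1

theorem IsUnitriangular.mulVec_apply_eq {g : Matrix (Fin n) (Fin n) ℝ} (hg : IsUnitriangular g)
    {i : Fin n} {v w : Fin n → ℝ} (h : ∀ j, i < j → v j = w j) :
    g.mulVec v i - v i = g.mulVec w i - w i := by
  have key : ∀ v : Fin n → ℝ, g.mulVec v i - v i = ∑ j, if i < j then g i j * v j else 0 := by
    intro v
    have : v i = ∑ j, if j = i then v j else 0 := by simp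
    rw [Matrix.mulVec, dotProduct, this, ← Finset.sum_sub_distrib]
    refine Finset.sum_congr rfl fun j _ => ?_
    rcases lt_trichotomy i j with hij | rfl | hij
    · simp [hij, hij.ne']
    · simp [hg.2]
    · simp [hij.ne, hij.not_gt, hg.1 hij]
  rw [key, key]
  refine Finset.sum_congr rfl fun j _ => ?_
  split_ifs with hj
  · rw [h j hj]
  · rfl

theorem IsUnitriangular.mulVec_apply_of_eq_zero {g : Matrix (Fin n) (Fin n) ℝ}
    (hg : IsUnitriangular g) {i : Fin n} {w : Fin n → ℝ} (h : ∀ j, i < j → w j = 0) :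
    g.mulVec w i = w i := by
  simpa [sub_eq_zero] using hg.mulVec_apply_eq (w := 0) h

theorem IsUnitriangular.one_sub_pow_mulVec {g : Matrix (Fin n) (Fin n) ℝ}
    (hg : IsUnitriangular g) (k : ℕ) {m : ℕ} {w : Fin n → ℝ} (h : ∀ i : Fin n, m ≤ i → w i = 0) :
    ∀ i : Fin n, m ≤ i + k → ((1 - g) ^ k).mulVec w i = 0 := by
  induction k with
  | zero => simpa using h
  | succ k ih =>
    intro i hi
    rw [pow_succ', ← Matrix.mulVec_mulVec, Matrix.sub_mulVec, Matrix.one_mulVec, Pi.sub_apply,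
      hg.mulVec_apply_of_eq_zero, sub_self]
    intro j hij
    exact ih j (by have : (i : ℕ) < j := hij; omega)

theorem IsUnitriangular.one_sub_pow_eq_zero {g : Matrix (Fin n) (Fin n) ℝ}
    (hg : IsUnitriangular g) : (1 - g) ^ n = 0 := by
  refine Matrix.ext_iff_mulVec.2 fun w => funext fun i => ?_
  simpa using hg.one_sub_pow_mulVec n (m := n) (w := w) (fun i hi => absurd i.2 (by omega)) i (by omega)

theorem truncLog_mulVec_apply_eq_zero {g : Matrix (Fin n) (Fin n) ℝ} (hg : IsUnitriangular g)
    {y : Fin n → ℝ} {i : Fin n} (h : ∀ j, i < j → g.mulVec y j = y j) (N : ℕ) :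
    ∀ j, i < j → (truncLog N g).mulVec y j = 0 := by
  intro j hj
  rw [truncLog, Matrix.neg_mulVec, Matrix.sum_mulVec, Pi.neg_apply, Finset.sum_apply,
    Finset.sum_eq_zero, neg_zero]
  intro k _
  rw [Matrix.smul_mulVec, pow_succ, ← Matrix.mulVec_mulVec, Pi.smul_apply,
    hg.one_sub_pow_mulVec k (m := i + 1), smul_zero]
  · intro l hl
    rw [Matrix.sub_mulVec, Matrix.one_mulVec, Pi.sub_apply, h l (by exact hl), sub_self]
  · have : (i : ℕ) < j := hj
    omega

/-- If `exp Z` fixes all the coordinates of `y` after `i`, then the one-parameter group of `Z`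
acts affinely on the coordinates of `y` from `i` on. -/
theorem exp_smul_mulVec_apply {Z : Matrix (Fin n) (Fin n) ℝ}
    (hZ : ∀ t : ℝ, IsUnitriangular (exp (t • Z))) {y : Fin n → ℝ} {i : Fin n}
    (h : ∀ j, i < j → (exp Z).mulVec y j = y j) (t : ℝ) {j : Fin n} (hj : i ≤ j) :
    (exp (t • Z)).mulVec y j = y j + t * ((exp Z).mulVec y j - y j) := by
  have hZ1 : IsUnitriangular (exp Z) := by simpa using hZ 1
  have hlog : truncLog n (exp Z) = Z := truncLog_exp fun t => (hZ t).one_sub_pow_eq_zero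
  have hZy : ∀ j, i < j → Z.mulVec y j = 0 := by
    have := truncLog_mulVec_apply_eq_zero hZ1 h n
    rwa [hlog] at this
  let ℓ : Matrix (Fin n) (Fin n) ℝ →ₗ[ℝ] ℝ :=
    { toFun := fun A => A.mulVec y j
      map_add' := fun A B => by simp [Matrix.add_mulVec]
      map_smul' := fun c A => by simp [Matrix.smul_mulVec] }
  have hd : ∀ t : ℝ, HasDerivAt (fun t : ℝ => (exp (t • Z)).mulVec y j) (Z.mulVec y j) t := by
    intro t
    have h1 := ℓ.toContinuousLinearMap.hasFDerivAt.comp_hasDerivAt t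
      (hasDerivAt_exp_smul_const (𝕂 := ℝ) Z t)
    have h2 : (exp (t • Z) * Z).mulVec y j = Z.mulVec y j := by
      rw [← Matrix.mulVec_mulVec]
      exact (hZ t).mulVec_apply_of_eq_zero fun l hl => hZy l (hj.trans_lt hl)
    rw [← h2]
    exact h1
  have hconst : ∀ s : ℝ, (exp (s • Z)).mulVec y j - s * Z.mulVec y j = y j := fun s => by
    have hd' : ∀ t : ℝ, HasDerivAt
        (fun t : ℝ => (exp (t • Z)).mulVec y j - t * Z.mulVec y j) 0 t := fun t => by
      simpa [Pi.sub_def] using (hd t).sub ((hasDerivAt_id t).mul_const (Z.mulVec y j))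
    have := is_const_of_deriv_eq_zero (fun t => (hd' t).differentiableAt)
      (fun t => (hd' t).deriv) s 0
    simpa [exp_zero] using this
  have h1 := hconst 1
  rw [one_smul] at h1
  linear_combination hconst t - t * h1

/-- A vector is movable at `i` if some element of `exp V` moves its `i`-th coordinate while fixing
all later ones. -/
def movable (V : Submodule ℝ (Matrix (Fin n) (Fin n) ℝ)) (i : Fin n) : Set (Fin n → ℝ) :=
  {x | ∃ X ∈ V, (∀ j, i < j → (exp X).mulVec x j = x j) ∧ (exp X).mulVec x i ≠ x i}

theorem IsSigmaCompact.measurableSet {E : Type*} [TopologicalSpace E] [T2Space E]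
    [MeasurableSpace E] [BorelSpace E] {s : Set E} (hs : IsSigmaCompact s) : MeasurableSet s := by
  obtain ⟨K, hK, rfl⟩ := hs
  exact MeasurableSet.iUnion fun k => (hK k).measurableSet

theorem measurableSet_movable (V : Submodule ℝ (Matrix (Fin n) (Fin n) ℝ)) (i : Fin n) :
    MeasurableSet (movable V i) := by
  have hc : ∀ j, Continuous fun p : Matrix (Fin n) (Fin n) ℝ × (Fin n → ℝ) =>
      (exp p.1).mulVec p.2 j := fun j =>
    (continuous_apply j).comp ((continuous_exp.comp continuous_fst).matrix_mulVec continuous_snd)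
  have hc' : ∀ j, Continuous fun p : Matrix (Fin n) (Fin n) ℝ × (Fin n → ℝ) => p.2 j := fun j =>
    (continuous_apply j).comp continuous_snd
  have : movable V i = ⋃ k : ℕ, Prod.snd '' {p : Matrix (Fin n) (Fin n) ℝ × (Fin n → ℝ) | p.1 ∈ V ∧
      (∀ j, i < j → (exp p.1).mulVec p.2 j = p.2 j) ∧
      1 / ((k : ℝ) + 1) ≤ |(exp p.1).mulVec p.2 i - p.2 i|} := by
    ext x
    simp only [movable, Set.mem_ofPred_eq, Set.mem_iUnion, Set.mem_image, Prod.exists,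
      exists_eq_right]
    constructor
    · rintro ⟨X, hX, h1, h2⟩
      obtain ⟨k, hk⟩ := exists_nat_one_div_lt (abs_pos.2 (sub_ne_zero.2 h2))
      exact ⟨k, X, hX, h1, hk.le⟩
    · rintro ⟨k, X, hX, h1, hk⟩
      have hk0 : (0 : ℝ) < 1 / ((k : ℝ) + 1) := by positivity
      exact ⟨X, hX, h1, sub_ne_zero.1 (abs_pos.1 (hk0.trans_le hk))⟩
  rw [this]
  have : SigmaCompactSpace (Matrix (Fin n) (Fin n) ℝ) :=
    inferInstanceAs (SigmaCompactSpace (Fin n → Fin n → ℝ))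
  refine MeasurableSet.iUnion fun k => IsSigmaCompact.measurableSet ?_
  refine IsSigmaCompact.image continuous_snd ?_
  refine isSigmaCompact_univ.of_isClosed_subset ?_ (Set.subset_univ _)
  refine (V.closed_of_finiteDimensional.preimage continuous_fst).inter (IsClosed.inter ?_ ?_)
  · change IsClosed {p : Matrix (Fin n) (Fin n) ℝ × (Fin n → ℝ) |
      ∀ j, i < j → (exp p.1).mulVec p.2 j = p.2 j}
    simp only [Set.ofPred_forall]
    exact isClosed_iInter fun j => isClosed_iInter fun _ => isClosed_eq (hc j) (hc' j)
  · exact isClosed_le continuous_const ((hc i).sub (hc' i)).abs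

theorem movable_congr {V : Submodule ℝ (Matrix (Fin n) (Fin n) ℝ)}
    (hV : ∀ X ∈ V, IsUnitriangular (exp X)) {i : Fin n} {x y : Fin n → ℝ}
    (hxy : ∀ j, i < j → x j = y j) (hx : x ∈ movable V i) : y ∈ movable V i := by
  obtain ⟨X, hX, h1, h2⟩ := hx
  refine ⟨X, hX, fun j hj => ?_, fun h => h2 ?_⟩
  · have := (hV X hX).mulVec_apply_eq (i := j) fun l hl => hxy l (hj.trans hl)
    linarith [h1 j hj]
  · have := (hV X hX).mulVec_apply_eq hxy
    linarith

variable {H : Subgroup (GL (Fin n) ℝ)}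

/-- A Borel set meeting each orbit exactly once modulo the coordinates before `m`. -/
theorem exists_measurableSet_section {V : Submodule ℝ (Matrix (Fin n) (Fin n) ℝ)}
    (hunip : ∀ g ∈ H, IsUnitriangular (g : Matrix (Fin n) (Fin n) ℝ))
    (hV : ∀ X ∈ V, expUnit X ∈ H) (hVH : ∀ g ∈ H, ∃ X ∈ V, expUnit X = g) {m : ℕ} (hm : m ≤ n) :
    ∃ S : Set (Fin n → ℝ), MeasurableSet S ∧
      (∀ x y : Fin n → ℝ, (∀ i : Fin n, m ≤ i → x i = y i) → x ∈ S → y ∈ S) ∧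
      (∀ x, ∃ h ∈ H, (h : Matrix (Fin n) (Fin n) ℝ).mulVec x ∈ S) ∧
      (∀ x ∈ S, ∀ y ∈ S, ∀ h ∈ H,
        (∀ i : Fin n, m ≤ i → (h : Matrix (Fin n) (Fin n) ℝ).mulVec x i = y i) →
        ∀ i : Fin n, m ≤ i → x i = y i) := by
  have hVu : ∀ X ∈ V, IsUnitriangular (exp X) := fun X hX => hunip _ (hV X hX)
  induction hm using Nat.decreasingInduction with
  | self =>
    exact ⟨Set.univ, MeasurableSet.univ, fun _ _ _ _ => trivial, fun x => ⟨1, H.one_mem, trivial⟩,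
      fun x _ y _ h _ _ i hi => absurd i.2 (by omega)⟩
  | of_succ m hm ih =>
    obtain ⟨S, hS, hinv, hex, huniq⟩ := ih
    let i₀ : Fin n := ⟨m, hm⟩
    have hlt : ∀ j : Fin n, i₀ < j ↔ m + 1 ≤ j := fun j => Iff.rfl
    have hsplit : ∀ j : Fin n, m ≤ j → j = i₀ ∨ i₀ < j := fun j hj => by
      rcases hj.eq_or_lt with h | h
      · exact Or.inl (Fin.ext h.symm)
      · exact Or.inr h
    refine ⟨S ∩ {x | x ∈ movable V i₀ → x i₀ = 0}, hS.inter ?_, ?_, ?_, ?_⟩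
    · have : {x : Fin n → ℝ | x ∈ movable V i₀ → x i₀ = 0} =
          (movable V i₀)ᶜ ∪ {x | x i₀ = 0} := by
        ext x; simp [imp_iff_not_or]
      rw [this]
      exact (measurableSet_movable V i₀).compl.union
        (measurableSet_eq_fun (measurable_pi_apply i₀) measurable_const)
    · rintro x y hxy ⟨hxS, hx0⟩
      refine ⟨hinv x y (fun i hi => hxy i (by omega)) hxS, fun hy => ?_⟩
      rw [← hxy i₀ le_rfl]
      exact hx0 (movable_congr hVu (fun j hj => (hxy j (le_of_lt hj)).symm) hy)
    · intro x
      obtain ⟨h, hh, hxS⟩ := hex x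
      set y := (h : Matrix (Fin n) (Fin n) ℝ).mulVec x with hy
      by_cases hmov : y ∈ movable V i₀
      · obtain ⟨X, hX, h1, h2⟩ := id hmov
        have hXt : ∀ t : ℝ, t • X ∈ V := fun t => V.smul_mem t hX
        have hflow := fun (t : ℝ) (j : Fin n) (hj : i₀ ≤ j) =>
          exp_smul_mulVec_apply (fun t => hVu _ (hXt t)) h1 t hj
        let t : ℝ := -y i₀ / ((exp X).mulVec y i₀ - y i₀)
        have hval : ((expUnit (t • X) * h : GL (Fin n) ℝ) : Matrix (Fin n) (Fin n) ℝ).mulVec x =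
            (exp (t • X)).mulVec y := by
          rw [hy, Matrix.mulVec_mulVec]
          rfl
        refine ⟨expUnit (t • X) * h, H.mul_mem (hV _ (hXt t)) hh, ?_⟩
        rw [hval]
        refine ⟨hinv y _ (fun j hj => ?_) hxS, fun _ => ?_⟩
        · rw [hflow t j (le_of_lt ((hlt j).2 hj)), h1 j ((hlt j).2 hj)]
          simp
        · rw [hflow t i₀ le_rfl, div_mul_cancel₀ _ (sub_ne_zero.2 h2)]
          simp
      · exact ⟨h, hh, hxS, fun hmov' => absurd hmov' hmov⟩
    · rintro x ⟨hxS, hx0⟩ y ⟨hyS, hy0⟩ h hh hxy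
      have hgt := huniq x hxS y hyS h hh fun i hi => hxy i (by omega)
      intro i hi
      rcases hsplit i hi with rfl | hi
      · by_contra hne
        obtain ⟨X, hX, rfl⟩ := hVH h hh
        have hxmov : x ∈ movable V i₀ := by
          refine ⟨X, hX, fun j hj => ?_, fun heq => hne ?_⟩
          · exact (hxy j (le_of_lt hj)).trans (hgt j hj).symm
          · exact heq.symm.trans (hxy i₀ le_rfl)
        have hymov := movable_congr hVu hgt hxmov
        exact hne ((hx0 hxmov).trans (hy0 hymov).symm)
      · exact hgt i hi

/-- In a unipotent group, the one-parameter group through a stabilizer element is in the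
stabilizer. -/
theorem exp_smul_mulVec_eq_self {Z : Matrix (Fin n) (Fin n) ℝ}
    (hZ : ∀ t : ℝ, IsUnitriangular (exp (t • Z))) {x : Fin n → ℝ} (h : (exp Z).mulVec x = x)
    (t : ℝ) : (exp (t • Z)).mulVec x = x := by
  funext i
  rw [exp_smul_mulVec_apply hZ (i := i) (fun j _ => congrFun h j) t le_rfl, h]
  simp

/-- A closed connected unipotent group is the exponential image of its Lie algebra. -/
theorem exists_submodule_expUnit
    (hclosed : IsClosed (H : Set (GL (Fin n) ℝ))) (hconn : IsConnected (H : Set (GL (Fin n) ℝ)))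
    (hunip : ∀ g ∈ H, IsUnitriangular (g : Matrix (Fin n) (Fin n) ℝ)) :
    ∃ V : Submodule ℝ (Matrix (Fin n) (Fin n) ℝ),
      (∀ X ∈ V, expUnit X ∈ H) ∧ ∀ g ∈ H, ∃ X ∈ V, expUnit X = g :=
  ⟨lieSubmodule H hclosed, fun _ => expUnit_mem, fun _ hg =>
    exists_lieSubmodule_expUnit_eq hconn.isPreconnected
      (fun g hg => (hunip g hg).one_sub_pow_eq_zero) hg⟩

theorem exists_measurableSet_existsUnique_orbit
    (hclosed : IsClosed (H : Set (GL (Fin n) ℝ))) (hconn : IsConnected (H : Set (GL (Fin n) ℝ)))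
    (hunip : ∀ g ∈ H, IsUnitriangular (g : Matrix (Fin n) (Fin n) ℝ)) :
    ∃ S : Set (Fin n → ℝ), MeasurableSet S ∧
      ∀ x : Fin n → ℝ, ∃! s : Fin n → ℝ, s ∈ S ∧
        ∃ h : ↥H, ((h : GL (Fin n) ℝ) : Matrix (Fin n) (Fin n) ℝ).mulVec x = s := by
  obtain ⟨V, hV, hVH⟩ := exists_submodule_expUnit hclosed hconn hunip
  obtain ⟨S, hS, -, hex, huniq⟩ := exists_measurableSet_section hunip hV hVH (Nat.zero_le n)
  refine ⟨S, hS, fun x => ?_⟩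
  obtain ⟨h, hh, hxS⟩ := hex x
  refine ⟨_, ⟨hxS, ⟨h, hh⟩, rfl⟩, ?_⟩
  rintro _ ⟨hs, k, rfl⟩
  refine funext fun i => huniq _ hs _ hxS (h * (k : GL (Fin n) ℝ)⁻¹)
    (H.mul_mem hh (H.inv_mem k.2)) (fun i _ => ?_) i (Nat.zero_le _)
  rw [Matrix.mulVec_mulVec, ← Units.val_mul, inv_mul_cancel_right]

theorem eq_one_of_discreteTopology_stabilizer
    (hclosed : IsClosed (H : Set (GL (Fin n) ℝ))) (hconn : IsConnected (H : Set (GL (Fin n) ℝ)))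
    (hunip : ∀ g ∈ H, IsUnitriangular (g : Matrix (Fin n) (Fin n) ℝ))
    (x : Fin n → ℝ) (hdisc : DiscreteTopology
      {h : ↥H // ((h : GL (Fin n) ℝ) : Matrix (Fin n) (Fin n) ℝ).mulVec x = x}) (h : ↥H)
    (hx : ((h : GL (Fin n) ℝ) : Matrix (Fin n) (Fin n) ℝ).mulVec x = x) : h = 1 := by
  obtain ⟨V, hV, hVH⟩ := exists_submodule_expUnit hclosed hconn hunip
  obtain ⟨Z, hZ, hZh⟩ := hVH h h.2
  have hZt : ∀ t : ℝ, expUnit (t • Z) ∈ H := fun t => hV _ (V.smul_mem t hZ)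
  have hfix : ∀ t : ℝ, (exp (t • Z)).mulVec x = x := exp_smul_mulVec_eq_self
    (fun t => hunip _ (hZt t))
    (by rw [show exp Z = (h : GL (Fin n) ℝ) from congrArg Units.val hZh, hx])
  let γ : ℝ → {h : ↥H // ((h : GL (Fin n) ℝ) : Matrix (Fin n) (Fin n) ℝ).mulVec x = x} :=
    fun t => ⟨⟨expUnit (t • Z), hZt t⟩, hfix t⟩
  have hγ : Continuous γ := Continuous.subtype_mk (Continuous.subtype_mk
    (continuous_expUnit.comp (continuous_id.smul continuous_const)) _) _
  have h10 : γ 1 = γ 0 := PreconnectedSpace.constant inferInstance hγ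
  refine Subtype.ext (hZh.symm.trans ?_)
  simpa [γ, expUnit_zero] using congrArg (fun g => (g.1 : GL (Fin n) ℝ)) h10

end Unipotent

/-- Chevalley–Rosenlicht: let `H` be a closed connected subgroup of the group `T(n,ℝ)` of
upper triangular matrices with unit diagonal. Then (1) there is a Borel measurable set
`S ⊆ ℝⁿ` meeting every `H`-orbit in exactly one point, and (2) for every `x ∈ ℝⁿ`, if the
stabilizer of `x` in `H` is discrete, then it is trivial. -/
theorem unipotent_orbits_fundamental_set_and_free
    (n : ℕ) (H : Subgroup (GL (Fin n) ℝ))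
    (hclosed : IsClosed (H : Set (GL (Fin n) ℝ)))
    (hconn : IsConnected (H : Set (GL (Fin n) ℝ)))
    (hunip : ∀ g ∈ H, ((g : Matrix (Fin n) (Fin n) ℝ).BlockTriangular (id : Fin n → Fin n))
      ∧ ∀ i, (g : Matrix (Fin n) (Fin n) ℝ) i i = 1) :
    (∃ S : Set (Fin n → ℝ), MeasurableSet S ∧
      ∀ x : Fin n → ℝ, ∃! s : Fin n → ℝ, s ∈ S ∧
        ∃ h : ↥H, ((h : GL (Fin n) ℝ) : Matrix (Fin n) (Fin n) ℝ).mulVec x = s) ∧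
    (∀ x : Fin n → ℝ,
      DiscreteTopology {h : ↥H // ((h : GL (Fin n) ℝ) : Matrix (Fin n) (Fin n) ℝ).mulVec x = x} →
      ∀ h : ↥H, ((h : GL (Fin n) ℝ) : Matrix (Fin n) (Fin n) ℝ).mulVec x = x → h = 1) := by
  exact ⟨exists_measurableSet_existsUnique_orbit hclosed hconn hunip,
    eq_one_of_discreteTopology_stabilizer hclosed hconn hunip⟩
end

section
/- Let H be an abelian subgroup of GL(n,ℝ) and let 𝒜 ⊆ M_n(ℝ) be a commutative subalgebra containing the identity matrix with H ⊆ 𝒜, and let 𝒜ˣ = {g ∈ GL(n,ℝ) : g ∈ 𝒜 and g⁻¹ ∈ 𝒜} be the unit group of 𝒜. Suppose there exists an H-invariant open subset O ⊆ ℝⁿ whose complement is Lebesgue-null such that for every x ∈ O the set stab_{𝒜ˣ}(x)·H = {gh : g ∈ 𝒜ˣ, gx = x, h ∈ H} is closed in GL(n,ℝ). Then there exists a measurable fundamental domain for the H-action on ℝⁿ. -/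
open MeasureTheory

/-- A measurable fundamental domain for the action of a subgroup `H ≤ GL(n,ℝ)` on `ℝⁿ`:
a Borel set `C` contained in an `H`-invariant Borel set `U` with Lebesgue-null complement,
such that `C` meets each `H`-orbit contained in `U` in exactly one point. -/
def HasMeasFundamentalDomain (n : ℕ) (H : Subgroup (GL (Fin n) ℝ)) : Prop :=
  ∃ C U : Set (Fin n → ℝ), MeasurableSet C ∧ MeasurableSet U ∧
    (∀ h ∈ H, ∀ x ∈ U, ((h : GL (Fin n) ℝ) : Matrix (Fin n) (Fin n) ℝ).mulVec x ∈ U) ∧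
    volume Uᶜ = 0 ∧ C ⊆ U ∧
    ∀ x ∈ U, ∃! s : Fin n → ℝ, s ∈ C ∧
      ∃ h ∈ H, ((h : GL (Fin n) ℝ) : Matrix (Fin n) (Fin n) ℝ).mulVec x = s

open Topology

namespace Setoid

variable {X : Type*} (r : Setoid X)

/-- The equivalence class of `x`. -/
def orbitClass (x : X) : Set X := {y | r x y}

/-- The saturation of a set: the union of the classes meeting it. -/
def saturation (s : Set X) : Set X := {x | ∃ y ∈ s, r x y}

/-- The points whose class has closure meeting `K`. -/
def closureMeets [TopologicalSpace X] (K : Set X) : Set X :=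
  {x | (closure (r.orbitClass x) ∩ K).Nonempty}

variable {r}

lemma closure_orbitClass_congr [TopologicalSpace X] {x y : X} (h : r x y) :
    closure (r.orbitClass x) = closure (r.orbitClass y) := by
  congr 1
  ext z
  exact ⟨fun hz => r.trans (r.symm h) hz, fun hz => r.trans h hz⟩

lemma closureMeets_congr [TopologicalSpace X] {K : Set X} {x y : X} (h : r x y) :
    x ∈ r.closureMeets K ↔ y ∈ r.closureMeets K := by
  simp only [closureMeets, Set.mem_ofPred_eq, closure_orbitClass_congr h]

lemma mem_saturation_of_mem_closure [TopologicalSpace X] {U : Set X} {x y : X}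
    (hU : IsOpen (r.saturation U)) (hy : y ∈ r.saturation U)
    (hxy : y ∈ closure (r.orbitClass x)) : x ∈ r.saturation U := by
  obtain ⟨w, ⟨v, hv, hwv⟩, hw⟩ := mem_closure_iff.1 hxy _ hU hy
  exact ⟨v, hv, r.trans hw hwv⟩

/-- Classes whose closures contain each other's base points coincide. -/
lemma rel_of_mem_closure [TopologicalSpace X]
    (hsat : ∀ U : Set X, IsOpen U → IsOpen (r.saturation U)) {x y : X}
    (hlc : IsLocallyClosed (r.orbitClass y))
    (hyx : y ∈ closure (r.orbitClass x)) (hxy : x ∈ closure (r.orbitClass y)) : r x y := by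
  obtain ⟨U, Z, hU, hZ, hUZ⟩ := hlc
  have hy : y ∈ U ∩ Z := hUZ ▸ r.refl y
  obtain ⟨w, hwU, hw⟩ := mem_closure_iff.1 hyx U hU hy.1
  have hwy : w ∈ closure (r.orbitClass y) := by
    rw [mem_closure_iff]
    intro V hV hwV
    obtain ⟨a, ⟨b, hb, hab⟩, ha⟩ := mem_closure_iff.1 hxy _ (hsat V hV) ⟨w, hwV, hw⟩
    exact ⟨b, hb, r.trans ha hab⟩
  have hwZ : w ∈ Z := by
    refine closure_minimal ?_ hZ hwy
    rw [hUZ]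
    exact Set.inter_subset_right
  have : w ∈ r.orbitClass y := hUZ ▸ ⟨hwU, hwZ⟩
  exact r.trans hw (r.symm this)

lemma measurableSet_closureMeets [MetricSpace X] [MeasurableSpace X] [BorelSpace X]
    (hsat : ∀ U : Set X, IsOpen U → IsOpen (r.saturation U)) {K : Set X} (hK : IsCompact K) :
    MeasurableSet (r.closureMeets K) := by
  have : r.closureMeets K =
      ⋂ m : ℕ, r.saturation (Metric.thickening (1 / ((m : ℝ) + 1)) K) := by
    ext x
    simp only [Set.mem_iInter]
    constructor
    · rintro ⟨y, hy, hyK⟩ m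
      have hδ : (0 : ℝ) < 1 / ((m : ℝ) + 1) := by positivity
      exact mem_saturation_of_mem_closure (hsat _ Metric.isOpen_thickening)
        ⟨y, Metric.self_subset_thickening hδ K hyK, r.refl y⟩ hy
    · intro h
      by_contra hne
      have hdisj : Disjoint K (closure (r.orbitClass x)) := by
        rw [Set.disjoint_iff_inter_eq_empty, Set.inter_comm]
        exact Set.not_nonempty_iff_eq_empty.1 hne
      obtain ⟨δ, hδ, hd⟩ := hdisj.exists_thickenings hK isClosed_closure
      obtain ⟨m, hm⟩ := exists_nat_one_div_lt hδ
      obtain ⟨y, hy, hxy⟩ := h m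
      exact Set.disjoint_left.1 hd (Metric.thickening_mono hm.le K hy)
        (Metric.self_subset_thickening hδ _ (subset_closure hxy))
  rw [this]
  exact MeasurableSet.iInter fun m => (hsat _ Metric.isOpen_thickening).measurableSet

/-- Points whose class meets `D` in a nonempty set that contains all its limit points in `D`. -/
def regularAt [TopologicalSpace X] (r : Setoid X) (D : Set X) : Set X :=
  {x | closure (r.orbitClass x) ∩ D ⊆ r.orbitClass x} ∩ r.closureMeets D

lemma regularAt_congr [TopologicalSpace X] {D : Set X} {x y : X} (h : r x y) :
    x ∈ r.regularAt D ↔ y ∈ r.regularAt D := by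
  have hc : r.orbitClass x = r.orbitClass y := by
    ext z
    exact ⟨fun hz => r.trans (r.symm h) hz, fun hz => r.trans h hz⟩
  simp only [regularAt, closureMeets, Set.mem_inter_iff, Set.mem_ofPred_eq, hc]

lemma measurableSet_regularAt [MetricSpace X] [SecondCountableTopology X]
    [MeasurableSpace X] [BorelSpace X]
    (hsat : ∀ U : Set X, IsOpen U → IsOpen (r.saturation U))
    (hlc : ∀ x, IsLocallyClosed (r.orbitClass x)) {D : Set X} (hD : IsCompact D) :
    MeasurableSet (r.regularAt D) := by
  refine MeasurableSet.inter ?_ (measurableSet_closureMeets hsat hD)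
  have : {x | closure (r.orbitClass x) ∩ D ⊆ r.orbitClass x} =
      (⋃ U ∈ TopologicalSpace.countableBasis X,
        r.saturation U ∩ r.closureMeets (D \ r.saturation U))ᶜ := by
    ext x
    simp only [Set.mem_compl_iff, Set.mem_iUnion, not_exists, Set.mem_ofPred_eq]
    constructor
    · rintro h U - ⟨⟨z, hz, hxz⟩, y, hy, hyD, hyU⟩
      exact hyU ⟨z, hz, r.trans (r.symm (h ⟨hy, hyD⟩)) hxz⟩
    · rintro h y ⟨hy, hyD⟩
      refine rel_of_mem_closure hsat (hlc y) hy ?_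
      rw [(TopologicalSpace.isBasis_countableBasis X).mem_closure_iff]
      intro U hU hxU
      by_contra hne
      refine h U hU ⟨⟨x, hxU, r.refl x⟩, y, hy, hyD, ?_⟩
      rintro ⟨z, hz, hyz⟩
      exact hne ⟨z, hz, hyz⟩
  rw [this]
  refine (MeasurableSet.biUnion (TopologicalSpace.countable_countableBasis X) fun U hU => ?_).compl
  have hUo := hsat U (TopologicalSpace.isOpen_of_mem_countableBasis hU)
  exact hUo.measurableSet.inter (measurableSet_closureMeets hsat (hD.diff hUo))

/-- Successive refinement of `B ∩ D`: at step `j`, cut every class that can be cut with `K j`. -/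
def refinement (r : Setoid X) (B : Set X) (K : ℕ → Set X) : ℕ → Set X
  | 0 => B
  | j + 1 => refinement r B K j ∩ (K j ∪ (r.saturation (refinement r B K j ∩ K j))ᶜ)

lemma refinement_antitone (B : Set X) (K : ℕ → Set X) : Antitone (r.refinement B K) :=
  antitone_nat_of_succ_le fun _ => Set.inter_subset_left

lemma saturation_refinement_succ (B : Set X) (K : ℕ → Set X) (j : ℕ) (L : Set X) :
    r.saturation (r.refinement B K (j + 1) ∩ L) =
      r.saturation (r.refinement B K j ∩ (K j ∩ L)) ∪
        (r.saturation (r.refinement B K j ∩ L) \ r.saturation (r.refinement B K j ∩ K j)) := by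
  ext x
  constructor
  · rintro ⟨y, ⟨⟨hy, hyK⟩, hyL⟩, hxy⟩
    by_cases hk : y ∈ K j
    · exact Or.inl ⟨y, ⟨hy, hk, hyL⟩, hxy⟩
    · refine Or.inr ⟨⟨y, ⟨hy, hyL⟩, hxy⟩, ?_⟩
      rintro ⟨z, hz, hxz⟩
      exact (hyK.resolve_left hk) ⟨z, hz, r.trans (r.symm hxy) hxz⟩
  · rintro (⟨y, ⟨hy, hk, hyL⟩, hxy⟩ | ⟨⟨y, ⟨hy, hyL⟩, hxy⟩, hn⟩)
    · exact ⟨y, ⟨⟨hy, Or.inl hk⟩, hyL⟩, hxy⟩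
    · refine ⟨y, ⟨⟨hy, Or.inr ?_⟩, hyL⟩, hxy⟩
      rintro ⟨z, hz, hyz⟩
      exact hn ⟨z, hz, r.trans hxy hyz⟩

/-- A Borel transversal for the classes that are regular at a compact set `D`. -/
lemma exists_transversal_regularAt [MetricSpace X] [SecondCountableTopology X]
    [MeasurableSpace X] [BorelSpace X]
    (hsat : ∀ U : Set X, IsOpen U → IsOpen (r.saturation U))
    (hlc : ∀ x, IsLocallyClosed (r.orbitClass x)) {D : Set X} (hD : IsCompact D)
    {K : ℕ → Set X} (hK : ∀ j, IsCompact (K j))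
    (hsep : ∀ x y, x ≠ y → ∃ j, x ∈ K j ∧ y ∉ K j) :
    ∃ C : Set X, MeasurableSet C ∧ ∀ x ∈ r.regularAt D, ∃! s, s ∈ C ∧ r x s := by
  set B := r.regularAt D ∩ D
  have hBm := measurableSet_regularAt hsat hlc hD
  have hmeas : ∀ j, ∀ L, IsCompact L → MeasurableSet (r.saturation (r.refinement B K j ∩ L)) := by
    intro j
    induction j with
    | zero =>
      intro L hL
      have : r.saturation (r.refinement B K 0 ∩ L) = r.regularAt D ∩ r.closureMeets (D ∩ L) := by
        ext x
        constructor
        · rintro ⟨y, ⟨⟨hyr, hyD⟩, hyL⟩, hxy⟩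
          exact ⟨(regularAt_congr hxy).2 hyr, y, subset_closure hxy, hyD, hyL⟩
        · rintro ⟨hx, y, hy, hyD, hyL⟩
          have hxy : r x y := hx.1 ⟨hy, hyD⟩
          exact ⟨y, ⟨⟨(regularAt_congr hxy).1 hx, hyD⟩, hyL⟩, hxy⟩
      rw [this]
      exact hBm.inter (measurableSet_closureMeets hsat (hD.inter hL))
    | succ j ih =>
      intro L hL
      rw [saturation_refinement_succ]
      exact (ih _ ((hK j).inter hL)).union ((ih _ hL).diff (ih _ (hK j)))
  have hRm : ∀ j, MeasurableSet (r.refinement B K j) := by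
    intro j
    induction j with
    | zero => exact hBm.inter hD.measurableSet
    | succ j ih => exact ih.inter ((hK j).measurableSet.union (hmeas j _ (hK j)).compl)
  refine ⟨⋂ j, r.refinement B K j, MeasurableSet.iInter hRm, fun x hx => ?_⟩
  have hcomp : ∀ j, IsCompact (r.orbitClass x ∩ r.refinement B K j) ∧
      (r.orbitClass x ∩ r.refinement B K j).Nonempty := by
    intro j
    induction j with
    | zero =>
      have : r.orbitClass x ∩ r.refinement B K 0 = closure (r.orbitClass x) ∩ D := by
        ext y
        constructor
        · rintro ⟨hy, -, hyD⟩
          exact ⟨subset_closure hy, hyD⟩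
        · intro hy
          have hxy : r x y := hx.1 hy
          exact ⟨hxy, (regularAt_congr hxy).1 hx, hy.2⟩
      rw [this]
      exact ⟨hD.inter_left isClosed_closure, hx.2⟩
    | succ j ih =>
      by_cases h : x ∈ r.saturation (r.refinement B K j ∩ K j)
      · have : r.orbitClass x ∩ r.refinement B K (j + 1) = (r.orbitClass x ∩ r.refinement B K j) ∩ K j := by
          ext y
          constructor
          · rintro ⟨hxy, hy, hyK⟩
            refine ⟨⟨hxy, hy⟩, hyK.resolve_right fun hn => hn ?_⟩
            obtain ⟨z, hz, hxz⟩ := h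
            exact ⟨z, hz, r.trans (r.symm hxy) hxz⟩
          · rintro ⟨⟨hxy, hy⟩, hyK⟩
            exact ⟨hxy, hy, Or.inl hyK⟩
        rw [this]
        obtain ⟨z, hz, hxz⟩ := h
        exact ⟨ih.1.inter (hK j), z, ⟨hxz, hz.1⟩, hz.2⟩
      · have : r.orbitClass x ∩ r.refinement B K (j + 1) = r.orbitClass x ∩ r.refinement B K j := by
          ext y
          constructor
          · rintro ⟨hxy, hy, -⟩
            exact ⟨hxy, hy⟩
          · rintro ⟨hxy, hy⟩
            refine ⟨hxy, hy, Or.inr ?_⟩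
            rintro ⟨z, hz, hyz⟩
            exact h ⟨z, hz, r.trans hxy hyz⟩
        rw [this]
        exact ih
  obtain ⟨s, hs⟩ := IsCompact.nonempty_iInter_of_sequence_nonempty_isCompact_isClosed
    (fun j => r.orbitClass x ∩ r.refinement B K j)
    (fun j => Set.inter_subset_inter_right _ (refinement_antitone B K (Nat.le_succ j)))
    (fun j => (hcomp j).2) (hcomp 0).1 (fun j => (hcomp j).1.isClosed)
  rw [Set.mem_iInter] at hs
  refine ⟨s, ⟨Set.mem_iInter.2 fun j => (hs j).2, (hs 0).1⟩, ?_⟩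
  rintro t ⟨ht, hxt⟩
  rw [Set.mem_iInter] at ht
  by_contra hne
  obtain ⟨j, hsj, htj⟩ := hsep s t (Ne.symm hne)
  exact ((ht (j + 1)).2.resolve_left htj)
    ⟨s, ⟨(hs j).2, hsj⟩, r.trans (r.symm hxt) (hs 0).1⟩

/-- In a locally compact second countable metric space, an equivalence relation with locally
closed classes for which saturations of open sets are open has a Borel transversal. -/
theorem exists_measurableSet_transversal [MetricSpace X] [LocallyCompactSpace X]
    [SecondCountableTopology X] [MeasurableSpace X] [BorelSpace X]
    (hsat : ∀ U : Set X, IsOpen U → IsOpen (r.saturation U))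
    (hlc : ∀ x, IsLocallyClosed (r.orbitClass x)) :
    ∃ C : Set X, MeasurableSet C ∧ ∀ x, ∃! s, s ∈ C ∧ r x s := by
  have hfam : ∃ K : ℕ → Set X, (∀ j, IsCompact (K j)) ∧
      ∀ x, ∀ W : Set X, IsOpen W → x ∈ W → ∃ j, x ∈ K j ∧ K j ⊆ W := by
    have hc : ({s | ∃ U ∈ TopologicalSpace.countableBasis X, IsCompact (closure U) ∧
        s = closure U} ∪ {∅} : Set (Set X)).Countable := by
      refine (((TopologicalSpace.countable_countableBasis X).image closure).mono ?_).union
        (Set.countable_singleton _)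
      rintro _ ⟨U, hU, -, rfl⟩
      exact ⟨U, hU, rfl⟩
    obtain ⟨K, hK⟩ := hc.exists_eq_range ⟨∅, Or.inr rfl⟩
    refine ⟨K, fun j => ?_, fun x W hW hx => ?_⟩
    · have : K j ∈ Set.range K := ⟨j, rfl⟩
      rw [← hK] at this
      rcases this with ⟨U, -, hU, h⟩ | h
      · rwa [h]
      · rw [Set.mem_singleton_iff.1 h]
        exact isCompact_empty
    · obtain ⟨L, hL, hxL, hLW⟩ := exists_compact_subset hW hx
      obtain ⟨U, hU, hxU, hUL⟩ := (TopologicalSpace.isBasis_countableBasis X).exists_subset_of_mem_open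
        hxL isOpen_interior
      have hcl : closure U ⊆ L := closure_minimal (hUL.trans interior_subset) hL.isClosed
      have : closure U ∈ Set.range K := by
        rw [← hK]
        exact Or.inl ⟨U, hU, hL.of_isClosed_subset isClosed_closure hcl, rfl⟩
      obtain ⟨j, hj⟩ := this
      exact ⟨j, hj ▸ subset_closure hxU, hj ▸ hcl.trans hLW⟩
  obtain ⟨K, hK, hKW⟩ := hfam
  have hsep : ∀ x y, x ≠ y → ∃ j, x ∈ K j ∧ y ∉ K j := by
    intro x y hxy
    obtain ⟨j, hj, hjW⟩ := hKW x {y}ᶜ isOpen_compl_singleton hxy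
    exact ⟨j, hj, fun hy => hjW hy rfl⟩
  have hreg : ∀ x, ∃ j, x ∈ r.regularAt (K j) := by
    intro x
    obtain ⟨U, Z, hU, hZ, hUZ⟩ := hlc x
    have hx : x ∈ U ∩ Z := hUZ ▸ r.refl x
    obtain ⟨j, hj, hjU⟩ := hKW x U hU hx.1
    refine ⟨j, ?_, x, subset_closure (r.refl x), hj⟩
    rintro y ⟨hy, hyK⟩
    rw [hUZ]
    refine ⟨hjU hyK, closure_minimal ?_ hZ hy⟩
    rw [hUZ]
    exact Set.inter_subset_right
  choose C hC hCu using fun k => exists_transversal_regularAt hsat hlc (hK k) hK hsep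
  refine ⟨⋃ k, C k ∩ disjointed (fun j => r.regularAt (K j)) k,
    MeasurableSet.iUnion fun k => (hC k).inter
      (MeasurableSet.disjointed (fun j => measurableSet_regularAt hsat hlc (hK j)) k), fun x => ?_⟩
  have hcongr : ∀ {y z : X} (k : ℕ), r y z →
      y ∈ disjointed (fun j => r.regularAt (K j)) k →
      z ∈ disjointed (fun j => r.regularAt (K j)) k := by
    intro y z k hyz hy
    rw [disjointed_eq_inter_compl] at hy ⊢
    simp only [Set.mem_inter_iff, Set.mem_iInter, Set.mem_compl_iff] at hy ⊢
    exact ⟨(regularAt_congr hyz).1 hy.1, fun i hi h => hy.2 i hi ((regularAt_congr hyz).2 h)⟩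
  have hxk : x ∈ ⋃ k, disjointed (fun j => r.regularAt (K j)) k := by
    rw [iUnion_disjointed]
    exact Set.mem_iUnion.2 (hreg x)
  obtain ⟨k, hk⟩ := Set.mem_iUnion.1 hxk
  obtain ⟨s, ⟨hsC, hxs⟩, hu⟩ := hCu k x (disjointed_subset _ k hk)
  refine ⟨s, ⟨Set.mem_iUnion.2 ⟨k, hsC, hcongr k hxs hk⟩, hxs⟩, ?_⟩
  rintro t ⟨ht, hxt⟩
  obtain ⟨l, htC, htl⟩ := Set.mem_iUnion.1 ht
  have hkl : k = l := by
    by_contra hne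
    exact Set.disjoint_left.1 (disjoint_disjointed _ hne) hk (hcongr l (r.symm hxt) htl)
  subst hkl
  exact hu t ⟨htC, hxt⟩

end Setoid

/-- In a subalgebra of a matrix algebra over `ℝ`, inverses of elements stay inside. -/
lemma Subalgebra.inv_coe_mem_of_coe_mem {n : ℕ} (𝒜 : Subalgebra ℝ (Matrix (Fin n) (Fin n) ℝ))
    (u : GL (Fin n) ℝ) (hu : (u : Matrix (Fin n) (Fin n) ℝ) ∈ 𝒜) :
    ((u⁻¹ : GL (Fin n) ℝ) : Matrix (Fin n) (Fin n) ℝ) ∈ 𝒜 := by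
  have hinj : Function.Injective (LinearMap.mulLeft ℝ (⟨u, hu⟩ : 𝒜)) := by
    intro a b hab
    have h : (u : Matrix (Fin n) (Fin n) ℝ) * a = u * b := congrArg Subtype.val hab
    exact Subtype.ext (u.isUnit.mul_left_cancel h)
  obtain ⟨b, hb⟩ := LinearMap.injective_iff_surjective.1 hinj 1
  have h : (u : Matrix (Fin n) (Fin n) ℝ) * b = 1 := congrArg Subtype.val hb
  rw [Units.inv_eq_of_mul_eq_one_right h]
  exact b.2

lemma Matrix.isOpen_image_coe_GL {n : ℕ} {S : Set (GL (Fin n) ℝ)} (hS : IsOpen S) :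
    IsOpen ((fun u : GL (Fin n) ℝ => (u : Matrix (Fin n) (Fin n) ℝ)) '' S) := by
  let R : NormedRing (Matrix (Fin n) (Fin n) ℝ) := Matrix.linftyOpNormedRing
  let _ : NormedAlgebra ℝ (Matrix (Fin n) (Fin n) ℝ) := Matrix.linftyOpNormedAlgebra
  have _ : @CompleteSpace (Matrix (Fin n) (Fin n) ℝ)
      R.toMetricSpace.toPseudoMetricSpace.toUniformSpace := FiniteDimensional.complete ℝ _
  exact (Units.isOpenEmbedding_val (R := Matrix (Fin n) (Fin n) ℝ)).isOpenMap S hS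

/-- If `stab(x)·H` is closed, then the `H`-orbit of `x` is locally closed. -/
lemma isLocallyClosed_orbit_of_isClosed_stabilizer_mul {n : ℕ} {H : Subgroup (GL (Fin n) ℝ)}
    {𝒜 : Subalgebra ℝ (Matrix (Fin n) (Fin n) ℝ)}
    (hAcomm : ∀ a ∈ 𝒜, ∀ b ∈ 𝒜, Commute a b)
    (hHA : ∀ g ∈ H, (g : Matrix (Fin n) (Fin n) ℝ) ∈ 𝒜) {x : Fin n → ℝ}
    (hstab : IsClosed {u : GL (Fin n) ℝ | ∃ g h : GL (Fin n) ℝ,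
      ((g : Matrix (Fin n) (Fin n) ℝ) ∈ 𝒜 ∧ ((g⁻¹ : GL (Fin n) ℝ) : Matrix (Fin n) (Fin n) ℝ) ∈ 𝒜) ∧
      (g : Matrix (Fin n) (Fin n) ℝ).mulVec x = x ∧ h ∈ H ∧ u = g * h}) :
    IsLocallyClosed {y | ∃ h ∈ H, (h : Matrix (Fin n) (Fin n) ℝ).mulVec x = y} := by
  set T := {u : GL (Fin n) ℝ | ∃ g h : GL (Fin n) ℝ,
      ((g : Matrix (Fin n) (Fin n) ℝ) ∈ 𝒜 ∧ ((g⁻¹ : GL (Fin n) ℝ) : Matrix (Fin n) (Fin n) ℝ) ∈ 𝒜) ∧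
      (g : Matrix (Fin n) (Fin n) ℝ).mulVec x = x ∧ h ∈ H ∧ u = g * h}
  let φ : 𝒜 →ₗ[ℝ] (Fin n → ℝ) :=
    ((Matrix.mulVecBilin ℝ ℝ).flip x).comp (Subalgebra.toSubmodule 𝒜).subtype
  have _ : IsTopologicalAddGroup 𝒜 := (Subalgebra.toSubmodule 𝒜).topologicalAddGroup
  have hφ : ∀ a : 𝒜, φ a = (a : Matrix (Fin n) (Fin n) ℝ).mulVec x := fun a => rfl
  have hopen : ∀ S : Set (GL (Fin n) ℝ), IsOpen S →
      ∃ V : Set (Fin n → ℝ), IsOpen V ∧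
        V ∩ (LinearMap.range φ : Set (Fin n → ℝ)) =
          {y | ∃ u ∈ S, (u : Matrix (Fin n) (Fin n) ℝ) ∈ 𝒜 ∧
            (u : Matrix (Fin n) (Fin n) ℝ).mulVec x = y} := by
    intro S hS
    have h1 : IsOpen ((↑) ⁻¹' ((fun u : GL (Fin n) ℝ => (u : Matrix (Fin n) (Fin n) ℝ)) '' S) :
        Set 𝒜) := (Matrix.isOpen_image_coe_GL hS).preimage continuous_subtype_val
    have h2 := φ.rangeRestrict.isOpenMap_of_finiteDimensional φ.surjective_rangeRestrict _ h1
    obtain ⟨V, hV, hVeq⟩ := isOpen_induced_iff.1 h2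
    refine ⟨V, hV, ?_⟩
    ext y
    constructor
    · rintro ⟨hyV, hy⟩
      have : (⟨y, hy⟩ : LinearMap.range φ) ∈ (Subtype.val ⁻¹' V : Set (LinearMap.range φ)) := hyV
      rw [hVeq] at this
      obtain ⟨a, ⟨u, hu, hua⟩, hay⟩ := this
      have hua' : (u : Matrix (Fin n) (Fin n) ℝ) = a := hua
      refine ⟨u, hu, hua' ▸ a.2, ?_⟩
      rw [hua', ← hφ]
      exact congrArg Subtype.val hay
    · rintro ⟨u, hu, huA, rfl⟩
      have hr : (u : Matrix (Fin n) (Fin n) ℝ).mulVec x ∈ LinearMap.range φ := ⟨⟨u, huA⟩, rfl⟩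
      refine ⟨?_, hr⟩
      have : (⟨_, hr⟩ : LinearMap.range φ) ∈ (Subtype.val ⁻¹' V : Set (LinearMap.range φ)) := by
        rw [hVeq]
        exact ⟨⟨u, huA⟩, ⟨u, hu, rfl⟩, rfl⟩
      exact this
  obtain ⟨V, hV, hVeq⟩ := hopen Set.univ isOpen_univ
  obtain ⟨W, hW, hWeq⟩ := hopen Tᶜ hstab.isOpen_compl
  refine ⟨V, (LinearMap.range φ : Set (Fin n → ℝ)) \ W, hV,
    (Submodule.closed_of_finiteDimensional _).sdiff hW, ?_⟩
  ext y
  constructor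
  · rintro ⟨h, hh, rfl⟩
    have hV' : (h : Matrix (Fin n) (Fin n) ℝ).mulVec x ∈
        V ∩ (LinearMap.range φ : Set (Fin n → ℝ)) := by
      rw [hVeq]
      exact ⟨h, trivial, hHA h hh, rfl⟩
    refine ⟨hV'.1, hV'.2, fun hyW => ?_⟩
    obtain ⟨u, huT, huA, hux⟩ := (Set.ext_iff.1 hWeq _).1 ⟨hyW, hV'.2⟩
    refine huT ⟨u * h⁻¹, h, ?_, ?_, hh, by group⟩
    · have hm : ((u * h⁻¹ : GL (Fin n) ℝ) : Matrix (Fin n) (Fin n) ℝ) ∈ 𝒜 := by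
        rw [Units.val_mul]
        exact 𝒜.mul_mem huA (hHA _ (H.inv_mem hh))
      exact ⟨hm, 𝒜.inv_coe_mem_of_coe_mem _ hm⟩
    · rw [Units.val_mul, (hAcomm _ huA _ (hHA _ (H.inv_mem hh))).eq, ← Matrix.mulVec_mulVec, hux,
        Matrix.mulVec_mulVec, ← Units.val_mul, inv_mul_cancel, Units.val_one, Matrix.one_mulVec]
  · rintro ⟨hyV, hy, hyW⟩
    obtain ⟨u, -, huA, rfl⟩ := (Set.ext_iff.1 hVeq _).1 ⟨hyV, hy⟩
    have huT : u ∈ T := by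
      by_contra hn
      exact hyW ((Set.ext_iff.1 hWeq _).2 ⟨u, hn, huA, rfl⟩).1
    obtain ⟨g, h, ⟨hgA, -⟩, hgx, hh, rfl⟩ := huT
    refine ⟨h, hh, ?_⟩
    rw [Units.val_mul, (hAcomm _ hgA _ (hHA h hh)).eq, ← Matrix.mulVec_mulVec, hgx]

/-- Let `H` be an abelian subgroup of `GL(n,ℝ)` contained in a commutative unital
subalgebra `𝒜` of `M_n(ℝ)` with unit group `𝒜ˣ`. If there is an `H`-invariant open
conull set `O ⊆ ℝⁿ` such that `stab_{𝒜ˣ}(x)·H` is closed in `GL(n,ℝ)` for every `x ∈ O`,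
then a measurable fundamental domain for the `H`-action exists. -/
theorem exists_fundamental_domain_of_closed_stabilizer_products
    (n : ℕ) (H : Subgroup (GL (Fin n) ℝ))
    (habelian : ∀ a ∈ H, ∀ b ∈ H, a * b = b * a)
    (𝒜 : Subalgebra ℝ (Matrix (Fin n) (Fin n) ℝ))
    (hAcomm : ∀ a ∈ 𝒜, ∀ b ∈ 𝒜, Commute a b)
    (hHA : ∀ g ∈ H, ((g : GL (Fin n) ℝ) : Matrix (Fin n) (Fin n) ℝ) ∈ 𝒜)
    (O : Set (Fin n → ℝ)) (hO : IsOpen O)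
    (hOinv : ∀ h ∈ H, ∀ x ∈ O, ((h : GL (Fin n) ℝ) : Matrix (Fin n) (Fin n) ℝ).mulVec x ∈ O)
    (hOconull : volume Oᶜ = 0)
    (hstab : ∀ x ∈ O, IsClosed {u : GL (Fin n) ℝ | ∃ g h : GL (Fin n) ℝ,
      ((g : Matrix (Fin n) (Fin n) ℝ) ∈ 𝒜 ∧ ((g⁻¹ : GL (Fin n) ℝ) : Matrix (Fin n) (Fin n) ℝ) ∈ 𝒜) ∧
      (g : Matrix (Fin n) (Fin n) ℝ).mulVec x = x ∧ h ∈ H ∧ u = g * h}) :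
    HasMeasFundamentalDomain n H := by
  let r : Setoid O :=
    { r := fun x y => ∃ h ∈ H, (h : Matrix (Fin n) (Fin n) ℝ).mulVec x = (y : Fin n → ℝ)
      iseqv :=
        { refl := fun x => ⟨1, H.one_mem, by simp⟩
          symm := by
            rintro x y ⟨h, hh, hxy⟩
            refine ⟨h⁻¹, H.inv_mem hh, ?_⟩
            rw [← hxy, Matrix.mulVec_mulVec, ← Units.val_mul, inv_mul_cancel, Units.val_one,
              Matrix.one_mulVec]
          trans := by
            rintro x y z ⟨h, hh, hxy⟩ ⟨k, hk, hyz⟩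
            refine ⟨k * h, H.mul_mem hk hh, ?_⟩
            rw [Units.val_mul, ← Matrix.mulVec_mulVec, hxy, hyz] } }
  have hsat : ∀ U : Set O, IsOpen U → IsOpen (r.saturation U) := by
    intro U hU
    have : r.saturation U = ⋃ h : H, (fun x : O => (⟨((h : GL (Fin n) ℝ) :
        Matrix (Fin n) (Fin n) ℝ).mulVec x, hOinv h h.2 x x.2⟩ : O)) ⁻¹' U := by
      ext x
      simp only [Set.mem_iUnion, Set.mem_preimage]
      constructor
      · rintro ⟨y, hy, h, hh, hxy⟩
        refine ⟨⟨h, hh⟩, ?_⟩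
        convert hy
      · rintro ⟨h, hx⟩
        exact ⟨_, hx, h, h.2, rfl⟩
    rw [this]
    refine isOpen_iUnion fun h => hU.preimage ?_
    exact (continuous_const.matrix_mulVec continuous_subtype_val).subtype_mk _
  have hlc : ∀ x, IsLocallyClosed (r.orbitClass x) := fun x =>
    (isLocallyClosed_orbit_of_isClosed_stabilizer_mul hAcomm hHA (hstab x x.2)).preimage
      continuous_subtype_val
  have : LocallyCompactSpace O := hO.locallyCompactSpace
  obtain ⟨C, hC, hCu⟩ := Setoid.exists_measurableSet_transversal hsat hlc
  refine ⟨Subtype.val '' C, O, hO.measurableSet.subtype_image hC, hO.measurableSet, hOinv,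
    hOconull, Subtype.coe_image_subset _ _, fun x hx => ?_⟩
  obtain ⟨s, ⟨hsC, hs⟩, hu⟩ := hCu ⟨x, hx⟩
  refine ⟨s, ⟨⟨s, hsC, rfl⟩, hs⟩, ?_⟩
  rintro _ ⟨⟨t, htC, rfl⟩, ht⟩
  exact congrArg Subtype.val (hu t ⟨htC, ht⟩)
end
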